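/- Let π ∈ ℤ[i] be a primary prime with p = π·π̄, let χ̃_π be the associated Hecke character of weight one, and let a_π be the rational integer attached to the elliptic Gauss sum coefficient. Then ϖ^{−2}·L(1, χ̃_π)² equals: 2^{−1}·i·χ_π(2)·p^{1/4}·a_π²·G₄(π)^{−1} if p ≡ 13 (mod 16); i·p^{1/4}·a_π²·G₄(π)^{−1} if p ≡ 5 (mod 16); −2·χ̄_π(1+i)·p^{1/4}·a_π²·G₄(π)^{−1} if p ≡ 1 (mod 16) and χ_π(2) = 1; −χ̄_π(1+i)·p^{1/4}·a_π²·G₄(π)^{−1} if p ≡ 1 (mod 16) and χ_π(2) = −1; 2i·χ̄_π(1+i)·p^{1/4}·a_π²·G₄(π)^{−1} if p ≡ 9 (mod 16) and χ_π(2) = 1; and i·χ̄_π(1+i)·p^{1/4}·a_π²·G₄(π)^{−1} if p ≡ 9 (mod 16) and χ_π(2) = −1. -/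

import Mathlib

open Complex BigOperators

noncomputable section

/-- The ring of Gaussian integers `ℤ[i]`, realized as a subring of `ℂ`. -/
def O4 : Subring ℂ := Subring.closure {Complex.I}

/-- `ζ₈ = e^{2πi/8}`, a primitive eighth root of unity. -/
def zeta8 : ℂ := Complex.exp (2 * Real.pi * Complex.I / 8)

/-- The ring `ℤ[ζ₈]`, realized as a subring of `ℂ`. -/
def O8 : Subring ℂ := Subring.closure {zeta8}

/-- The congruence `a ≡ b (mod c)` in `ℤ[i]`. -/
def GCong (a b c : ℂ) : Prop := ∃ d ∈ O4, a - b = c * d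

/-- `a` and `b` are coprime in `ℤ[i]`. -/
def GCoprime (a b : ℂ) : Prop := ∃ u ∈ O4, ∃ v ∈ O4, u * a + v * b = 1

/-- The real period `ϖ = 2∫₀¹ (1−x⁴)^{−1/2} dx`. -/
def varpi : ℝ := 2 * ∫ x in (0:ℝ)..(1:ℝ), (1 - x ^ 4) ^ (-(1:ℝ)/2)

/-- The points of the period lattice `ϖ·ℤ[i]`. -/
def ω4 (m : ℤ × ℤ) : ℂ := (varpi : ℂ) * ((m.1 : ℂ) + (m.2 : ℂ) * Complex.I)

/-- The Weierstrass `℘`-function of the period lattice `ϖ·ℤ[i]`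
(so that `℘′² = 4℘³ − 4℘`). -/
def wp4 (u : ℂ) : ℂ :=
  (u ^ 2)⁻¹ + ∑' m : ℤ × ℤ, if m = 0 then 0 else (((u - ω4 m) ^ 2)⁻¹ - ((ω4 m) ^ 2)⁻¹)

/-- The derivative `℘′` of the Weierstrass `℘`-function of `ϖ·ℤ[i]`. -/
def wp4' (u : ℂ) : ℂ := ∑' m : ℤ × ℤ, (-2) * ((u - ω4 m) ^ 3)⁻¹

/-- The Weierstrass `ζ`-function of the period lattice `ϖ·ℤ[i]`. -/
def wzeta4 (u : ℂ) : ℂ :=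
  u⁻¹ + ∑' m : ℤ × ℤ, if m = 0 then 0 else ((u - ω4 m)⁻¹ + (ω4 m)⁻¹ + u * ((ω4 m) ^ 2)⁻¹)

/-- The non-analytic doubly periodic function `Z(u) = ζ(ϖu) − (π/ϖ)·ū`. -/
def Z4 (u : ℂ) : ℂ :=
  wzeta4 ((varpi : ℂ) * u) - ((Real.pi / varpi : ℝ) : ℂ) * (starRingEnd ℂ) u

/-- The lemniscatic sine `φ(u) = sl((1−i)ϖu) = −2(1−i)·℘(ϖu)/℘′(ϖu)`,
of period lattice `ℤ[i]`. -/
def phi4 (u : ℂ) : ℂ :=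
  -2 * (1 - Complex.I) * wp4 ((varpi : ℂ) * u) / wp4' ((varpi : ℂ) * u)

/-- The lemniscatic cosine `ψ(u) = cl((1−i)ϖu) = (℘(ϖu)+i)/(℘(ϖu)−i)`,
of period lattice `ℤ[i]`. -/
def psi4 (u : ℂ) : ℂ :=
  (wp4 ((varpi : ℂ) * u) + Complex.I) / (wp4 ((varpi : ℂ) * u) - Complex.I)

/-- A residue class character modulo `β` on `ℤ[i]`. -/
structure IsResChar4 (β : ℂ) (χ : ℂ → ℂ) : Prop where
  periodic : ∀ a ∈ O4, ∀ b ∈ O4, GCong a b β → χ a = χ b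
  map_mul : ∀ a ∈ O4, ∀ b ∈ O4, χ (a * b) = χ a * χ b
  map_one : χ 1 = 1
  vanish : ∀ a ∈ O4, ¬ GCoprime a β → χ a = 0

/-- The quartic residue character `χ_π = (·/π)₄` modulo a prime `π` with `p = π·π̄`:
`χ_π(ν)⁴ = 1` and `χ_π(ν) ≡ ν^{(p−1)/4} (mod π)`. -/
structure IsQuarticChar (π : ℂ) (p : ℕ) (χ : ℂ → ℂ) : Prop where
  resChar : IsResChar4 π χ
  quart : ∀ ν ∈ O4, GCoprime ν π → χ ν ^ 4 = 1
  euler : ∀ ν ∈ O4, GCoprime ν π → GCong (χ ν) (ν ^ ((p - 1) / 4)) π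

/-- The elliptic Gauss sum `G_π(χ, f) = (1/4)·Σ_{ν ∈ (ℤ[i]/(π))^×} χ(ν)·f(ν/π)`,
computed via the integer representatives `1, …, p−1` of `(ℤ[i]/(π))^× ≅ (ℤ/p)^×`. -/
def EGS4 (p : ℕ) (χ f : ℂ → ℂ) (π : ℂ) : ℂ :=
  (1/4 : ℂ) * ∑ r ∈ Finset.Icc 1 (p - 1), χ (r : ℂ) * f ((r : ℂ) / π)

/-- `S` is a quarter set of `(ℤ[i]/(π))^×`, i.e. `(ℤ[i]/(π))^× = S ∪ −S ∪ iS ∪ −iS`. -/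
def IsQuarterSet (π : ℂ) (S : Finset ℂ) : Prop :=
  (∀ ν ∈ S, ν ∈ O4 ∧ GCoprime ν π) ∧
  (∀ a ∈ O4, GCoprime a π →
    ∃ ν ∈ S, ∃ ε ∈ ({1, -1, Complex.I, -Complex.I} : Set ℂ), GCong a (ε * ν) π) ∧
  (∀ ν ∈ S, ∀ μ ∈ S, ∀ ε ∈ ({1, -1, Complex.I, -Complex.I} : Set ℂ),
    ∀ ε' ∈ ({1, -1, Complex.I, -Complex.I} : Set ℂ),
      GCong (ε * ν) (ε' * μ) π → ν = μ ∧ ε = ε')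

/-- `γ(S)`: if `p ≡ 5 (mod 8)`, the fourth root of unity with
`γ(S) ≡ ∏_{ν∈S} ν (mod π)`; if `p ≡ 1 (mod 8)`, the fourth root of `−1` with
`γ(S) ≡ ∏_{ν∈S} ν (mod Π)` for a fixed prime `Π` of `ℤ[ζ₈]` with `π = Π·Π′`. -/
def IsGamma4 (π : ℂ) (p : ℕ) (S : Finset ℂ) (γ : ℂ) : Prop :=
  (p % 8 = 5 → γ ^ 4 = 1 ∧ GCong γ (∏ ν ∈ S, ν) π) ∧
  (p % 8 = 1 → γ ^ 4 = -1 ∧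
    ∃ P : O8, Prime P ∧ (∃ Q : O8, π = (P : ℂ) * (Q : ℂ)) ∧
      ∃ d ∈ O8, γ - ∏ ν ∈ S, ν = (P : ℂ) * d)

/-- `L` is the value at `s = 1` of the analytic continuation of the Hecke `L`-series
`L(s, χ̃) = Σ_𝔞 χ̃(𝔞)·N𝔞^{−s} = (1/4)·Σ_{ν ∈ ℤ[i]} χ₁(ν)·ν̄·|ν|^{−2s}` attached to the
weight-one Hecke character `χ̃((ν)) = χ₁(ν)·ν̄` of `ℚ(i)`. -/
def IsLValue4 (χ₁ : ℂ → ℂ) (L : ℂ) : Prop :=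
  ∃ F : ℂ → ℂ, DifferentiableOn ℂ F {s : ℂ | 0 < s.re} ∧
    (∀ s : ℂ, 3/2 < s.re →
      F s = (1/4 : ℂ) *
        ∑' ν : O4, χ₁ (ν : ℂ) * (starRingEnd ℂ) (ν : ℂ) *
          ((Complex.normSq (ν : ℂ) : ℂ) ^ (-s))) ∧
    F 1 = L

/-- `T` is a complete residue system modulo `β` in `ℤ[i]`. -/
def IsCRS4 (β : ℂ) (T : Finset ℂ) : Prop :=
  (∀ a ∈ T, a ∈ O4) ∧ (∀ a ∈ T, ∀ b ∈ T, GCong a b β → a = b) ∧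
  (∀ z ∈ O4, ∃ a ∈ T, GCong z a β)

/-- `e^{2πi·Re(z)}`. -/
def eRe4 (z : ℂ) : ℂ := Complex.exp (2 * Real.pi * Complex.I * (z.re : ℂ))

/-- `χ₀`: the character mod `(1+i)³` giving the natural isomorphism
`(ℤ[i]/(1+i)³)^× ≅ W`, i.e. `χ₀(ν) = ε` for `ν ≡ ε (mod (1+i)³)`, `ε ∈ W = {±1, ±i}`. -/
def IsChi0₄ (χ₀ : ℂ → ℂ) : Prop :=
  IsResChar4 ((1 + Complex.I) ^ 3) χ₀ ∧
    ∀ ε ∈ ({1, -1, Complex.I, -Complex.I} : Set ℂ), χ₀ ε = ε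

/-- `χ₀′`: the character mod `(1+i)² = 2i` giving `(ℤ[i]/(2))^× ≅ {±1}`, i.e.
`χ₀′(ν) = δ²` for `ν ≡ δ (mod (1+i)²)`, `δ ∈ {1, i}`. -/
def IsChi0'₄ (χ₀' : ℂ → ℂ) : Prop :=
  IsResChar4 2 χ₀' ∧ χ₀' Complex.I = -1

/-- The classical quartic Gauss sum `G₄(π) = Σ_{r=1}^{p−1} (r/π)₄·e^{2πir/p}`. -/
def G4sum (p : ℕ) (χ : ℂ → ℂ) : ℂ :=
  ∑ r ∈ Finset.Icc 1 (p - 1), χ (r : ℂ) * Complex.exp (2 * Real.pi * Complex.I * (r : ℂ) / (p : ℂ))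


section

open Filter Asymptotics Set HurwitzZeta

/-- The Gaussian integer attached to a pair of integers. -/
def gi (m : ℤ × ℤ) : ℂ := (m.1 : ℂ) + (m.2 : ℂ) * Complex.I

@[simp] lemma gi_re (m : ℤ × ℤ) : (gi m).re = m.1 := by simp [gi]
@[simp] lemma gi_im (m : ℤ × ℤ) : (gi m).im = m.2 := by simp [gi]

/-- The theta function `Σ_m conj (u + m) exp (-π t |u + m|²)` over the Gaussian integers, written
with Mathlib's one-dimensional kernels. -/
def cTheta (u : ℂ) (t : ℝ) : ℂ :=
  oddKernel (u.re : ℝ) t * evenKernel (u.im : ℝ) t -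
    I * (evenKernel (u.re : ℝ) t * oddKernel (u.im : ℝ) t)

/-- The dual theta function `-i Σ_m conj m · exp (2πi Re (u conj m)) exp (-π t |m|²)`. -/
def cThetaHat (u : ℂ) (t : ℝ) : ℂ :=
  sinKernel (u.re : ℝ) t * cosKernel (u.im : ℝ) t -
    I * (cosKernel (u.re : ℝ) t * sinKernel (u.im : ℝ) t)

lemma HasSum.prod_mul_complex {f g : ℤ → ℂ} {a b : ℂ} (hf : HasSum f a) (hg : HasSum g b) :
    HasSum (fun m : ℤ × ℤ => f m.1 * g m.2) (a * b) :=
  hf.mul hg (summable_mul_of_summable_norm hf.summable.norm hg.summable.norm)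

lemma HasSum.congr_fun_eq {ι : Type*} {f g : ι → ℂ} {a : ℂ} (hf : HasSum f a)
    (h : ∀ i, g i = f i) : HasSum g a := by
  rwa [funext h]

lemma hasSum_cTheta (u : ℂ) {t : ℝ} (ht : 0 < t) :
    HasSum (fun m => (starRingEnd ℂ) (u + gi m) * Real.exp (-Real.pi * normSq (u + gi m) * t))
      (cTheta u t) := by
  have e1 := Complex.hasSum_ofReal.2 (hasSum_int_evenKernel u.re ht)
  have e2 := Complex.hasSum_ofReal.2 (hasSum_int_evenKernel u.im ht)
  have o1 := Complex.hasSum_ofReal.2 (hasSum_int_oddKernel u.re ht)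
  have o2 := Complex.hasSum_ofReal.2 (hasSum_int_oddKernel u.im ht)
  have := (o1.prod_mul_complex e2).sub ((e1.prod_mul_complex o2).mul_left I)
  rw [cTheta]
  refine this.congr_fun_eq fun m => ?_
  have h1 : Real.exp (-Real.pi * normSq (u + gi m) * t) =
      Real.exp (-Real.pi * (m.1 + u.re) ^ 2 * t) * Real.exp (-Real.pi * (m.2 + u.im) ^ 2 * t) := by
    rw [← Real.exp_add]
    congr 1
    simp [normSq_apply]
    ring
  have h2 : (starRingEnd ℂ) (u + gi m) = (m.1 + u.re : ℝ) - I * (m.2 + u.im : ℝ) := by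
    apply Complex.ext <;> simp [add_comm]
  rw [h1, h2]
  push_cast
  ring

lemma hasSum_cThetaHat (u : ℂ) {t : ℝ} (ht : 0 < t) :
    HasSum (fun m => -I * (starRingEnd ℂ) (gi m) * eRe4 (u * (starRingEnd ℂ) (gi m)) *
      Real.exp (-Real.pi * normSq (gi m) * t)) (cThetaHat u t) := by
  have e1 := hasSum_int_cosKernel u.re ht
  have e2 := hasSum_int_cosKernel u.im ht
  have o1 := hasSum_int_sinKernel u.re ht
  have o2 := hasSum_int_sinKernel u.im ht
  have := (o1.prod_mul_complex e2).sub ((e1.prod_mul_complex o2).mul_left I)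
  rw [cThetaHat]
  refine this.congr_fun_eq fun m => ?_
  have h1 : Real.exp (-Real.pi * normSq (gi m) * t) =
      Real.exp (-Real.pi * m.1 ^ 2 * t) * Real.exp (-Real.pi * m.2 ^ 2 * t) := by
    rw [← Real.exp_add]
    congr 1
    simp [normSq_apply]
    ring
  have h2 : (starRingEnd ℂ) (gi m) = m.1 - I * m.2 := by
    apply Complex.ext <;> simp
  have h3 : eRe4 (u * (starRingEnd ℂ) (gi m)) =
      cexp (2 * Real.pi * I * u.re * m.1) * cexp (2 * Real.pi * I * u.im * m.2) := by
    rw [eRe4, ← Complex.exp_add]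
    congr 1
    simp
    ring
  rw [h1, h3, h2]
  push_cast
  ring

lemma cTheta_functional_equation (u : ℂ) {t : ℝ} (ht : 0 < t) :
    cTheta u t = ((t ^ 2)⁻¹ : ℝ) * cThetaHat u t⁻¹ := by
  have h : (1 / t ^ (3 / 2 : ℝ)) * (1 / t ^ (1 / 2 : ℝ)) = (t ^ 2)⁻¹ := by
    rw [one_div, one_div, ← mul_inv, ← Real.rpow_add ht]
    norm_num
  rw [cTheta, cThetaHat, ← h]
  simp only [oddKernel_functional_equation, evenKernel_functional_equation, one_div]
  push_cast
  ring

lemma cTheta_add_gi (u : ℂ) (m : ℤ × ℤ) (t : ℝ) : cTheta (u + gi m) t = cTheta u t := by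
  have h (x : ℝ) (n : ℤ) : ((x + n : ℝ) : UnitAddCircle) = (x : UnitAddCircle) := by
    rw [AddCircle.coe_add, add_eq_left]
    exact (AddCircle.coe_eq_zero_iff 1).2 ⟨n, by simp⟩
  simp only [cTheta, add_re, gi_re, add_im, gi_im, h]

lemma cTheta_I_mul (u : ℂ) (t : ℝ) : cTheta (I * u) t = -I * cTheta u t := by
  have h1 : ((-u.im : ℝ) : UnitAddCircle) = -(u.im : UnitAddCircle) := rfl
  simp only [cTheta, I_mul_re, I_mul_im, h1, oddKernel_neg, evenKernel_neg]
  push_cast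
  linear_combination (-(oddKernel (u.im : UnitAddCircle) t : ℂ) *
    (evenKernel (u.re : UnitAddCircle) t : ℂ)) * I_sq

lemma continuousOn_cTheta (u : ℂ) : ContinuousOn (cTheta u) (Ioi 0) := by
  have h1 := continuous_ofReal.comp_continuousOn (continuousOn_evenKernel u.re)
  have h2 := continuous_ofReal.comp_continuousOn (continuousOn_evenKernel u.im)
  have h3 := continuous_ofReal.comp_continuousOn (continuousOn_oddKernel u.re)
  have h4 := continuous_ofReal.comp_continuousOn (continuousOn_oddKernel u.im)
  exact (h3.mul h2).sub (continuousOn_const.mul (h1.mul h4))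

lemma isBigO_atTop_rpow_of_exp {f : ℝ → ℝ} (h : ∃ p, 0 < p ∧ f =O[atTop] fun x => Real.exp (-p * x))
    (a : ℝ) : f =O[atTop] fun x => x ^ (-a) := by
  obtain ⟨p, hp, h⟩ := h
  exact h.trans (isLittleO_exp_neg_mul_rpow_atTop hp _).isBigO

lemma isBigO_one_of_sub {f : ℝ → ℝ} {c : ℝ}
    (h : ∃ p, 0 < p ∧ (f · - c) =O[atTop] fun x => Real.exp (-p * x)) :
    f =O[atTop] fun _ => (1 : ℝ) := by
  have h1 : (f · - c) =O[atTop] fun _ => (1 : ℝ) := by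
    refine (isBigO_atTop_rpow_of_exp h 0).congr_right fun x => by simp
  have := h1.add (isBigO_const_const c one_ne_zero atTop)
  simpa using this

lemma isBigO_atTop_comb {f g f' g' : ℝ → ℝ} {a : ℝ} (hf : f =O[atTop] fun x => x ^ (-a))
    (hf' : f' =O[atTop] fun x => x ^ (-a)) (hg : g =O[atTop] fun _ => (1 : ℝ))
    (hg' : g' =O[atTop] fun _ => (1 : ℝ)) :
    (fun t => (f t : ℂ) * g t - I * (g' t * f' t)) =O[atTop] fun x => x ^ (-a) := by
  have h1 : (fun t => (f t : ℂ) * g t) =O[atTop] fun x => x ^ (-a) := by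
    have := hf.mul hg
    simp only [mul_one] at this
    exact IsBigO.congr_left (isBigO_ofReal_left.2 this) fun x => by push_cast; rfl
  have h2 : (fun t => (g' t : ℂ) * f' t) =O[atTop] fun x => x ^ (-a) := by
    have := hg'.mul hf'
    simp only [one_mul] at this
    exact IsBigO.congr_left (isBigO_ofReal_left.2 this) fun x => by push_cast; rfl
  exact h1.sub (h2.const_mul_left I)

lemma isBigO_atTop_cTheta (u : ℂ) (a : ℝ) : cTheta u =O[atTop] fun x => x ^ (-a) :=
  isBigO_atTop_comb (isBigO_atTop_rpow_of_exp (isBigO_atTop_oddKernel _) a)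
    (isBigO_atTop_rpow_of_exp (isBigO_atTop_oddKernel _) a)
    (isBigO_one_of_sub (isBigO_atTop_evenKernel_sub _))
    (isBigO_one_of_sub (isBigO_atTop_evenKernel_sub _))

lemma isBigO_atTop_cThetaHat (u : ℂ) (a : ℝ) : cThetaHat u =O[atTop] fun x => x ^ (-a) :=
  isBigO_atTop_comb (isBigO_atTop_rpow_of_exp (isBigO_atTop_sinKernel _) a)
    (isBigO_atTop_rpow_of_exp (isBigO_atTop_sinKernel _) a)
    (isBigO_one_of_sub (isBigO_atTop_cosKernel_sub _))
    (isBigO_one_of_sub (isBigO_atTop_cosKernel_sub _))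

lemma isBigO_zero_cTheta (u : ℂ) (b : ℝ) : cTheta u =O[nhdsWithin 0 (Ioi 0)] fun x => x ^ (-b) := by
  have h := (isBigO_atTop_cThetaHat u (2 - b)).comp_tendsto tendsto_inv_nhdsGT_zero
  have h2 : (fun t : ℝ => (((t ^ 2)⁻¹ : ℝ) : ℂ)) =O[nhdsWithin 0 (Ioi 0)]
      fun t : ℝ => (t ^ 2)⁻¹ := isBigO_ofReal_left.2 (isBigO_refl _ _)
  refine IsBigO.congr' (h2.mul h) ?_ ?_
  · filter_upwards [self_mem_nhdsWithin] with t ht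
    exact (cTheta_functional_equation u ht).symm
  · filter_upwards [self_mem_nhdsWithin] with t ht
    have ht : 0 < t := ht
    simp only [Function.comp]
    rw [Real.inv_rpow ht.le, ← Real.rpow_neg ht.le, ← Real.rpow_natCast, ← Real.rpow_neg ht.le,
      ← Real.rpow_add ht]
    congr 1
    push_cast
    ring

lemma mellinConvergent_cTheta (u s : ℂ) : MellinConvergent (cTheta u) s :=
  mellinConvergent_of_isBigO_rpow
    ((continuousOn_cTheta u).locallyIntegrableOn measurableSet_Ioi)
    (isBigO_atTop_cTheta u (s.re + 1)) (by linarith) (isBigO_zero_cTheta u (s.re - 1))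
    (by linarith)

lemma differentiable_mellin_cTheta (u : ℂ) : Differentiable ℂ (mellin (cTheta u)) := fun s =>
  mellin_differentiableAt_of_isBigO_rpow
    ((continuousOn_cTheta u).locallyIntegrableOn measurableSet_Ioi)
    (isBigO_atTop_cTheta u (s.re + 1)) (by linarith) (isBigO_zero_cTheta u (s.re - 1))
    (by linarith)

/-- The Eisenstein–Kronecker function of weight one of the lattice `ℤ[i]`. -/
def EK (u : ℂ) : ℂ := Real.pi * mellin (cTheta u) 1

lemma EK_add_gi (u : ℂ) (m : ℤ × ℤ) : EK (u + gi m) = EK u := by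
  simp only [EK, mellin, cTheta_add_gi]

lemma EK_I_mul (u : ℂ) : EK (I * u) = -I * EK u := by
  have : cTheta (I * u) = fun t => (-I) • cTheta u t := by
    ext t; rw [cTheta_I_mul, smul_eq_mul]
  rw [EK, this, mellin_const_smul, EK, smul_eq_mul]
  ring

lemma EK_neg (u : ℂ) : EK (-u) = -EK u := by
  have h : -u = I * (I * u) := by rw [← mul_assoc, I_mul_I]; ring
  rw [h, EK_I_mul, EK_I_mul]
  linear_combination (EK u) * I_sq

lemma I_mem_O4 : I ∈ O4 := Subring.subset_closure rfl

lemma gi_mem_O4 (m : ℤ × ℤ) : gi m ∈ O4 :=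
  O4.add_mem (intCast_mem O4 _) (O4.mul_mem (intCast_mem O4 _) I_mem_O4)

lemma exists_gi {z : ℂ} (hz : z ∈ O4) : ∃ m, gi m = z := by
  induction hz using Subring.closure_induction with
  | mem x hx => exact ⟨(0, 1), by rw [mem_singleton_iff.1 hx]; simp [gi]⟩
  | zero => exact ⟨0, by simp [gi]⟩
  | one => exact ⟨(1, 0), by simp [gi]⟩
  | add x y _ _ hx hy =>
    obtain ⟨m, rfl⟩ := hx
    obtain ⟨n, rfl⟩ := hy
    exact ⟨m + n, by simp [gi]; ring⟩
  | neg x _ hx =>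
    obtain ⟨m, rfl⟩ := hx
    exact ⟨-m, by simp [gi]; ring⟩
  | mul x y _ _ hx hy =>
    obtain ⟨m, rfl⟩ := hx
    obtain ⟨n, rfl⟩ := hy
    refine ⟨(m.1 * n.1 - m.2 * n.2, m.1 * n.2 + m.2 * n.1), ?_⟩
    simp only [gi]
    push_cast
    linear_combination (-(m.2 : ℂ) * n.2) * I_sq

lemma gi_injective : Function.Injective gi := by
  intro m n h
  have h1 := congrArg re h
  have h2 := congrArg im h
  simp only [gi_re, gi_im, Int.cast_inj] at h1 h2
  exact Prod.ext h1 h2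

lemma mem_O4_iff {z : ℂ} : z ∈ O4 ↔ ∃ x y : ℤ, z = x + y * I := by
  constructor
  · intro hz
    obtain ⟨m, rfl⟩ := exists_gi hz
    exact ⟨m.1, m.2, rfl⟩
  · rintro ⟨x, y, rfl⟩
    exact gi_mem_O4 (x, y)

/-- The parametrization of the Gaussian integers by pairs of integers. -/
def giEquiv : ℤ × ℤ ≃ O4 :=
  Equiv.ofBijective (fun m => ⟨gi m, gi_mem_O4 m⟩)
    ⟨fun _ _ h => gi_injective (congrArg Subtype.val h), fun z => by
      obtain ⟨m, hm⟩ := exists_gi z.2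
      exact ⟨m, Subtype.ext hm⟩⟩

lemma giEquiv_apply (m : ℤ × ℤ) : ((giEquiv m : O4) : ℂ) = gi m := rfl

lemma star_mem_O4 {z : ℂ} (hz : z ∈ O4) : (starRingEnd ℂ) z ∈ O4 := by
  obtain ⟨x, y, rfl⟩ := mem_O4_iff.1 hz
  exact mem_O4_iff.2 ⟨x, -y, by simp⟩

lemma gi_eq_zero {m : ℤ × ℤ} : gi m = 0 ↔ m = 0 :=
  ⟨fun h => gi_injective (by rw [h]; simp [gi]), fun h => by rw [h]; simp [gi]⟩

lemma summable_norm_gi_rpow {k : ℝ} (hk : 2 < k) : Summable fun m => ‖gi m‖ ^ (-k) := by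
  have h := EisensteinSeries.summable_one_div_norm_rpow hk
  rw [← (finTwoArrowEquiv ℤ).symm.summable_iff] at h
  refine h.of_nonneg_of_le (fun m => by positivity) fun m => ?_
  by_cases hm : m = 0
  · subst hm
    have : gi 0 = 0 := gi_eq_zero.2 rfl
    rw [this, norm_zero, Real.zero_rpow (by linarith)]
    exact Real.rpow_nonneg (norm_nonneg _) _
  · refine Real.rpow_le_rpow_of_nonpos ?_ ?_ (by linarith)
    · rw [norm_pos_iff]
      intro h0
      refine hm (Prod.ext ?_ ?_)
      · simpa using congrFun h0 0
      · simpa using congrFun h0 1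
    · rw [pi_norm_le_iff_of_nonneg (norm_nonneg _)]
      intro i
      fin_cases i
      · simpa [Int.norm_eq_abs] using abs_re_le_norm (gi m)
      · simpa [Int.norm_eq_abs] using abs_im_le_norm (gi m)

lemma GCong.refl (a b : ℂ) : GCong a a b := ⟨0, O4.zero_mem, by ring⟩
lemma GCong.symm {a b c : ℂ} (h : GCong a b c) : GCong b a c := by
  obtain ⟨d, hd, h⟩ := h
  exact ⟨-d, O4.neg_mem hd, by linear_combination -h⟩
lemma GCong.trans {a b c d : ℂ} (h : GCong a b d) (h' : GCong b c d) : GCong a c d := by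
  obtain ⟨x, hx, h⟩ := h
  obtain ⟨y, hy, h'⟩ := h'
  exact ⟨x + y, O4.add_mem hx hy, by linear_combination h + h'⟩
lemma GCong.add {a b c d e : ℂ} (h : GCong a b e) (h' : GCong c d e) : GCong (a + c) (b + d) e := by
  obtain ⟨x, hx, h⟩ := h
  obtain ⟨y, hy, h'⟩ := h'
  exact ⟨x + y, O4.add_mem hx hy, by linear_combination h + h'⟩
lemma GCong.mul_left {a b c k : ℂ} (h : GCong a b c) (hk : k ∈ O4) : GCong (k * a) (k * b) c := by
  obtain ⟨x, hx, h⟩ := h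
  exact ⟨k * x, O4.mul_mem hk hx, by linear_combination k * h⟩
/-- The family `ρ` represents every residue class of Gaussian integers modulo `β` exactly once. -/
structure IsRes {ι : Type*} (β : ℂ) (ρ : ι → ℂ) : Prop where
  mem : ∀ i, ρ i ∈ O4
  cover : ∀ z ∈ O4, ∃! i, GCong z (ρ i) β

section residues

variable {ι : Type*} {β : ℂ} {ρ : ι → ℂ}

lemma IsRes.eq_of_gcong (h : IsRes β ρ) {i j : ι} (hij : GCong (ρ i) (ρ j) β) : i = j :=
  (h.cover _ (h.mem i)).unique (GCong.refl _ _) hij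

lemma IsRes.bijective (h : IsRes β ρ) (hβ : β ∈ O4) (h0 : β ≠ 0) :
    Function.Bijective fun x : ι × O4 => (⟨ρ x.1 + β * x.2,
      O4.add_mem (h.mem _) (O4.mul_mem hβ x.2.2)⟩ : O4) := by
  constructor
  · rintro ⟨i, m⟩ ⟨j, n⟩ hx
    have hx : ρ i + β * m = ρ j + β * n := congrArg Subtype.val hx
    have hij : i = j := h.eq_of_gcong ⟨n - m, O4.sub_mem n.2 m.2, by linear_combination hx⟩
    subst hij
    have : (m : ℂ) = n := mul_left_cancel₀ h0 (add_left_cancel hx)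
    rw [Subtype.ext this]
  · rintro ⟨z, hz⟩
    obtain ⟨i, ⟨d, hd, hi⟩, -⟩ := h.cover z hz
    exact ⟨(i, ⟨d, hd⟩), Subtype.ext (by simp only; linear_combination -hi)⟩

lemma hasSum_prod_fintype [Fintype ι] {κ : Type*} {f : ι × κ → ℂ} {a : ι → ℂ}
    (h : ∀ i, HasSum (fun k => f (i, k)) (a i)) : HasSum f (∑ i, a i) := by
  classical
  have h1 : ∀ i ∈ Finset.univ, HasSum (fun x : ι × κ => if x.1 = i then f x else 0) (a i) := by
    intro i _
    have hinj : Function.Injective (fun k : κ => (i, k)) := Prod.mk_right_injective i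
    refine (hinj.hasSum_iff ?_).1 ?_
    · rintro ⟨j, k⟩ hx
      rw [if_neg]
      rintro rfl
      exact hx ⟨k, rfl⟩
    · simpa [Function.comp_def] using h i
  refine (hasSum_sum h1).congr_fun_eq fun x => ?_
  simp

lemma hasMellin_finset_sum {f : ι → ℝ → ℂ} {a : ι → ℂ} {s : ℂ} (t : Finset ι)
    (h : ∀ i, HasMellin (f i) s (a i)) :
    HasMellin (fun x => ∑ i ∈ t, f i x) s (∑ i ∈ t, a i) := by
  classical
  induction t using Finset.induction_on with
  | empty => simp [HasMellin, MellinConvergent, mellin]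
  | insert i t hi ih =>
    have := hasMellin_add (h i).1 ih.1
    simp only [Finset.sum_insert hi]
    rwa [(h i).2, ih.2] at this

/-- The theta function of the Hecke character `ν ↦ χ₁ ν · conj ν`, as a sum over residues. -/
def heckeTheta [Fintype ι] (β : ℂ) (ρ : ι → ℂ) (χ₁ : ℂ → ℂ) (t : ℝ) : ℂ :=
  ∑ i, χ₁ (ρ i) * (starRingEnd ℂ) β * cTheta (ρ i / β) (normSq β * t)

lemma hasSum_heckeTheta [Fintype ι] (h : IsRes β ρ) (hβ : β ∈ O4) (h0 : β ≠ 0) {χ₁ : ℂ → ℂ}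
    (hper : ∀ a ∈ O4, ∀ b ∈ O4, GCong a b β → χ₁ a = χ₁ b) {t : ℝ} (ht : 0 < t) :
    HasSum (fun ν : O4 => χ₁ ν * (starRingEnd ℂ) (ν : ℂ) *
      Real.exp (-Real.pi * normSq (ν : ℂ) * t)) (heckeTheta β ρ χ₁ t) := by
  have hpos : 0 < normSq β * t := mul_pos (normSq_pos.2 h0) ht
  refine ((Equiv.ofBijective _ (h.bijective hβ h0)).hasSum_iff).1 (hasSum_prod_fintype fun i => ?_)
  refine (giEquiv.hasSum_iff).1 (((hasSum_cTheta (ρ i / β) hpos).mul_left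
    (χ₁ (ρ i) * (starRingEnd ℂ) β)).congr_fun_eq fun m => ?_)
  simp only [Function.comp, Equiv.ofBijective_apply, giEquiv_apply]
  have e1 : ρ i + β * gi m = β * (ρ i / β + gi m) := by field_simp
  have e2 : χ₁ (ρ i + β * gi m) = χ₁ (ρ i) :=
    hper _ (O4.add_mem (h.mem _) (O4.mul_mem hβ (gi_mem_O4 m))) _ (h.mem i)
      ⟨gi m, gi_mem_O4 m, by ring⟩
  rw [e2, e1, map_mul, map_mul]
  have e3 : -Real.pi * (normSq β * normSq (ρ i / β + gi m)) * t =
    -Real.pi * normSq (ρ i / β + gi m) * (normSq β * t) := by ring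
  rw [e3]
  ring

lemma mellin_heckeTheta [Fintype ι] (h0 : β ≠ 0) (χ₁ : ℂ → ℂ) (s : ℂ) :
    mellin (heckeTheta β ρ χ₁) s = ∑ i, χ₁ (ρ i) * (starRingEnd ℂ) β *
      ((normSq β : ℂ) ^ (-s) * mellin (cTheta (ρ i / β)) s) := by
  have hpos := normSq_pos.2 h0
  have hM (i : ι) : HasMellin (fun t => (χ₁ (ρ i) * (starRingEnd ℂ) β) •
      cTheta (ρ i / β) (normSq β * t)) s
      (χ₁ (ρ i) * (starRingEnd ℂ) β * ((normSq β : ℂ) ^ (-s) * mellin (cTheta (ρ i / β)) s)) := by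
    refine ⟨((MellinConvergent.comp_mul_left hpos).2
      (mellinConvergent_cTheta _ _)).const_smul _, ?_⟩
    rw [mellin_const_smul, mellin_comp_mul_left _ _ hpos, smul_eq_mul, smul_eq_mul]
  exact (hasMellin_finset_sum Finset.univ hM).2

end residues

section lvalue

variable {ι : Type*} [Fintype ι] {β : ℂ} {ρ : ι → ℂ} {χ₁ : ℂ → ℂ}

lemma IsRes.norm_le (h : IsRes β ρ) (hper : ∀ a ∈ O4, ∀ b ∈ O4, GCong a b β → χ₁ a = χ₁ b)
    {z : ℂ} (hz : z ∈ O4) : ‖χ₁ z‖ ≤ ∑ i, ‖χ₁ (ρ i)‖ := by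
  obtain ⟨i, hi, -⟩ := h.cover z hz
  rw [hper z hz _ (h.mem i) hi]
  exact Finset.single_le_sum (f := fun i => ‖χ₁ (ρ i)‖) (fun _ _ => norm_nonneg _)
    (Finset.mem_univ i)

lemma summable_hecke (h : IsRes β ρ) (hper : ∀ a ∈ O4, ∀ b ∈ O4, GCong a b β → χ₁ a = χ₁ b)
    {σ : ℝ} (hσ : 3 / 2 < σ) :
    Summable fun ν : O4 => ‖χ₁ ν * (starRingEnd ℂ) (ν : ℂ)‖ / normSq (ν : ℂ) ^ σ := by
  rw [← giEquiv.summable_iff]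
  have hs := (summable_norm_gi_rpow (k := 2 * σ - 1) (by linarith)).mul_left (∑ i, ‖χ₁ (ρ i)‖)
  refine hs.of_nonneg_of_le (fun m => ?_) fun m => ?_
  · exact div_nonneg (norm_nonneg _) (Real.rpow_nonneg (normSq_nonneg _) _)
  · simp only [Function.comp, giEquiv_apply]
    by_cases hm : gi m = 0
    · rw [hm, norm_zero, Real.zero_rpow (by linarith)]
      simp
    · have hpos : 0 < ‖gi m‖ := norm_pos_iff.2 hm
      have e : normSq (gi m) ^ σ = ‖gi m‖ ^ (2 * σ) := by
        rw [normSq_eq_norm_sq, ← Real.rpow_natCast, ← Real.rpow_mul hpos.le]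
        norm_num
      have e2 : ‖gi m‖ ^ (-(2 * σ - 1)) = ‖gi m‖ / ‖gi m‖ ^ (2 * σ) := by
        rw [neg_sub, Real.rpow_sub hpos, Real.rpow_one]
      rw [norm_mul, norm_conj, e, e2, mul_div_assoc]
      exact mul_le_mul_of_nonneg_right (h.norm_le hper (gi_mem_O4 m)) (by positivity)

lemma mellin_heckeTheta_eq_tsum (h : IsRes β ρ) (hβ : β ∈ O4) (h0 : β ≠ 0)
    (hper : ∀ a ∈ O4, ∀ b ∈ O4, GCong a b β → χ₁ a = χ₁ b) {s : ℂ} (hs : 3 / 2 < s.re) :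
    mellin (heckeTheta β ρ χ₁) s = (Real.pi : ℂ) ^ (-s) * Complex.Gamma s *
      ∑' ν : O4, χ₁ (ν : ℂ) * (starRingEnd ℂ) (ν : ℂ) * ((normSq (ν : ℂ) : ℂ) ^ (-s)) := by
  have : Countable O4 := giEquiv.symm.injective.countable
  rw [← tsum_mul_left]
  refine ((hasSum_mellin_pi_mul (q := fun ν : O4 => normSq (ν : ℂ)) (fun ν => ?_) (by linarith)
    (fun t ht => hasSum_heckeTheta h hβ h0 hper ht) (summable_hecke h hper hs)).congr_fun_eq
    fun ν => ?_).tsum_eq.symm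
  · rcases eq_or_ne (ν : ℂ) 0 with h | h
    · left; simp [h]
    · right; exact normSq_pos.2 h
  · simp only [cpow_neg]
    ring

lemma differentiable_mellin_heckeTheta (h0 : β ≠ 0) :
    Differentiable ℂ (mellin (heckeTheta β ρ χ₁)) := by
  have hn : (normSq β : ℂ) ≠ 0 := ofReal_ne_zero.2 (normSq_pos.2 h0).ne'
  have : mellin (heckeTheta β ρ χ₁) = fun s => ∑ i, χ₁ (ρ i) * (starRingEnd ℂ) β *
      ((normSq β : ℂ) ^ (-s) * mellin (cTheta (ρ i / β)) s) := by
    funext s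
    exact mellin_heckeTheta h0 χ₁ s
  rw [this]
  refine Differentiable.fun_sum fun i _ => (Differentiable.const_mul ?_ _)
  refine Differentiable.mul (fun s => ?_) (differentiable_mellin_cTheta _)
  exact (differentiableAt_id.neg).const_cpow (Or.inl hn)

lemma IsLValue4.eq_mellin (h : IsRes β ρ) (hβ : β ∈ O4) (h0 : β ≠ 0)
    (hper : ∀ a ∈ O4, ∀ b ∈ O4, GCong a b β → χ₁ a = χ₁ b) {L : ℂ} (hL : IsLValue4 χ₁ L) :
    L = (1 / 4 : ℂ) * Real.pi * mellin (heckeTheta β ρ χ₁) 1 := by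
  obtain ⟨F, hF, hFs, rfl⟩ := hL
  have hopen : IsOpen {s : ℂ | 0 < s.re} := isOpen_lt continuous_const continuous_re
  have hpi : (Real.pi : ℂ) ≠ 0 := ofReal_ne_zero.2 Real.pi_ne_zero
  have d1 : DifferentiableOn ℂ (fun s => (Real.pi : ℂ) ^ (-s) * Complex.Gamma s * (4 * F s))
      {s : ℂ | 0 < s.re} := by
    refine DifferentiableOn.mul (DifferentiableOn.mul (fun s _ => ?_) fun s hs => ?_)
      (hF.const_mul _)
    · exact (((differentiableAt_id.neg).const_cpow (Or.inl hpi))).differentiableWithinAt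
    · refine (differentiableAt_Gamma s fun m hm => ?_).differentiableWithinAt
      rw [hm] at hs
      simp only [mem_ofPred_eq, neg_re, natCast_re] at hs
      linarith [m.cast_nonneg (α := ℝ)]
  have d2 := (differentiable_mellin_heckeTheta (ρ := ρ) (χ₁ := χ₁) h0).differentiableOn
    (s := {s : ℂ | 0 < s.re})
  have hev : (fun s => (Real.pi : ℂ) ^ (-s) * Complex.Gamma s * (4 * F s)) =ᶠ[nhds 2]
      mellin (heckeTheta β ρ χ₁) := by
    have : {s : ℂ | 3 / 2 < s.re} ∈ nhds (2 : ℂ) :=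
      (isOpen_lt continuous_const continuous_re).mem_nhds (by norm_num [mem_ofPred_eq])
    filter_upwards [this] with s hs
    rw [hFs s hs, mellin_heckeTheta_eq_tsum h hβ h0 hper hs]
    ring
  have hpre : IsPreconnected {s : ℂ | 0 < s.re} := (convex_halfSpace_re_gt 0).isPreconnected
  have h2 : (2 : ℂ) ∈ {s : ℂ | 0 < s.re} := by simp
  have h1 : (1 : ℂ) ∈ {s : ℂ | 0 < s.re} := by simp
  have := (d1.analyticOnNhd hopen).eqOn_of_preconnected_of_eventuallyEq (d2.analyticOnNhd hopen)
    hpre h2 hev h1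
  rw [← this]
  simp only [Gamma_one, cpow_neg, cpow_one]
  field_simp

/-- The value at `1` of a Hecke `L`-series of weight one as a sum of Eisenstein–Kronecker values. -/
lemma IsLValue4.eq_sum (h : IsRes β ρ) (hβ : β ∈ O4) (h0 : β ≠ 0)
    (hper : ∀ a ∈ O4, ∀ b ∈ O4, GCong a b β → χ₁ a = χ₁ b) {L : ℂ} (hL : IsLValue4 χ₁ L) :
    L = (1 / 4 : ℂ) * β⁻¹ * ∑ i, χ₁ (ρ i) * EK (ρ i / β) := by
  rw [hL.eq_mellin h hβ h0 hper, mellin_heckeTheta h0, Finset.mul_sum, Finset.mul_sum]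
  refine Finset.sum_congr rfl fun i _ => ?_
  have hs : (starRingEnd ℂ) β ≠ 0 := (map_ne_zero _).2 h0
  rw [EK, cpow_neg, cpow_one, ← mul_conj]
  field_simp

lemma heckeTheta_functional_equation (h : IsRes β ρ) (hβ : β ∈ O4) (h0 : β ≠ 0)
    (hper : ∀ a ∈ O4, ∀ b ∈ O4, GCong a b β → χ₁ a = χ₁ b) {g : ℂ}
    (hg : ∀ m ∈ O4, ∑ i, χ₁ (ρ i) * eRe4 (ρ i * m / β) = (starRingEnd ℂ) (χ₁ m) * g)
    {t : ℝ} (ht : 0 < t) : heckeTheta β ρ χ₁ t =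
      -I * g * (starRingEnd ℂ) β * ((((normSq β * t) ^ 2)⁻¹ : ℝ) : ℂ) *
        (starRingEnd ℂ) (heckeTheta β ρ χ₁ (normSq β * t)⁻¹) := by
  have hp : 0 < normSq β * t := mul_pos (normSq_pos.2 h0) ht
  have hq : 0 < (normSq β * t)⁻¹ := inv_pos.2 hp
  let e : ℤ × ℤ ≃ O4 := ⟨fun m => ⟨(starRingEnd ℂ) (gi m), star_mem_O4 (gi_mem_O4 m)⟩,
    fun z => giEquiv.symm ⟨(starRingEnd ℂ) z, star_mem_O4 z.2⟩, fun m => by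
      rw [Equiv.symm_apply_eq]
      exact Subtype.ext (by simp [giEquiv_apply]), fun z => Subtype.ext (by
      simp only [← giEquiv_apply, Equiv.apply_symm_apply, conj_conj])⟩
  have h1 : HasSum (fun m : ℤ × ℤ => ∑ i, χ₁ (ρ i) * (-I * (starRingEnd ℂ) (gi m) *
      eRe4 (ρ i / β * (starRingEnd ℂ) (gi m)) *
      Real.exp (-Real.pi * normSq (gi m) * (normSq β * t)⁻¹)))
      (∑ i, χ₁ (ρ i) * cThetaHat (ρ i / β) (normSq β * t)⁻¹) :=
    hasSum_sum fun i _ => (hasSum_cThetaHat (ρ i / β) hq).mul_left _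
  have h2 := ((hasSum_conj'.2 (hasSum_heckeTheta h hβ h0 hper hq)).mul_left (-I * g))
  rw [← e.hasSum_iff] at h2
  have h3 := h1.unique (h2.congr_fun_eq fun m => ?_)
  · simp only [heckeTheta, cTheta_functional_equation _ hp]
    simp only [heckeTheta] at h3
    have : ∑ i, χ₁ (ρ i) * (starRingEnd ℂ) β * (((((normSq β * t) ^ 2)⁻¹ : ℝ) : ℂ) *
        cThetaHat (ρ i / β) (normSq β * t)⁻¹) = (starRingEnd ℂ) β *
        ((((normSq β * t) ^ 2)⁻¹ : ℝ) : ℂ) *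
        ∑ i, χ₁ (ρ i) * cThetaHat (ρ i / β) (normSq β * t)⁻¹ := by
      rw [Finset.mul_sum]
      exact Finset.sum_congr rfl fun i _ => by ring
    rw [this, h3]
    ring
  · have hm := hg _ (star_mem_O4 (gi_mem_O4 m))
    simp only [Function.comp, e, Equiv.coe_fn_mk, map_mul, conj_ofReal, conj_conj, normSq_conj]
    have : ∑ i, χ₁ (ρ i) * (-I * (starRingEnd ℂ) (gi m) *
      eRe4 (ρ i / β * (starRingEnd ℂ) (gi m)) *
      (Real.exp (-Real.pi * normSq (gi m) * (normSq β * t)⁻¹) : ℂ)) = (-I * (starRingEnd ℂ) (gi m) *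
      (Real.exp (-Real.pi * normSq (gi m) * (normSq β * t)⁻¹) : ℂ)) * ∑ i, χ₁ (ρ i) *
        eRe4 (ρ i * (starRingEnd ℂ) (gi m) / β) := by
      rw [Finset.mul_sum]
      refine Finset.sum_congr rfl fun i _ => ?_
      rw [div_mul_eq_mul_div]
      ring
    rw [this, hm]
    ring

/-- The functional equation at the central point. -/
lemma IsLValue4.eq_conj (h : IsRes β ρ) (hβ : β ∈ O4) (h0 : β ≠ 0)
    (hper : ∀ a ∈ O4, ∀ b ∈ O4, GCong a b β → χ₁ a = χ₁ b) {g : ℂ}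
    (hg : ∀ m ∈ O4, ∑ i, χ₁ (ρ i) * eRe4 (ρ i * m / β) = (starRingEnd ℂ) (χ₁ m) * g)
    {L : ℂ} (hL : IsLValue4 χ₁ L) : L = -I * (g / β) * (starRingEnd ℂ) L := by
  have hn := normSq_pos.2 h0
  have hnc : (normSq β : ℂ) ≠ 0 := ofReal_ne_zero.2 hn.ne'
  have hs : (starRingEnd ℂ) β ≠ 0 := (map_ne_zero _).2 h0
  have h1 : mellin (heckeTheta β ρ χ₁) 1 = mellin (fun t => (-I * g * (starRingEnd ℂ) β *
      ((normSq β : ℂ) ^ 2)⁻¹) • ((t : ℂ) ^ (-2 : ℂ) • (fun x : ℝ => (starRingEnd ℂ)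
        (heckeTheta β ρ χ₁ ((normSq β)⁻¹ * x))) t⁻¹)) 1 := by
    refine MeasureTheory.setIntegral_congr_fun measurableSet_Ioi fun t ht => ?_
    simp only
    rw [heckeTheta_functional_equation h hβ h0 hper hg ht, mul_inv (normSq β) t, cpow_neg]
    norm_num
    ring
  rw [mellin_const_smul, mellin_cpow_smul, mellin_comp_inv (fun x : ℝ => (starRingEnd ℂ)
        (heckeTheta β ρ χ₁ ((normSq β)⁻¹ * x))), mellin_comp_mul_left (fun x : ℝ => (starRingEnd ℂ)
        (heckeTheta β ρ χ₁ x)) _ (inv_pos.2 hn)] at h1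
  have h2 : mellin (fun x : ℝ => (starRingEnd ℂ) (heckeTheta β ρ χ₁ x)) 1 =
      (starRingEnd ℂ) (mellin (heckeTheta β ρ χ₁) 1) := by
    simp only [mellin, sub_self, cpow_zero, one_smul]
    exact integral_conj
  have e : -(1 + -2 : ℂ) = 1 := by norm_num
  rw [e, h2] at h1
  rw [hL.eq_mellin h hβ h0 hper, map_mul, map_mul, conj_ofReal]
  conv_lhs => rw [h1]
  simp only [smul_eq_mul, map_div₀, map_one, map_ofNat]
  rw [cpow_neg, cpow_one, ofReal_inv, inv_inv, ← mul_conj]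
  field_simp

end lvalue

lemma eRe4_add (z w : ℂ) : eRe4 (z + w) = eRe4 z * eRe4 w := by
  rw [eRe4, eRe4, eRe4, ← Complex.exp_add]
  congr 1
  push_cast [add_re]
  ring

lemma eRe4_quarter {z : ℂ} (k : ℤ) (h : 4 * z.re = k) : eRe4 z = I ^ k := by
  have h2 : I = cexp (Real.pi / 2 * I) := (exp_pi_div_two_mul_I).symm
  have h3 : (z.re : ℂ) = k / 4 := by
    rw [eq_div_iff (by norm_num), ← ofReal_intCast, ← h]
    push_cast
    ring
  rw [eRe4, h3]
  conv_rhs => rw [h2]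
  rw [← Complex.exp_int_mul]
  congr 1
  ring

lemma eRe4_eq_one {z : ℂ} (hz : z ∈ O4) : eRe4 z = 1 := by
  obtain ⟨m, rfl⟩ := exists_gi hz
  rw [eRe4_quarter (4 * m.1) (by simp), zpow_mul]
  have : I ^ (4 : ℤ) = 1 := by exact_mod_cast I_pow_four
  rw [this, one_zpow]

/-- `g` is the Gauss sum of `χ` modulo `β`, with the twisting property. -/
def HasGauss {ι : Type*} [Fintype ι] (β : ℂ) (ρ : ι → ℂ) (χ : ℂ → ℂ) (g : ℂ) : Prop :=
  ∀ m ∈ O4, ∑ i, χ (ρ i) * eRe4 (ρ i * m / β) = (starRingEnd ℂ) (χ m) * g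

section gauss

variable {ι κ : Type*} {a b : ℂ} {ρ : ι → ℂ} {σ : κ → ℂ}

lemma IsRes.hasGauss [Fintype ι] (h : IsRes a ρ) (h0 : a ≠ 0) {χ : ℂ → ℂ}
    (hper : ∀ x ∈ O4, ∀ y ∈ O4, GCong x y a → χ x = χ y) {g : ℂ}
    (hg : ∀ j, ∑ i, χ (ρ i) * eRe4 (ρ i * ρ j / a) = (starRingEnd ℂ) (χ (ρ j)) * g) :
    HasGauss a ρ χ g := by
  intro m hm
  obtain ⟨j, hj, -⟩ := h.cover m hm
  rw [hper m hm _ (h.mem j) hj, ← hg]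
  obtain ⟨d, hd, hj⟩ := hj
  refine Finset.sum_congr rfl fun i _ => ?_
  have : ρ i * m / a = ρ i * ρ j / a + ρ i * d := by
    field_simp
    linear_combination ρ i * hj
  rw [this, eRe4_add, eRe4_eq_one (O4.mul_mem (h.mem i) hd), mul_one]

lemma IsRes.mul (h : IsRes a ρ) (h' : IsRes b σ) (ha : a ∈ O4) (hb : b ∈ O4) (hab : GCoprime a b) :
    IsRes (a * b) (fun x : ι × κ => b * ρ x.1 + a * σ x.2) := by
  obtain ⟨u, hu, v, hv, huv⟩ := hab
  refine ⟨fun x => O4.add_mem (O4.mul_mem hb (h.mem _)) (O4.mul_mem ha (h'.mem _)),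
    fun z hz => ?_⟩
  obtain ⟨i, ⟨d, hd, hi⟩, -⟩ := h.cover (v * z) (O4.mul_mem hv hz)
  obtain ⟨j, ⟨e, he, hj⟩, -⟩ := h'.cover (u * z) (O4.mul_mem hu hz)
  have hmain : GCong z (b * ρ i + a * σ j) (a * b) :=
    ⟨d + e, O4.add_mem hd he, by linear_combination b * hi + a * hj - z * huv⟩
  refine ⟨(i, j), hmain, ?_⟩
  rintro ⟨i', j'⟩ hx
  obtain ⟨f, hf, hx⟩ := hmain.symm.trans hx
  simp only at hx
  have hi' : i' = i := (h.eq_of_gcong ⟨u * (ρ i - ρ i') + v * (b * f - (σ j - σ j')),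
    O4.add_mem (O4.mul_mem hu (O4.sub_mem (h.mem _) (h.mem _)))
      (O4.mul_mem hv (O4.sub_mem (O4.mul_mem hb hf) (O4.sub_mem (h'.mem _) (h'.mem _)))),
    by linear_combination v * hx - (ρ i - ρ i') * huv⟩).symm
  have hj' : j' = j := (h'.eq_of_gcong ⟨v * (σ j - σ j') + u * (a * f - (ρ i - ρ i')),
    O4.add_mem (O4.mul_mem hv (O4.sub_mem (h'.mem _) (h'.mem _)))
      (O4.mul_mem hu (O4.sub_mem (O4.mul_mem ha hf) (O4.sub_mem (h.mem _) (h.mem _)))),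
    by linear_combination u * hx - (σ j - σ j') * huv⟩).symm
  rw [hi', hj']

lemma HasGauss.mul [Fintype ι] [Fintype κ] (h : IsRes a ρ) (h' : IsRes b σ) (ha : a ∈ O4)
    (hb : b ∈ O4) (ha0 : a ≠ 0) (hb0 : b ≠ 0) {χa χb : ℂ → ℂ} (ca : IsResChar4 a χa)
    (cb : IsResChar4 b χb) {g g' : ℂ} (hg : HasGauss a ρ χa g) (hg' : HasGauss b σ χb g') :
    HasGauss (a * b) (fun x : ι × κ => b * ρ x.1 + a * σ x.2) (fun z => χa z * χb z)
      (χa b * χb a * g * g') := by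
  intro m hm
  have e (x : ι × κ) : χa (b * ρ x.1 + a * σ x.2) * χb (b * ρ x.1 + a * σ x.2) *
      eRe4 ((b * ρ x.1 + a * σ x.2) * m / (a * b)) = (χa b * χb a) *
      ((χa (ρ x.1) * eRe4 (ρ x.1 * m / a)) * (χb (σ x.2) * eRe4 (σ x.2 * m / b))) := by
    have m1 := O4.mul_mem hb (h.mem x.1)
    have m2 := O4.mul_mem ha (h'.mem x.2)
    have e1 : χa (b * ρ x.1 + a * σ x.2) = χa b * χa (ρ x.1) := by
      rw [← ca.map_mul _ hb _ (h.mem _)]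
      exact ca.periodic _ (O4.add_mem m1 m2) _ m1 ⟨_, h'.mem x.2, by ring⟩
    have e2 : χb (b * ρ x.1 + a * σ x.2) = χb a * χb (σ x.2) := by
      rw [← cb.map_mul _ ha _ (h'.mem _)]
      exact cb.periodic _ (O4.add_mem m1 m2) _ m2 ⟨_, h.mem x.1, by ring⟩
    have e3 : (b * ρ x.1 + a * σ x.2) * m / (a * b) = ρ x.1 * m / a + σ x.2 * m / b := by
      field_simp
    rw [e1, e2, e3, eRe4_add]
    ring
  simp only [e]
  rw [← Finset.mul_sum, Fintype.sum_prod_type]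
  simp only
  rw [← Finset.sum_mul_sum, hg m hm, hg' m hm, map_mul]
  ring

lemma IsResChar4.mul_periodic (ha : a ∈ O4) (hb : b ∈ O4) {χa χb : ℂ → ℂ} (ca : IsResChar4 a χa)
    (cb : IsResChar4 b χb) : ∀ x ∈ O4, ∀ y ∈ O4, GCong x y (a * b) →
      χa x * χb x = χa y * χb y := by
  rintro x hx y hy ⟨d, hd, h⟩
  rw [ca.periodic x hx y hy ⟨b * d, O4.mul_mem hb hd, by linear_combination h⟩,
    cb.periodic x hx y hy ⟨a * d, O4.mul_mem ha hd, by linear_combination h⟩]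

lemma IsResChar4.conj {χa : ℂ → ℂ} (ca : IsResChar4 a χa) :
    IsResChar4 a (fun z => (starRingEnd ℂ) (χa z)) :=
  ⟨fun x hx y hy h => by rw [ca.periodic x hx y hy h],
    fun x hx y hy => by simp [ca.map_mul x hx y hy], by simp [ca.map_one],
    fun x hx h => by rw [ca.vanish x hx h, map_zero]⟩

end gauss

lemma one_add_I_mem : 1 + I ∈ O4 := O4.add_mem O4.one_mem I_mem_O4

lemma one_add_I_mul_ne_one {w : ℂ} (hw : w ∈ O4) : (1 + I) * w ≠ 1 := by
  obtain ⟨m, rfl⟩ := exists_gi hw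
  intro h
  have h1 := congrArg re h
  have h2 := congrArg im h
  simp only [mul_re, mul_im, add_re, add_im, one_re, one_im, I_re, I_im, gi_re, gi_im] at h1 h2
  have h1 : m.1 - m.2 = 1 := by exact_mod_cast (by linarith : (m.1 : ℝ) - m.2 = 1)
  have h2 : m.1 + m.2 = 0 := by exact_mod_cast (by linarith : (m.1 : ℝ) + m.2 = 0)
  omega

lemma not_gcoprime_of_even {z w : ℂ} (hz : z ∈ O4) (hw : w ∈ O4) :
    ¬ GCoprime ((1 + I) * z) ((1 + I) * w) := by
  rintro ⟨u, hu, v, hv, h⟩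
  exact one_add_I_mul_ne_one (O4.add_mem (O4.mul_mem hu hz) (O4.mul_mem hv hw))
    (by linear_combination h : (1 + I) * (u * z + v * w) = 1)

lemma lam_eq : (1 + I) ^ 3 = -2 + 2 * I := by
  linear_combination (3 + I) * I_sq

lemma gi_sub (m n : ℤ × ℤ) : gi m - gi n = gi (m.1 - n.1, m.2 - n.2) := by
  simp only [gi]
  push_cast
  ring

lemma gcong_two {m n : ℤ × ℤ} : GCong (gi m) (gi n) 2 ↔ 2 ∣ m.1 - n.1 ∧ 2 ∣ m.2 - n.2 := by
  have e (k : ℤ × ℤ) : 2 * gi k = gi (2 * k.1, 2 * k.2) := by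
    simp only [gi]
    push_cast
    ring
  constructor
  · rintro ⟨d, hd, h⟩
    obtain ⟨k, rfl⟩ := exists_gi hd
    rw [e, gi_sub] at h
    have := Prod.ext_iff.1 (gi_injective h)
    exact ⟨⟨k.1, this.1⟩, ⟨k.2, this.2⟩⟩
  · rintro ⟨⟨x, hx⟩, ⟨y, hy⟩⟩
    exact ⟨gi (x, y), gi_mem_O4 _, by rw [gi_sub, e, hx, hy]⟩

lemma gcong_lam {m n : ℤ × ℤ} : GCong (gi m) (gi n) ((1 + I) ^ 3) ↔
    2 ∣ m.1 - n.1 ∧ 4 ∣ (m.1 - n.1) + (m.2 - n.2) := by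
  have e (k : ℤ × ℤ) : (-2 + 2 * I) * gi k = gi (-2 * k.1 - 2 * k.2, 2 * k.1 - 2 * k.2) := by
    simp only [gi]
    push_cast
    linear_combination (2 * (k.2 : ℂ)) * I_sq
  rw [lam_eq]
  constructor
  · rintro ⟨d, hd, h⟩
    obtain ⟨k, rfl⟩ := exists_gi hd
    rw [e, gi_sub] at h
    have := Prod.ext_iff.1 (gi_injective h)
    simp only at this
    omega
  · rintro ⟨⟨x, hx⟩, ⟨y, hy⟩⟩
    refine ⟨gi (y - x, -y), gi_mem_O4 _, ?_⟩
    rw [e, gi_sub]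
    congr 2 <;> simp only <;> omega

/-- Representatives of the Gaussian integers modulo `2`. -/
def resTwo : Fin 4 → ℤ × ℤ := ![(0, 0), (1, 0), (0, 1), (1, 1)]

/-- Representatives of the Gaussian integers modulo `(1 + i)³`. -/
def resLam : Fin 8 → ℤ × ℤ := ![(1, 0), (0, 1), (-1, 0), (0, -1), (0, 0), (2, 0), (1, 1), (1, -1)]

lemma isRes_two : IsRes 2 (fun k => gi (resTwo k)) := by
  refine ⟨fun k => gi_mem_O4 _, fun z hz => ?_⟩
  obtain ⟨⟨x, y⟩, rfl⟩ := exists_gi hz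
  have hu : ∀ j k : Fin 4, 2 ∣ (resTwo j).1 - (resTwo k).1 ∧ 2 ∣ (resTwo j).2 - (resTwo k).2 →
      j = k := by decide
  have hex : ∃ k, GCong (gi (x, y)) (gi (resTwo k)) 2 := by
    simp only [gcong_two]
    rcases Int.emod_two_eq_zero_or_one x with hx | hx <;>
    rcases Int.emod_two_eq_zero_or_one y with hy | hy
    · exact ⟨0, by simp [resTwo]; omega⟩
    · exact ⟨2, by simp [resTwo]; omega⟩
    · exact ⟨1, by simp [resTwo]; omega⟩
    · exact ⟨3, by simp [resTwo]; omega⟩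
  obtain ⟨k, hk⟩ := hex
  exact ⟨k, hk, fun j hj => hu j k (gcong_two.1 (hj.symm.trans hk))⟩

lemma isRes_lam : IsRes ((1 + I) ^ 3) (fun k => gi (resLam k)) := by
  refine ⟨fun k => gi_mem_O4 _, fun z hz => ?_⟩
  obtain ⟨⟨x, y⟩, rfl⟩ := exists_gi hz
  have hu : ∀ j k : Fin 8, 2 ∣ (resLam j).1 - (resLam k).1 ∧
      4 ∣ ((resLam j).1 - (resLam k).1) + ((resLam j).2 - (resLam k).2) → j = k := by decide
  have hex : ∃ k, GCong (gi (x, y)) (gi (resLam k)) ((1 + I) ^ 3) := by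
    simp only [gcong_lam]
    have h4 : (x + y) % 4 = 0 ∨ (x + y) % 4 = 1 ∨ (x + y) % 4 = 2 ∨ (x + y) % 4 = 3 := by omega
    rcases Int.emod_two_eq_zero_or_one x with hx | hx <;>
    rcases h4 with hy | hy | hy | hy
    · exact ⟨4, by simp [resLam]; omega⟩
    · exact ⟨1, by simp [resLam]; omega⟩
    · exact ⟨5, by simp [resLam]; omega⟩
    · exact ⟨3, by simp [resLam]; omega⟩
    · exact ⟨7, by simp [resLam]; omega⟩
    · exact ⟨0, by simp [resLam]; omega⟩
    · exact ⟨6, by simp [resLam]; omega⟩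
    · exact ⟨2, by simp [resLam]; omega⟩
  obtain ⟨k, hk⟩ := hex
  exact ⟨k, hk, fun j hj => hu j k (gcong_lam.1 (hj.symm.trans hk))⟩

lemma IsChi0'₄.values {c : ℂ → ℂ} (h : IsChi0'₄ c) :
    c (gi (0, 0)) = 0 ∧ c (gi (1, 0)) = 1 ∧ c (gi (0, 1)) = -1 ∧ c (gi (1, 1)) = 0 := by
  have e2 : (2 : ℂ) = (1 + I) * (1 - I) := by linear_combination I_sq
  have hm : 1 - I ∈ O4 := O4.sub_mem O4.one_mem I_mem_O4
  refine ⟨h.1.vanish _ (gi_mem_O4 _) ?_, ?_, ?_, h.1.vanish _ (gi_mem_O4 _) ?_⟩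
  · have := not_gcoprime_of_even O4.zero_mem hm
    rwa [← e2, mul_zero, ← gi_eq_zero.2 rfl] at this
  · simpa [gi] using h.1.map_one
  · simpa [gi] using h.2
  · have := not_gcoprime_of_even O4.one_mem hm
    rw [← e2, mul_one] at this
    simpa [gi] using this

lemma IsChi0₄.values {c : ℂ → ℂ} (h : IsChi0₄ c) (k : Fin 8) :
    c (gi (resLam k)) = ![1, I, -1, -I, 0, 0, 0, 0] k := by
  have e3 : (1 + I) ^ 3 = (1 + I) * (1 + I) ^ 2 := by ring
  have hm : (1 + I) ^ 2 ∈ O4 := O4.pow_mem one_add_I_mem 2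
  have hm' : 1 - I ∈ O4 := O4.sub_mem O4.one_mem I_mem_O4
  have hv {z : ℂ} (hz : z ∈ O4) : c ((1 + I) * z) = 0 := by
    refine h.1.vanish _ (O4.mul_mem one_add_I_mem hz) ?_
    rw [e3]
    exact not_gcoprime_of_even hz hm
  fin_cases k
  · simpa [resLam, gi] using h.2 1 (by simp)
  · simpa [resLam, gi] using h.2 I (by simp)
  · simpa [resLam, gi] using h.2 (-1) (by simp)
  · simpa [resLam, gi] using h.2 (-I) (by simp)
  · simpa [resLam, gi] using hv O4.zero_mem
  · have := hv hm'
    rw [show (1 + I) * (1 - I) = 2 by linear_combination -I_sq] at this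
    simpa [resLam, gi] using this
  · simpa [resLam, gi] using hv O4.one_mem
  · have := hv (O4.neg_mem I_mem_O4)
    rw [show (1 + I) * (-I) = 1 + -I by linear_combination -I_sq] at this
    simpa [resLam, gi] using this

lemma IsChi0'₄.hasGauss {c : ℂ → ℂ} (h : IsChi0'₄ c) :
    HasGauss 2 (fun k => gi (resTwo k)) c (-2) := by
  refine isRes_two.hasGauss two_ne_zero h.1.periodic fun j => ?_
  obtain ⟨h0, h1, h2, h3⟩ := h.values
  have e (i j : Fin 4) : eRe4 (gi (resTwo i) * gi (resTwo j) / 2) =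
      I ^ (2 * ((resTwo i).1 * (resTwo j).1 - (resTwo i).2 * (resTwo j).2)) := by
    refine eRe4_quarter _ ?_
    push_cast
    simp [div_ofNat_re]
    ring
  simp only [e]
  rw [Fin.sum_univ_four]
  fin_cases j <;> simp [resTwo, h0, h1, h2, h3] <;> norm_num

lemma hasGauss_lam_aux {c : ℂ → ℂ} (hc : IsResChar4 ((1 + I) ^ 3) c) (ε : ℂ)
    (hv : ∀ k, c (gi (resLam k)) = ![1, ε, -1, -ε, 0, 0, 0, 0] k) (hε : ε = I ∨ ε = -I) :
    HasGauss ((1 + I) ^ 3) (fun k => gi (resLam k)) c (-2 * (I * (1 - ε))) := by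
  have hl : (1 + I) ^ 3 ≠ 0 := by
    rw [lam_eq]
    intro h
    have := congrArg re h
    simp at this
  refine isRes_lam.hasGauss hl hc.periodic fun j => ?_
  have e (i j : Fin 8) : eRe4 (gi (resLam i) * gi (resLam j) / (1 + I) ^ 3) =
      I ^ (-((resLam i).1 * (resLam j).1 - (resLam i).2 * (resLam j).2) +
        ((resLam i).1 * (resLam j).2 + (resLam i).2 * (resLam j).1)) := by
    refine eRe4_quarter _ ?_
    have : gi (resLam i) * gi (resLam j) / (1 + I) ^ 3 =
        gi (resLam i) * gi (resLam j) * (-1 - I) / 4 := by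
      rw [div_eq_div_iff hl (by norm_num), lam_eq]
      linear_combination (gi (resLam i) * gi (resLam j)) * 2 * I_sq
    rw [this]
    push_cast
    simp [div_ofNat_re]
    ring
  simp only [e, hv]
  rw [Fin.sum_univ_eight]
  have i1 : I ^ (-1 : ℤ) = -I := by simp
  have i2 : I ^ (2 : ℤ) = -1 := by exact_mod_cast I_sq
  have i3 : I ^ (-2 : ℤ) = -1 := by rw [zpow_neg, i2]; norm_num
  rcases hε with rfl | rfl
  all_goals
    fin_cases j <;> simp [resLam, i1, i2, i3] <;> ring_nf <;> simp [I_sq] <;> ring_nf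
lemma IsChi0₄.hasGauss {c : ℂ → ℂ} (h : IsChi0₄ c) :
    HasGauss ((1 + I) ^ 3) (fun k => gi (resLam k)) c (-2 * (I * (1 - I))) :=
  hasGauss_lam_aux h.1 I h.values (Or.inl rfl)

lemma IsChi0₄.hasGauss_conj {c : ℂ → ℂ} (h : IsChi0₄ c) :
    HasGauss ((1 + I) ^ 3) (fun k => gi (resLam k)) (fun z => (starRingEnd ℂ) (c z))
      (-2 * (I * (1 - -I))) :=
  hasGauss_lam_aux h.1.conj (-I) (fun k => by simp only [h.values]; fin_cases k <;> simp)
    (Or.inr rfl)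

/-- A primary prime `π` of norm `p` together with its quartic residue character. -/
structure QDatum (p : ℕ) (π : ℂ) (χ : ℂ → ℂ) : Prop where
  prime : p.Prime
  mod4 : p % 4 = 1
  mem : π ∈ O4
  primary : GCong π 1 ((1 + I) ^ 3)
  norm : (p : ℂ) = π * (starRingEnd ℂ) π
  quartic : IsQuarticChar π p χ

namespace QDatum

variable {p : ℕ} {π : ℂ} {χ : ℂ → ℂ}

lemma exists_re_im (h : QDatum p π χ) : ∃ a b : ℤ, π = a + b * I ∧ a ^ 2 + b ^ 2 = p ∧
    2 ∣ a - 1 ∧ 4 ∣ a - 1 + b := by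
  obtain ⟨m, hm⟩ := exists_gi h.mem
  have h1 := h.primary
  have e1 : (1 : ℂ) = gi (1, 0) := by simp [gi]
  rw [← hm] at h1
  have h2 : 2 ∣ m.1 - 1 ∧ 4 ∣ m.1 - 1 + (m.2 - 0) := by
    refine (gcong_lam (m := m) (n := (1, 0))).1 ?_
    rw [← e1]
    exact h1
  refine ⟨m.1, m.2, hm.symm, ?_, h2.1, by simpa using h2.2⟩
  have h3 := h.norm
  rw [← hm, mul_conj] at h3
  have h4 : (p : ℝ) = normSq (gi m) := by exact_mod_cast h3
  simp only [normSq_apply, gi_re, gi_im] at h4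
  have h5 : (p : ℤ) = m.1 * m.1 + m.2 * m.2 := by exact_mod_cast h4
  rw [h5]
  ring

lemma ne_zero (h : QDatum p π χ) : π ≠ 0 := by
  rintro h0
  have := h.norm
  rw [h0, zero_mul] at this
  exact h.prime.ne_zero (by exact_mod_cast this)

lemma normSq_eq (h : QDatum p π χ) : normSq π = p := by
  have := h.norm
  rw [mul_conj] at this
  exact_mod_cast this.symm

lemma five_le (h : QDatum p π χ) : 5 ≤ p := by
  have h1 := h.prime.two_le
  have h2 := h.mod4
  omega

lemma gcong_int (h : QDatum p π χ) {r s : ℤ} : GCong r s π ↔ (p : ℤ) ∣ r - s := by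
  constructor
  · rintro ⟨d, hd, hr⟩
    obtain ⟨m, rfl⟩ := exists_gi hd
    have h1 : ((r - s : ℤ) : ℂ) = π * gi m := by push_cast; exact hr
    have h2 := congrArg normSq h1
    rw [map_mul, h.normSq_eq] at h2
    simp only [normSq_apply, gi_re, gi_im, intCast_re, intCast_im] at h2
    have h3 : (r - s) * (r - s) + 0 * 0 = p * (m.1 * m.1 + m.2 * m.2) := by exact_mod_cast h2
    have hp : Prime (p : ℤ) := Nat.prime_iff_prime_int.1 h.prime
    exact (hp.dvd_mul.1 (⟨m.1 * m.1 + m.2 * m.2, by linarith⟩ : (p : ℤ) ∣ (r - s) * (r - s))).elim id id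
  · rintro ⟨k, hk⟩
    refine ⟨(starRingEnd ℂ) π * k, O4.mul_mem (star_mem_O4 h.mem) (intCast_mem O4 k), ?_⟩
    rw [← mul_assoc, ← h.norm]
    exact_mod_cast hk

lemma exists_int (h : QDatum p π χ) {z : ℂ} (hz : z ∈ O4) : ∃ n : ℤ, GCong z n π := by
  obtain ⟨a, b, hab, hn, -, -⟩ := h.exists_re_im
  have hp : Prime (p : ℤ) := Nat.prime_iff_prime_int.1 h.prime
  have hb : ¬ (p : ℤ) ∣ b := by
    intro hb
    have ha : (p : ℤ) ∣ a ^ 2 := by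
      rw [show a ^ 2 = p - b ^ 2 by linarith]
      exact dvd_sub dvd_rfl (dvd_pow hb two_ne_zero)
    have ha := hp.dvd_of_dvd_pow ha
    have : (p : ℤ) ^ 2 ∣ p := by
      conv_rhs => rw [← hn]
      exact dvd_add (pow_dvd_pow_of_dvd ha 2) (pow_dvd_pow_of_dvd hb 2)
    have h1 := Int.le_of_dvd (by exact_mod_cast h.prime.pos) this
    have := h.five_le
    nlinarith
  obtain ⟨u, v, huv⟩ := ((Prime.coprime_iff_not_dvd hp).2 hb)
  obtain ⟨x, y, rfl⟩ := mem_O4_iff.1 hz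
  refine ⟨x - y * a * v, y * v + y * u * (starRingEnd ℂ) π * I, ?_, ?_⟩
  · exact O4.add_mem (O4.mul_mem (intCast_mem O4 _) (intCast_mem O4 _))
      (O4.mul_mem (O4.mul_mem (O4.mul_mem (intCast_mem O4 _) (intCast_mem O4 _))
        (star_mem_O4 h.mem)) I_mem_O4)
  · have huv' : (u : ℂ) * p + v * b = 1 := by exact_mod_cast huv
    push_cast
    linear_combination (-(y : ℂ) * I) * huv' + (y * u * I) * h.norm - y * v * hab

lemma not_gcong_zero_iff (h : QDatum p π χ) {z : ℂ} (hz : z ∈ O4) :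
    GCoprime z π ↔ ¬ GCong z 0 π := by
  obtain ⟨n, hn⟩ := h.exists_int hz
  have hp : Prime (p : ℤ) := Nat.prime_iff_prime_int.1 h.prime
  constructor
  · rintro ⟨u, hu, v, hv, huv⟩ ⟨d, hd, hz0⟩
    have : GCong ((1 : ℤ) : ℂ) ((0 : ℤ) : ℂ) π :=
      ⟨u * d + v, O4.add_mem (O4.mul_mem hu hd) hv, by
        push_cast
        linear_combination -huv + u * hz0⟩
    rw [h.gcong_int] at this
    exact hp.not_dvd_one (by simpa using this)
  · intro hz0
    have : ¬ (p : ℤ) ∣ n := by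
      intro hd
      refine hz0 (hn.trans ?_)
      have := h.gcong_int.2 (by simpa using hd : (p : ℤ) ∣ n - 0)
      simpa using this
    obtain ⟨u, v, huv⟩ := ((Prime.coprime_iff_not_dvd hp).2 this)
    obtain ⟨d, hd, hz1⟩ := hn
    refine ⟨v, intCast_mem O4 _, u * (starRingEnd ℂ) π - v * d, ?_, ?_⟩
    · exact O4.sub_mem (O4.mul_mem (intCast_mem O4 _) (star_mem_O4 h.mem))
        (O4.mul_mem (intCast_mem O4 _) hd)
    · have huv' : (u : ℂ) * p + v * n = 1 := by exact_mod_cast huv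
      linear_combination huv' + (v : ℂ) * hz1 - u * h.norm

lemma chi_pow_four (h : QDatum p π χ) {z : ℂ} (hz : z ∈ O4) (h0 : ¬ GCong z 0 π) : χ z ^ 4 = 1 :=
  h.quartic.quart z hz ((h.not_gcong_zero_iff hz).2 h0)

lemma chi_eq_zero (h : QDatum p π χ) {z : ℂ} (hz : z ∈ O4) (h0 : GCong z 0 π) : χ z = 0 :=
  h.quartic.resChar.vanish z hz fun hc => (h.not_gcong_zero_iff hz).1 hc h0

end QDatum

lemma eq_of_pow_four {x : ℂ} (hx : x ^ 4 = 1) : x = 1 ∨ x = -1 ∨ x = I ∨ x = -I := by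
  have h : (x - 1) * ((x + 1) * ((x - I) * (x + I))) = 0 := by
    linear_combination hx - (x ^ 2 - 1) * I_sq
  rcases mul_eq_zero.1 h with h | h
  · exact Or.inl (sub_eq_zero.1 h)
  rcases mul_eq_zero.1 h with h | h
  · exact Or.inr (Or.inl (eq_neg_of_add_eq_zero_left h))
  rcases mul_eq_zero.1 h with h | h
  · exact Or.inr (Or.inr (Or.inl (sub_eq_zero.1 h)))
  · exact Or.inr (Or.inr (Or.inr (eq_neg_of_add_eq_zero_left h)))

lemma mem_O4_of_pow_four {x : ℂ} (hx : x ^ 4 = 1) : x ∈ O4 := by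
  rcases eq_of_pow_four hx with rfl | rfl | rfl | rfl
  · exact O4.one_mem
  · exact O4.neg_mem O4.one_mem
  · exact I_mem_O4
  · exact O4.neg_mem I_mem_O4

lemma norm_of_pow_four {x : ℂ} (hx : x ^ 4 = 1) : ‖x‖ = 1 := by
  rcases eq_of_pow_four hx with rfl | rfl | rfl | rfl <;> simp

namespace QDatum

variable {p : ℕ} {π : ℂ} {χ : ℂ → ℂ}

lemma eq_of_gcong (h : QDatum p π χ) {x y : ℂ} (hx : x ^ 4 = 1) (hy : y ^ 4 = 1)
    (hxy : GCong x y π) : x = y := by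
  obtain ⟨d, hd, hxy⟩ := hxy
  obtain ⟨m, rfl⟩ := exists_gi hd
  have h1 : normSq (x - y) ≤ 4 := by
    rw [normSq_eq_norm_sq]
    have := norm_sub_le x y
    rw [norm_of_pow_four hx, norm_of_pow_four hy] at this
    nlinarith [norm_nonneg (x - y)]
  rw [hxy, map_mul, h.normSq_eq] at h1
  simp only [normSq_apply, gi_re, gi_im] at h1
  have h2 : (p : ℤ) * (m.1 * m.1 + m.2 * m.2) ≤ 4 := by exact_mod_cast h1
  have h5 : (5 : ℤ) ≤ p := by exact_mod_cast h.five_le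
  have h3 : m.1 * m.1 + m.2 * m.2 = 0 := by nlinarith [mul_self_nonneg m.1, mul_self_nonneg m.2]
  have h4 : m = 0 := by
    have h1 := mul_self_nonneg m.1
    have h2 := mul_self_nonneg m.2
    exact Prod.ext (mul_self_eq_zero.1 (by linarith)) (mul_self_eq_zero.1 (by linarith))
  rw [gi_eq_zero.2 h4, mul_zero] at hxy
  exact sub_eq_zero.1 hxy

lemma isRes (h : QDatum p π χ) [NeZero p] : IsRes π (fun r : ZMod p => ((r.val : ℕ) : ℂ)) := by
  refine ⟨fun r => natCast_mem O4 _, fun z hz => ?_⟩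
  obtain ⟨n, hn⟩ := h.exists_int hz
  have key (r : ZMod p) : GCong z ((r.val : ℕ) : ℂ) π ↔ r = (n : ZMod p) := by
    have h1 : GCong z ((r.val : ℕ) : ℂ) π ↔ GCong ((n : ℤ) : ℂ) (((r.val : ℕ) : ℤ) : ℂ) π := by
      push_cast
      exact ⟨fun hr => hn.symm.trans hr, fun hr => hn.trans hr⟩
    rw [h1, h.gcong_int, ← ZMod.intCast_zmod_eq_zero_iff_dvd]
    push_cast
    rw [ZMod.natCast_zmod_val, sub_eq_zero, eq_comm]
  exact ⟨n, (key _).2 rfl, fun r hr => (key r).1 hr⟩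

lemma chi_intCast (h : QDatum p π χ) [NeZero p] (n : ℤ) :
    χ n = χ (((n : ZMod p).val : ℕ) : ℂ) := by
  refine h.quartic.resChar.periodic _ (intCast_mem O4 _) _ (natCast_mem O4 _) ?_
  have : GCong (n : ℂ) ((((n : ZMod p).val : ℕ) : ℤ) : ℂ) π := by
    rw [h.gcong_int, ← ZMod.intCast_zmod_eq_zero_iff_dvd]
    push_cast
    rw [ZMod.natCast_zmod_val, sub_self]
  simpa using this

lemma val_ne_zero (h : QDatum p π χ) [NeZero p] {r : ZMod p} (hr : r ≠ 0) :
    ¬ GCong ((r.val : ℕ) : ℂ) 0 π := by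
  intro h0
  have : GCong (((r.val : ℕ) : ℤ) : ℂ) ((0 : ℤ) : ℂ) π := by simpa using h0
  rw [h.gcong_int, ← ZMod.intCast_zmod_eq_zero_iff_dvd] at this
  push_cast at this
  rw [ZMod.natCast_zmod_val, sub_zero] at this
  exact hr this

lemma exists_gaussianInt (h : QDatum p π χ) [NeZero p] (r : ZMod p) :
    ∃ x : GaussianInt, GaussianInt.toComplex x = χ ((r.val : ℕ) : ℂ) := by
  by_cases hr : r = 0
  · subst hr
    exact ⟨0, by simp [h.chi_eq_zero O4.zero_mem (GCong.refl 0 _)]⟩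
  · obtain ⟨m, hm⟩ := exists_gi (mem_O4_of_pow_four
      (h.chi_pow_four (natCast_mem O4 _) (h.val_ne_zero hr)))
    exact ⟨⟨m.1, m.2⟩, by rw [← hm, GaussianInt.toComplex_def]; rfl⟩

/-- The quartic residue character as a multiplicative character of `ZMod p` with values in `ℤ[i]`. -/
def char (h : QDatum p π χ) [Fact p.Prime] : MulChar (ZMod p) GaussianInt where
  toFun r := (h.exists_gaussianInt r).choose
  map_one' := by
    apply GaussianInt.toComplex_injective
    have := h.chi_intCast 1
    rw [(h.exists_gaussianInt 1).choose_spec]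
    simp only [Int.cast_one] at this
    rw [← this, h.quartic.resChar.map_one, map_one]
  map_mul' r s := by
    apply GaussianInt.toComplex_injective
    rw [map_mul, (h.exists_gaussianInt _).choose_spec, (h.exists_gaussianInt _).choose_spec,
      (h.exists_gaussianInt _).choose_spec, ← h.quartic.resChar.map_mul _ (natCast_mem O4 _) _
        (natCast_mem O4 _)]
    have := h.chi_intCast (r.val * s.val)
    push_cast [ZMod.natCast_zmod_val] at this
    rw [this]
  map_nonunit' r hr := by
    apply GaussianInt.toComplex_injective
    rw [isUnit_iff_ne_zero, not_not] at hr
    subst hr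
    rw [map_zero]
    refine (h.exists_gaussianInt 0).choose_spec.trans ?_
    rw [ZMod.val_zero, Nat.cast_zero, h.chi_eq_zero O4.zero_mem (GCong.refl 0 _)]

lemma toComplex_char (h : QDatum p π χ) [Fact p.Prime] (r : ZMod p) :
    GaussianInt.toComplex (h.char r) = χ ((r.val : ℕ) : ℂ) :=
  (h.exists_gaussianInt r).choose_spec

lemma toComplex_char_intCast (h : QDatum p π χ) [Fact p.Prime] (n : ℤ) :
    GaussianInt.toComplex (h.char n) = χ n := by
  rw [h.toComplex_char, ← h.chi_intCast]

lemma euler_int (h : QDatum p π χ) {n : ℤ} (hn : ¬ (p : ℤ) ∣ n) :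
    GCong (χ n) (n ^ ((p - 1) / 4)) π := by
  refine h.quartic.euler n (intCast_mem O4 _) ((h.not_gcong_zero_iff (intCast_mem O4 _)).2 ?_)
  intro h0
  have : GCong (n : ℂ) ((0 : ℤ) : ℂ) π := by simpa using h0
  rw [h.gcong_int, sub_zero] at this
  exact hn this

lemma char_sq_ne_one (h : QDatum p π χ) [Fact p.Prime] : h.char ^ 2 ≠ 1 := by
  intro h1
  obtain ⟨g, hg⟩ := IsCyclic.exists_generator (α := (ZMod p)ˣ)
  have h2 : χ (((g : ZMod p).val : ℕ) : ℂ) ^ 2 = 1 := by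
    rw [← h.toComplex_char, ← map_pow, ← MulChar.pow_apply_coe, h1, MulChar.one_apply_coe, map_one]
  set n : ℤ := (((g : ZMod p).val : ℕ) : ℤ) with hn
  have hnc : ((n : ℤ) : ℂ) = (((g : ZMod p).val : ℕ) : ℂ) := by simp [hn]
  have hng : (n : ZMod p) = g := by simp [hn]
  have hnd : ¬ (p : ℤ) ∣ n := by
    rw [← ZMod.intCast_zmod_eq_zero_iff_dvd, hng]
    exact g.ne_zero
  obtain ⟨d, hd, he⟩ := h.euler_int hnd
  have hx := h.chi_pow_four (natCast_mem O4 _) (h.val_ne_zero g.ne_zero)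
  rw [← hnc] at hx h2
  have h3 : GCong ((n ^ ((p - 1) / 4 * 2) : ℤ) : ℂ) ((1 : ℤ) : ℂ) π := by
    refine ⟨-(d * (χ n + n ^ ((p - 1) / 4))), O4.neg_mem (O4.mul_mem hd (O4.add_mem
      (mem_O4_of_pow_four hx) (O4.pow_mem (intCast_mem O4 _) _))), ?_⟩
    push_cast
    rw [pow_mul]
    linear_combination h2 - (χ n + n ^ ((p - 1) / 4)) * he
  rw [h.gcong_int, ← ZMod.intCast_zmod_eq_zero_iff_dvd] at h3
  push_cast at h3
  rw [hng, sub_eq_zero] at h3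
  have h4 : g ^ ((p - 1) / 4 * 2) = 1 := by
    apply Units.ext
    push_cast
    exact h3
  have h5 := orderOf_dvd_of_pow_eq_one h4
  rw [orderOf_eq_card_of_forall_mem_zpowers hg, Nat.card_eq_fintype_card, ZMod.card_units] at h5
  have h6 := Nat.le_of_dvd (by have := h.five_le; omega) h5
  have := h.five_le
  omega

lemma char_ne_one (h : QDatum p π χ) [Fact p.Prime] : h.char ≠ 1 := fun h1 =>
  h.char_sq_ne_one (by rw [h1, one_pow])

end QDatum

lemma sum_Icc_eq_sum_zmod {p : ℕ} [NeZero p] (f : ℕ → ℂ) (h0 : f 0 = 0) :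
    ∑ r ∈ Finset.Icc 1 (p - 1), f r = ∑ r : ZMod p, f r.val := by
  obtain ⟨n, rfl⟩ := Nat.exists_eq_succ_of_ne_zero (NeZero.ne p)
  have h1 : ∑ r : ZMod (n + 1), f r.val = ∑ i ∈ Finset.range (n + 1), f i :=
    Fin.sum_univ_eq_sum_range f (n + 1)
  rw [h1, Finset.range_eq_Ico, Finset.sum_eq_sum_Ico_succ_bot n.succ_pos, h0, zero_add]
  rfl

namespace QDatum

variable {p : ℕ} {π : ℂ} {χ : ℂ → ℂ}

/-- The quartic residue character as a complex valued multiplicative character of `ZMod p`. -/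
def cchar (h : QDatum p π χ) [Fact p.Prime] : MulChar (ZMod p) ℂ :=
  h.char.ringHomComp GaussianInt.toComplex

lemma cchar_apply (h : QDatum p π χ) [Fact p.Prime] (r : ZMod p) :
    h.cchar r = χ ((r.val : ℕ) : ℂ) := h.toComplex_char r

lemma cchar_intCast (h : QDatum p π χ) [Fact p.Prime] (n : ℤ) : h.cchar n = χ n :=
  h.toComplex_char_intCast n

lemma cchar_ne_one (h : QDatum p π χ) [Fact p.Prime] : h.cchar ≠ 1 :=
  (MulChar.ringHomComp_ne_one_iff GaussianInt.toComplex_injective).2 h.char_ne_one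

lemma chi_zero (h : QDatum p π χ) : χ 0 = 0 := h.chi_eq_zero O4.zero_mem (GCong.refl 0 _)

lemma G4sum_eq (h : QDatum p π χ) [Fact p.Prime] :
    G4sum p χ = gaussSum h.cchar ZMod.stdAddChar := by
  unfold G4sum gaussSum
  rw [sum_Icc_eq_sum_zmod (fun r : ℕ => χ (r : ℂ) * exp (2 * Real.pi * I * (r : ℂ) / (p : ℂ)))
    (by simp [h.chi_zero])]
  refine Finset.sum_congr rfl fun r _ => ?_
  rw [h.cchar_apply]
  have := ZMod.stdAddChar_coe (N := p) (r.val : ℤ)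
  push_cast [ZMod.natCast_zmod_val] at this
  rw [this]

lemma conj_chi_mul (h : QDatum p π χ) {z : ℂ} (hz : z ∈ O4) (h0 : ¬ GCong z 0 π) :
    (starRingEnd ℂ) (χ z) * χ z = 1 := by
  rcases eq_of_pow_four (h.chi_pow_four hz h0) with h1 | h1 | h1 | h1 <;> simp [h1]

lemma eRe4_int (h : QDatum p π χ) [Fact p.Prime] {a : ℤ} (ha : π.re = a) (n : ℤ) :
    eRe4 (n / π) = ZMod.stdAddChar ((a * n : ℤ) : ZMod p) := by
  rw [ZMod.stdAddChar_coe, eRe4]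
  congr 1
  have : ((n : ℂ) / π).re = a * n / p := by
    rw [div_re, h.normSq_eq, ha]
    simp
    ring
  rw [this]
  push_cast
  ring

/-- The Gauss sum of the quartic residue character modulo `π`. -/
lemma hasGauss (h : QDatum p π χ) [Fact p.Prime] {a : ℤ} (ha : π.re = a) :
    HasGauss π (fun r : ZMod p => ((r.val : ℕ) : ℂ)) χ ((starRingEnd ℂ) (χ a) * G4sum p χ) := by
  obtain ⟨a', b, hab, hn, -, -⟩ := h.exists_re_im
  have haa : a = a' := by
    have h1 : π.re = a' := by simp [hab]
    exact_mod_cast ha.symm.trans h1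
  subst haa
  have hpa : ((a : ℤ) : ZMod p) ≠ 0 := by
    intro h0
    rw [ZMod.intCast_zmod_eq_zero_iff_dvd] at h0
    have hp : Prime (p : ℤ) := Nat.prime_iff_prime_int.1 h.prime
    have hb : (p : ℤ) ∣ b ^ 2 := by
      rw [show b ^ 2 = p - a ^ 2 by linarith]
      exact dvd_sub dvd_rfl (dvd_pow h0 two_ne_zero)
    have hb := hp.dvd_of_dvd_pow hb
    have : (p : ℤ) ^ 2 ∣ p := by
      conv_rhs => rw [← hn]
      exact dvd_add (pow_dvd_pow_of_dvd h0 2) (pow_dvd_pow_of_dvd hb 2)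
    have h1 := Int.le_of_dvd (by exact_mod_cast h.prime.pos) this
    have := h.five_le
    nlinarith
  refine h.isRes.hasGauss h.ne_zero h.quartic.resChar.periodic fun j => ?_
  have e (r : ZMod p) : χ ((r.val : ℕ) : ℂ) * eRe4 (((r.val : ℕ) : ℂ) * ((j.val : ℕ) : ℂ) / π) =
      h.cchar r * ZMod.stdAddChar.mulShift (a * j : ZMod p) r := by
    rw [h.cchar_apply, AddChar.mulShift_apply]
    have := h.eRe4_int ha ((r.val : ℤ) * (j.val : ℤ))
    push_cast [ZMod.natCast_zmod_val] at this
    rw [this, mul_comm r, mul_assoc]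
  simp only [e]
  change gaussSum _ _ = _
  by_cases hj : j = 0
  · subst hj
    rw [mul_zero, AddChar.mulShift_zero, gaussSum_one_right h.cchar_ne_one]
    simp [h.chi_zero]
  · obtain ⟨u, hu⟩ := (mul_ne_zero hpa hj).isUnit
    have h1 := gaussSum_mulShift h.cchar ZMod.stdAddChar u
    have h2 : h.cchar u = χ a * χ ((j.val : ℕ) : ℂ) := by
      rw [hu, map_mul, h.cchar_intCast, h.cchar_apply]
    have h3 := h.conj_chi_mul (natCast_mem O4 _) (h.val_ne_zero hj)
    have h4 := h.conj_chi_mul (natCast_mem O4 _) (h.val_ne_zero hpa)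
    rw [← h.chi_intCast] at h4
    rw [h.G4sum_eq, ← h1, h2, hu]
    linear_combination -(gaussSum h.cchar (ZMod.stdAddChar.mulShift (a * j : ZMod p))) *
      (h3 * (starRingEnd ℂ) (χ a) * χ a + h4)

end QDatum

lemma IsLValue4.sq_eq {ι : Type*} [Fintype ι] {β : ℂ} {ρ : ι → ℂ} {χ₁ : ℂ → ℂ} (h : IsRes β ρ)
    (hβ : β ∈ O4) (h0 : β ≠ 0)
    (hper : ∀ a ∈ O4, ∀ b ∈ O4, GCong a b β → χ₁ a = χ₁ b) {g : ℂ} (hg : HasGauss β ρ χ₁ g)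
    {L : ℂ} (hL : IsLValue4 χ₁ L) : L ^ 2 = -I * (g / β) * ((‖L‖ ^ 2 : ℝ) : ℂ) := by
  have h1 := hL.eq_conj h hβ h0 hper hg
  have h2 := mul_conj' L
  push_cast
  rw [← h2]
  linear_combination L * h1

namespace QDatum

variable {p : ℕ} {π : ℂ} {χ : ℂ → ℂ}

lemma EGS4_eq (h : QDatum p π χ) [Fact p.Prime] (f : ℂ → ℂ) :
    EGS4 p χ f π = (1 / 4 : ℂ) * ∑ r : ZMod p, χ ((r.val : ℕ) : ℂ) * f (((r.val : ℕ) : ℂ) / π) := by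
  rw [EGS4, sum_Icc_eq_sum_zmod (fun r : ℕ => χ (r : ℂ) * f ((r : ℂ) / π)) (by simp [h.chi_zero])]

lemma lvalue_eq (h : QDatum p π χ) {L : ℂ} (hL : IsLValue4 χ L) : L = π⁻¹ * EGS4 p χ EK π := by
  have : Fact p.Prime := ⟨h.prime⟩
  rw [hL.eq_sum h.isRes h.mem h.ne_zero h.quartic.resChar.periodic, h.EGS4_eq]
  ring

lemma lvalue_sq (h : QDatum p π χ) {L : ℂ} (hL : IsLValue4 χ L) {a : ℤ} (ha : π.re = a) :
    L ^ 2 = -I * ((starRingEnd ℂ) (χ a) * G4sum p χ / π) * ((‖L‖ ^ 2 : ℝ) : ℂ) := by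
  have : Fact p.Prime := ⟨h.prime⟩
  exact hL.sq_eq h.isRes h.mem h.ne_zero h.quartic.resChar.periodic (h.hasGauss ha)

section twist

variable {κ : Type*} [Fintype κ] {b : ℂ} {σ : κ → ℂ} {χb : ℂ → ℂ} {L : ℂ}

lemma coprime_of_gcong (hb : GCong π 1 b) : ∃ u ∈ O4, ∃ v ∈ O4, u * π + v * b = 1 := by
  obtain ⟨d, hd, hb⟩ := hb
  exact ⟨1, O4.one_mem, -d, O4.neg_mem hd, by linear_combination hb⟩

lemma char_b_eq_one (h : QDatum p π χ) (hb : GCong π 1 b) (cb : IsResChar4 b χb) : χb π = 1 := by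
  rw [cb.periodic _ h.mem _ O4.one_mem hb, cb.map_one]

lemma lvalue_twist_eq (h : QDatum p π χ) (hbm : b ∈ O4) (hb0 : b ≠ 0) (hb : GCong π 1 b)
    (hσ : IsRes b σ) (cb : IsResChar4 b χb) (hL : IsLValue4 (fun z => χ z * χb z) L) :
    L = (π * b)⁻¹ * χ b * EGS4 p χ (fun u => ∑ k, χb (σ k) * EK (u + σ k / b)) π := by
  have : Fact p.Prime := ⟨h.prime⟩
  have hπ0 := h.ne_zero
  rw [hL.eq_sum (h.isRes.mul hσ h.mem hbm (coprime_of_gcong hb)) (O4.mul_mem h.mem hbm)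
    (mul_ne_zero h.ne_zero hb0) (IsResChar4.mul_periodic h.mem hbm h.quartic.resChar cb), h.EGS4_eq,
    Fintype.sum_prod_type]
  have e (r : ZMod p) (k : κ) : χ (b * ((r.val : ℕ) : ℂ) + π * σ k) *
      χb (b * ((r.val : ℕ) : ℂ) + π * σ k) * EK ((b * ((r.val : ℕ) : ℂ) + π * σ k) / (π * b)) =
      χ b * (χ ((r.val : ℕ) : ℂ) * (χb (σ k) * EK (((r.val : ℕ) : ℂ) / π + σ k / b))) := by
    have m1 := O4.mul_mem hbm (natCast_mem O4 r.val)
    have m2 := O4.mul_mem h.mem (hσ.mem k)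
    have e1 : χ (b * ((r.val : ℕ) : ℂ) + π * σ k) = χ b * χ ((r.val : ℕ) : ℂ) := by
      rw [← h.quartic.resChar.map_mul _ hbm _ (natCast_mem O4 _)]
      exact h.quartic.resChar.periodic _ (O4.add_mem m1 m2) _ m1 ⟨σ k, hσ.mem k, by ring⟩
    have e2 : χb (b * ((r.val : ℕ) : ℂ) + π * σ k) = χb (σ k) := by
      rw [← one_mul (χb (σ k)), ← h.char_b_eq_one hb cb, ← cb.map_mul _ h.mem _ (hσ.mem k)]
      exact cb.periodic _ (O4.add_mem m1 m2) _ m2 ⟨_, natCast_mem O4 r.val, by ring⟩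
    have e3 : (b * ((r.val : ℕ) : ℂ) + π * σ k) / (π * b) = ((r.val : ℕ) : ℂ) / π + σ k / b := by
      field_simp
    rw [e1, e2, e3]
    ring
  simp only [e, ← Finset.mul_sum]
  ring

lemma lvalue_twist_sq (h : QDatum p π χ) (hbm : b ∈ O4) (hb0 : b ≠ 0) (hb : GCong π 1 b)
    (hσ : IsRes b σ) (cb : IsResChar4 b χb) (hL : IsLValue4 (fun z => χ z * χb z) L) {a : ℤ}
    (ha : π.re = a) {g : ℂ} (hg : HasGauss b σ χb g) :
    L ^ 2 = -I * (χ b * ((starRingEnd ℂ) (χ a) * G4sum p χ) * g / (π * b)) *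
      ((‖L‖ ^ 2 : ℝ) : ℂ) := by
  have : Fact p.Prime := ⟨h.prime⟩
  have := hL.sq_eq (h.isRes.mul hσ h.mem hbm (coprime_of_gcong hb)) (O4.mul_mem h.mem hbm)
    (mul_ne_zero h.ne_zero hb0) (IsResChar4.mul_periodic h.mem hbm h.quartic.resChar cb)
    (HasGauss.mul h.isRes hσ h.mem hbm h.ne_zero hb0 h.quartic.resChar cb (h.hasGauss ha) hg)
  rw [this, h.char_b_eq_one hb cb, mul_one]

end twist

end QDatum

section quadratic

lemma hasSum_jacobiTheta {τ : ℂ} (hτ : 0 < τ.im) :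
    HasSum (fun n : ℤ => cexp (Real.pi * I * (n : ℂ) ^ 2 * τ)) (jacobiTheta τ) := by
  have := hasSum_jacobiTheta₂_term 0 hτ
  simp_rw [jacobiTheta₂_term, mul_zero, zero_add, ← jacobiTheta_eq_jacobiTheta₂] at this
  exact this

lemma jacobiTheta_neg_inv {τ : ℂ} (hτ : 0 < τ.im) :
    jacobiTheta (-τ⁻¹) = (-I * τ) ^ (1 / 2 : ℂ) * jacobiTheta τ := by
  have := jacobiTheta_S_smul ⟨τ, hτ⟩
  rw [UpperHalfPlane.modular_S_smul] at this
  convert! this using 2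
  simp [inv_neg]

lemma jacobiTheta_rational {p : ℕ} [NeZero p] {z : ℝ} (hz : 0 < z) :
    jacobiTheta (2 / p + I * z) = ∑ r : Fin p, cexp (2 * Real.pi * I * (r : ℕ) ^ 2 / p) *
      (evenKernel ((((r : ℕ) / p : ℝ)) : UnitAddCircle) (p ^ 2 * z) : ℝ) := by
  have hp : (0 : ℝ) < p := by exact_mod_cast Nat.pos_of_ne_zero (NeZero.ne p)
  have hpc : (p : ℂ) ≠ 0 := by exact_mod_cast NeZero.ne p
  have him : 0 < (2 / p + I * z : ℂ).im := by
    have : (2 / p : ℂ) = ((2 / p : ℝ) : ℂ) := by push_cast; rfl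
    rw [this]
    simpa using hz
  refine (hasSum_jacobiTheta him).unique ?_
  rw [← ((Equiv.prodComm _ _).trans (Int.divModEquiv p).symm).hasSum_iff]
  refine hasSum_prod_fintype fun r => ?_
  refine ((Complex.hasSum_ofReal.2 (hasSum_int_evenKernel ((r : ℕ) / p : ℝ)
    (mul_pos (pow_pos hp 2) hz))).mul_left _).congr_fun_eq fun n => ?_
  have e : ((Equiv.prodComm (Fin p) ℤ).trans (Int.divModEquiv p).symm) (r, n) =
    n * p + ((r : ℕ) : ℤ) := rfl
  rw [Function.comp, e, ofReal_exp, ← Complex.exp_add, Complex.exp_eq_exp_iff_exists_int]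
  refine ⟨n ^ 2 * p + 2 * n * (r : ℕ), ?_⟩
  push_cast
  field_simp
  ring_nf
  simp only [I_sq]
  ring

lemma tendsto_cosKernel_atTop (a : UnitAddCircle) : Tendsto (cosKernel a) atTop (nhds 1) := by
  obtain ⟨q, hq, h⟩ := isBigO_atTop_cosKernel_sub a
  have h1 : Tendsto (fun x : ℝ => Real.exp (-q * x)) atTop (nhds 0) :=
    Real.tendsto_exp_atBot.comp (tendsto_id.const_mul_atTop_of_neg (neg_lt_zero.2 hq))
  have := (h.trans_tendsto h1).add_const 1
  simpa using this

lemma tendsto_sqrt_mul_evenKernel (a : UnitAddCircle) {c : ℝ} (hc : 0 < c) :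
    Tendsto (fun z : ℝ => Real.sqrt z * evenKernel a (c ^ 2 * z)) (nhdsWithin 0 (Ioi 0))
      (nhds c⁻¹) := by
  have h1 : Tendsto (fun z : ℝ => 1 / (c ^ 2 * z)) (nhdsWithin 0 (Ioi 0)) atTop := by
    have := tendsto_inv_nhdsGT_zero (𝕜 := ℝ)
    refine (this.const_mul_atTop (r := (c ^ 2)⁻¹) (by positivity)).congr fun z => ?_
    rw [one_div, mul_inv]
  have h2 := ((tendsto_cosKernel_atTop a).comp h1).const_mul c⁻¹
  rw [mul_one] at h2
  refine h2.congr' ?_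
  filter_upwards [self_mem_nhdsWithin] with z hz
  have hz : 0 < z := hz
  rw [evenKernel_functional_equation, ← Real.sqrt_eq_rpow, Real.sqrt_mul (by positivity),
    Real.sqrt_sq hc.le]
  have := (Real.sqrt_pos.2 hz).ne'
  simp only [Function.comp]
  field_simp

lemma jacobiTheta_neg_half_add {p : ℕ} (hp : p % 4 = 1) {v : ℂ} (hv : 0 < v.im) :
    jacobiTheta (-(p / 2) + v) = (1 + I) * jacobiTheta (4 * v) - I * jacobiTheta v := by
  have h4 : 0 < (4 * v).im := by simpa using hv
  have h1 : 0 < (-(p / 2) + v).im := by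
    have : (p / 2 : ℂ) = ((p / 2 : ℝ) : ℂ) := by push_cast; rfl
    rw [this]
    simpa using hv
  have hinj : Function.Injective (fun n : ℤ => 2 * n) := mul_right_injective₀ two_ne_zero
  have hE : HasSum (fun n : ℤ => if Even n then cexp (Real.pi * I * (n : ℂ) ^ 2 * v) else 0)
      (jacobiTheta (4 * v)) := by
    refine (hinj.hasSum_iff ?_).1 ((hasSum_jacobiTheta h4).congr_fun_eq fun n => ?_)
    · intro n hn
      rw [if_neg]
      rintro ⟨m, rfl⟩
      exact hn ⟨m, by simp [two_mul]⟩
    · simp only [Function.comp, even_two_mul, if_true]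
      congr 1
      push_cast
      ring
  refine (hasSum_jacobiTheta h1).unique (((hE.mul_left (1 + I)).sub
    ((hasSum_jacobiTheta hv).mul_left I)).congr_fun_eq fun n => ?_)
  have e : Real.pi * I * (n : ℂ) ^ 2 * (-(p / 2) + v) =
      Real.pi * I * (n : ℂ) ^ 2 * v + -(Real.pi * I * (n : ℂ) ^ 2 * (p / 2)) := by ring
  rw [e, Complex.exp_add]
  obtain ⟨q, hq⟩ : ∃ q : ℕ, p = 4 * q + 1 := ⟨p / 4, by omega⟩
  rcases Int.even_or_odd n with he | ho
  · rw [if_pos he]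
    obtain ⟨m, rfl⟩ := he
    have : cexp (-(Real.pi * I * ((m + m : ℤ) : ℂ) ^ 2 * (p / 2))) = 1 := by
      rw [Complex.exp_eq_one_iff]
      exact ⟨-(m ^ 2 * p), by push_cast; ring⟩
    rw [this]
    ring
  · rw [if_neg (Int.not_even_iff_odd.2 ho)]
    obtain ⟨m, rfl⟩ := ho
    have : cexp (-(Real.pi * I * ((2 * m + 1 : ℤ) : ℂ) ^ 2 * (p / 2))) = -I := by
      have h : -I = cexp (-(Real.pi / 2 * I)) := by rw [Complex.exp_neg, exp_pi_div_two_mul_I, inv_I]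
      rw [h, Complex.exp_eq_exp_iff_exists_int]
      refine ⟨-((m ^ 2 + m) * p + q), ?_⟩
      rw [hq]
      push_cast
      ring
    rw [this]
    ring

lemma ofReal_mul_cpow_half {z : ℝ} (hz : 0 < z) {w : ℂ} (hw : w ≠ 0) :
    ((z : ℂ) * w) ^ (1 / 2 : ℂ) = (Real.sqrt z : ℝ) * w ^ (1 / 2 : ℂ) := by
  have hzc : (z : ℂ) ≠ 0 := ofReal_ne_zero.2 hz.ne'
  rw [cpow_def_of_ne_zero (mul_ne_zero hzc hw), log_ofReal_mul hz hw, add_mul, Complex.exp_add,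
    cpow_def_of_ne_zero hw, Real.sqrt_eq_rpow, ofReal_cpow hz.le, cpow_def_of_ne_zero hzc,
    ofReal_log hz.le]
  push_cast
  rfl

lemma tendsto_jacobiTheta_im_atTop : Tendsto jacobiTheta (comap Complex.im atTop) (nhds 1) := by
  have h1 : Tendsto (fun x : ℝ => Real.exp (-Real.pi * x)) atTop (nhds 0) :=
    Real.tendsto_exp_atBot.comp
      (tendsto_id.const_mul_atTop_of_neg (neg_lt_zero.2 Real.pi_pos))
  have := (isBigO_at_im_infty_jacobiTheta_sub_one.trans_tendsto (h1.comp tendsto_comap)).add_const 1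
  simpa using this

/-- The sign of the quadratic Gauss sum for `p ≡ 1 mod 4`. -/
theorem sum_exp_sq {p : ℕ} [NeZero p] (hp : p % 4 = 1) :
    ∑ r : Fin p, cexp (2 * Real.pi * I * (r : ℕ) ^ 2 / p) = (Real.sqrt p : ℝ) := by
  have hp0 : (0 : ℝ) < p := by exact_mod_cast Nat.pos_of_ne_zero (NeZero.ne p)
  have hpc : (p : ℂ) ≠ 0 := by exact_mod_cast NeZero.ne p
  set F := nhdsWithin (0 : ℝ) (Ioi 0) with hF
  set S := ∑ r : Fin p, cexp (2 * Real.pi * I * (r : ℕ) ^ 2 / p) with hS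
  set τ : ℝ → ℂ := fun z => 2 / p + I * z with hτ
  have him (z : ℝ) : (τ z).im = z := by
    have : (2 / p : ℂ) = ((2 / p : ℝ) : ℂ) := by push_cast; rfl
    simp only [hτ, this]
    simp
  have hτ0 {z : ℝ} (hz : 0 < z) : τ z ≠ 0 := fun h => hz.ne' (by rw [← him z, h, zero_im])
  have hτc : Tendsto τ F (nhds (2 / p)) := by
    have : Continuous τ := by fun_prop
    have h := this.tendsto 0
    simp only [hτ, ofReal_zero, mul_zero, add_zero] at h
    exact h.mono_left nhdsWithin_le_nhds
  have hL1 : Tendsto (fun z : ℝ => (Real.sqrt z : ℂ) * jacobiTheta (τ z)) F (nhds (S * (p : ℂ)⁻¹)) := by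
    have : Tendsto (fun z : ℝ => ∑ r : Fin p, cexp (2 * Real.pi * I * (r : ℕ) ^ 2 / p) *
        ((Real.sqrt z * evenKernel ((((r : ℕ) / p : ℝ)) : UnitAddCircle) (p ^ 2 * z) : ℝ) : ℂ)) F
        (nhds (∑ r : Fin p, cexp (2 * Real.pi * I * (r : ℕ) ^ 2 / p) * (((p : ℝ)⁻¹ : ℝ) : ℂ))) :=
      tendsto_finsetSum _ fun r _ => Tendsto.const_mul _
        ((continuous_ofReal.tendsto _).comp (tendsto_sqrt_mul_evenKernel _ hp0))
    rw [← Finset.sum_mul, ofReal_inv, ofReal_natCast] at this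
    refine this.congr' ?_
    filter_upwards [self_mem_nhdsWithin] with z hz
    rw [jacobiTheta_rational hz, Finset.mul_sum]
    refine Finset.sum_congr rfl fun r _ => ?_
    push_cast
    ring
  have hsp : ((Real.sqrt p : ℝ) : ℂ) ^ 2 = p := by
    rw [← ofReal_pow, Real.sq_sqrt hp0.le, ofReal_natCast]
  have hs0 : ((Real.sqrt p : ℝ) : ℂ) ≠ 0 := ofReal_ne_zero.2 (Real.sqrt_pos.2 hp0).ne'
  have hw : (-I * (2 / p)) ^ (1 / 2 : ℂ) = (1 - I) / (Real.sqrt p : ℝ) := by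
    have e : -I * (2 / p) = ((1 - I) / (Real.sqrt p : ℝ)) ^ 2 := by
      rw [div_pow, hsp]
      field_simp
      linear_combination -I_sq
    rw [e, one_div, sq_cpow_two_inv]
    rw [div_ofReal_re]
    exact div_pos (by simp) (Real.sqrt_pos.2 hp0)
  have hL2 : Tendsto (fun z : ℝ => (-I * τ z) ^ (1 / 2 : ℂ) * ((Real.sqrt z : ℂ) * jacobiTheta (τ z)))
      F (nhds ((1 - I) / (Real.sqrt p : ℝ) * (S * (p : ℂ)⁻¹))) := by
    refine Tendsto.mul ?_ hL1
    rw [← hw]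
    refine (continuousAt_cpow_const ?_).tendsto.comp (hτc.const_mul (-I))
    have e : -I * (2 / p) = ((2 / p : ℝ) : ℂ) * -I := by push_cast; ring
    rw [mem_slitPlane_iff, e]
    right
    rw [im_ofReal_mul]
    simp [hp0.ne']
  have hk (k : ℝ) (hk0 : 0 < k) : Tendsto (fun z : ℝ => (Real.sqrt z : ℂ) *
      jacobiTheta (k ^ 2 * (p * I * z / (2 * τ z)))) F (nhds (2 / (k * p))) := by
    have hkc : (k : ℂ) ≠ 0 := ofReal_ne_zero.2 hk0.ne'
    set w : ℝ → ℂ := fun z => k ^ 2 * p / (2 * τ z) with hwdef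
    have hwt : Tendsto w F (nhds ((((k * p / 2) ^ 2 : ℝ)) : ℂ)) := by
      have := (tendsto_const_nhds (x := (k ^ 2 * p : ℂ))).div (hτc.const_mul 2)
        (mul_ne_zero two_ne_zero (div_ne_zero two_ne_zero hpc))
      convert! this using 2
      push_cast
      field_simp
    have hwh : Tendsto (fun z => (w z) ^ (1 / 2 : ℂ)) F (nhds ((k * p / 2 : ℝ) : ℂ)) := by
      have e : ((k * p / 2 : ℝ) : ℂ) = ((((k * p / 2) ^ 2 : ℝ)) : ℂ) ^ (1 / 2 : ℂ) := by
        rw [one_div, ofReal_pow, sq_cpow_two_inv]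
        rw [ofReal_re]
        positivity
      rw [e]
      refine (continuousAt_cpow_const ?_).tendsto.comp hwt
      rw [ofReal_mem_slitPlane]
      positivity
    have hT : Tendsto (fun z : ℝ => jacobiTheta (-(k ^ 2 * (p * I * z / (2 * τ z)))⁻¹)) F
        (nhds 1) := by
      refine tendsto_jacobiTheta_im_atTop.comp (tendsto_comap_iff.2 ?_)
      have h1 : Tendsto (fun z : ℝ => (4 / (k ^ 2 * p ^ 2)) * z⁻¹) F atTop :=
        (tendsto_inv_nhdsGT_zero (𝕜 := ℝ)).const_mul_atTop (by positivity)
      refine h1.congr' ?_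
      filter_upwards [self_mem_nhdsWithin] with z hz
      have hz : 0 < z := hz
      have hzc : (z : ℂ) ≠ 0 := ofReal_ne_zero.2 hz.ne'
      have hT0 := hτ0 hz
      have e : -(k ^ 2 * (p * I * z / (2 * τ z)))⁻¹ =
          (((4 / (k ^ 2 * p ^ 2)) * z⁻¹ : ℝ) : ℂ) * I - ((2 / (k ^ 2 * p) : ℝ) : ℂ) := by
        push_cast
        field_simp
        simp only [hτ]
        field_simp
        linear_combination (-4 : ℂ) * I_sq
      simp only [Function.comp, e]
      rw [sub_im, im_ofReal_mul, ofReal_im, I_im, mul_one, sub_zero]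
    have hq := hT.div hwh (ofReal_ne_zero.2 (by positivity))
    have e2 : (1 : ℂ) / ((k * p / 2 : ℝ) : ℂ) = 2 / (k * p) := by push_cast; field_simp
    rw [e2] at hq
    refine hq.congr' ?_
    filter_upwards [self_mem_nhdsWithin] with z hz
    have hz : 0 < z := hz
    have hzc : (z : ℂ) ≠ 0 := ofReal_ne_zero.2 hz.ne'
    have hT0 := hτ0 hz
    have hw0 : w z ≠ 0 := div_ne_zero (mul_ne_zero (pow_ne_zero 2 hkc) hpc)
      (mul_ne_zero two_ne_zero hT0)
    have hwh0 : (w z) ^ (1 / 2 : ℂ) ≠ 0 := by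
      rw [Ne, cpow_eq_zero_iff, not_and_or]
      exact Or.inl hw0
    have hv : 0 < (k ^ 2 * (p * I * z / (2 * τ z))).im := by
      have e : k ^ 2 * (p * I * z / (2 * τ z)) =
          ((k ^ 2 * p * z / 2 / normSq (τ z) : ℝ) : ℂ) * (I * (starRingEnd ℂ) (τ z)) := by
        have hn : (normSq (τ z) : ℂ) ≠ 0 := ofReal_ne_zero.2 (normSq_pos.2 hT0).ne'
        push_cast
        field_simp
        rw [← mul_conj]
      have hre : (τ z).re = 2 / p := by
        have : (2 / p : ℂ) = ((2 / p : ℝ) : ℂ) := by push_cast; rfl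
        simp only [hτ, this]
        simp
      rw [e, im_ofReal_mul]
      have := normSq_pos.2 hT0
      simp only [I_mul_im, conj_re, hre]
      positivity
    have e3 : -I * (k ^ 2 * (p * I * z / (2 * τ z))) = z * w z := by
      simp only [hwdef]
      field_simp
      linear_combination -I_sq
    rw [Pi.div_apply, jacobiTheta_neg_inv hv, e3, ofReal_mul_cpow_half hz hw0]
    field_simp
  have hR := ((hk 2 two_pos).const_mul (1 + I)).sub ((hk 1 one_pos).const_mul I)
  have heq := tendsto_nhds_unique hL2 (hR.congr' ?_)
  · have h1I : (1 - I : ℂ) ≠ 0 := by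
      intro h
      have := congrArg re h
      simp at this
    push_cast at heq
    have : (1 - I) * (S - (Real.sqrt p : ℝ)) = 0 := by
      field_simp at heq
      linear_combination heq
    exact sub_eq_zero.1 ((mul_eq_zero.1 this).resolve_left h1I)
  · filter_upwards [self_mem_nhdsWithin] with z hz
    have hz : 0 < z := hz
    have hT0 := hτ0 hz
    have hzc : (z : ℂ) ≠ 0 := ofReal_ne_zero.2 hz.ne'
    have hti : 0 < (τ z).im := by rw [him]; exact hz
    set v := p * I * z / (2 * τ z) with hvdef
    have e : -(τ z)⁻¹ = -(p / 2) + v := by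
      rw [hvdef]
      field_simp
      simp only [hτ]
      field_simp
      ring
    have hv : 0 < v.im := by
      have : v = -(τ z)⁻¹ + ((p / 2 : ℝ) : ℂ) := by rw [e]; push_cast; ring
      rw [this, add_im, ofReal_im, add_zero, neg_im, inv_im]
      have := normSq_pos.2 hT0
      rw [neg_div, neg_neg]
      positivity
    have := jacobiTheta_neg_inv hti
    rw [e, jacobiTheta_neg_half_add hp hv] at this
    have e4 : ((2 : ℝ) : ℂ) ^ 2 * v = 4 * v := by push_cast; norm_num
    have e5 : ((1 : ℝ) : ℂ) ^ 2 * v = v := by push_cast; ring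
    rw [e4, e5]
    linear_combination (Real.sqrt z : ℂ) * this

end quadratic

lemma GCong.sum {ι : Type*} {s : Finset ι} {f g : ι → ℂ} {c : ℂ}
    (h : ∀ i ∈ s, GCong (f i) (g i) c) : GCong (∑ i ∈ s, f i) (∑ i ∈ s, g i) c := by
  choose! d hd he using h
  refine ⟨∑ i ∈ s, d i, O4.sum_mem fun i hi => hd i hi, ?_⟩
  rw [← Finset.sum_sub_distrib, Finset.mul_sum]
  exact Finset.sum_congr rfl he

lemma GCong.mul {a a' b b' c : ℂ} (h : GCong a a' c) (h' : GCong b b' c) (hb : b ∈ O4)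
    (ha' : a' ∈ O4) : GCong (a * b) (a' * b') c := by
  obtain ⟨d, hd, e⟩ := h
  obtain ⟨d', hd', e'⟩ := h'
  exact ⟨d * b + a' * d', O4.add_mem (O4.mul_mem hd hb) (O4.mul_mem ha' hd'), by
    linear_combination b * e + a' * e'⟩

lemma sum_zmod_eq_sum_fin {p : ℕ} [NeZero p] (f : ℕ → ℂ) :
    ∑ r : ZMod p, f r.val = ∑ r : Fin p, f r := by
  obtain ⟨n, rfl⟩ := Nat.exists_eq_succ_of_ne_zero (NeZero.ne p)
  rfl

namespace QDatum

variable {p : ℕ} {π : ℂ} {χ : ℂ → ℂ}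

lemma cchar_zero (h : QDatum p π χ) [Fact p.Prime] : h.cchar 0 = 0 := MulChar.map_zero _

lemma cchar_sq (h : QDatum p π χ) [Fact p.Prime] (r : ZMod p) :
    h.cchar r ^ 2 = ((quadraticChar (ZMod p) r : ℤ) : ℂ) := by
  by_cases hr : r = 0
  · subst hr
    simp [h.cchar_zero]
  · rw [h.cchar_apply]
    have h4 := h.chi_pow_four (natCast_mem O4 _) (h.val_ne_zero hr)
    have hd : ¬ (p : ℤ) ∣ (r.val : ℤ) := by
      rw [← ZMod.intCast_zmod_eq_zero_iff_dvd]
      simpa using hr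
    have hq := quadraticChar_dichotomy hr
    refine h.eq_of_gcong (by rw [← pow_mul, mul_comm, pow_mul, h4, one_pow]) ?_ ?_
    · rcases hq with hq | hq <;> rw [hq] <;> norm_num
    · have he := h.euler_int hd
      push_cast at he
      have h1 : GCong (χ ((r.val : ℕ) : ℂ) ^ 2) (((r.val : ℕ) : ℂ) ^ ((p - 1) / 4) * ((r.val : ℕ) : ℂ) ^ ((p - 1) / 4)) π := by
        rw [sq]
        exact he.mul he (mem_O4_of_pow_four h4) (O4.pow_mem (natCast_mem O4 _) _)
      refine h1.trans ?_
      have h2 : GCong (((r.val : ℤ) ^ ((p - 1) / 4) * (r.val : ℤ) ^ ((p - 1) / 4) : ℤ) : ℂ)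
          ((quadraticChar (ZMod p) r : ℤ) : ℂ) π := by
        rw [h.gcong_int, ← ZMod.intCast_zmod_eq_zero_iff_dvd]
        have h2p : ringChar (ZMod p) ≠ 2 := by
          rw [ZMod.ringChar_zmod_n]
          have := h.five_le
          omega
        push_cast [ZMod.natCast_zmod_val]
        rw [quadraticChar_eq_pow_of_char_ne_two' h2p, ZMod.card, ← pow_add, sub_eq_zero]
        congr 1
        have := h.mod4
        omega
      push_cast at h2
      exact h2

lemma gaussSum_sq (h : QDatum p π χ) [Fact p.Prime] :
    gaussSum (h.cchar ^ 2) ZMod.stdAddChar = (Real.sqrt p : ℝ) := by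
  have h2p : ringChar (ZMod p) ≠ 2 := by
    rw [ZMod.ringChar_zmod_n]
    have := h.five_le
    omega
  have hsum : ∑ r : ZMod p, (ZMod.stdAddChar r : ℂ) = 0 :=
    AddChar.sum_eq_zero_of_ne_one fun h1 => by
      have := ZMod.isPrimitive_stdAddChar p (one_ne_zero)
      rw [AddChar.mulShift_one] at this
      exact this h1
  rw [← sum_exp_sq h.mod4, gaussSum]
  calc ∑ r : ZMod p, (h.cchar ^ 2) r * ZMod.stdAddChar r
      = ∑ r : ZMod p, (((quadraticChar (ZMod p) r : ℤ) : ℂ) + 1) * ZMod.stdAddChar r := by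
        simp only [add_mul, Finset.sum_add_distrib, one_mul, hsum, add_zero]
        refine Finset.sum_congr rfl fun r _ => ?_
        rw [MulChar.pow_apply' _ two_ne_zero, h.cchar_sq]
    _ = ∑ r : ZMod p, ∑ x : ZMod p with x ^ 2 = r, ZMod.stdAddChar (x ^ 2) := by
        refine Finset.sum_congr rfl fun r _ => ?_
        have h1 := quadraticChar_card_sqrts h2p r
        have h2 : ((quadraticChar (ZMod p) r : ℤ) : ℂ) + 1 =
            ((Finset.univ.filter fun x : ZMod p => x ^ 2 = r).card : ℂ) := by
          have h3 : (Finset.univ.filter fun x : ZMod p => x ^ 2 = r) =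
              {x : ZMod p | x ^ 2 = r}.toFinset := by ext; simp
          rw [h3]
          have : ((({x : ZMod p | x ^ 2 = r}.toFinset).card : ℤ) : ℂ) = ((quadraticChar (ZMod p) r + 1 : ℤ) : ℂ) := by
            rw [h1]
          push_cast at this
          exact this.symm
        rw [h2, Finset.sum_congr rfl (g := fun _ => ZMod.stdAddChar r), Finset.sum_const, nsmul_eq_mul]
        intro x hx
        rw [(Finset.mem_filter.1 hx).2]
    _ = ∑ x : ZMod p, ZMod.stdAddChar (x ^ 2) := Finset.sum_fiberwise _ _ _
    _ = _ := by
        rw [← sum_zmod_eq_sum_fin (fun r : ℕ => cexp (2 * Real.pi * I * (r : ℂ) ^ 2 / p))]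
        refine Finset.sum_congr rfl fun x _ => ?_
        have := ZMod.stdAddChar_coe (N := p) ((x.val : ℤ) ^ 2)
        push_cast [ZMod.natCast_zmod_val] at this
        rw [this]

lemma conj_cchar (h : QDatum p π χ) [Fact p.Prime] (r : ZMod p) :
    (starRingEnd ℂ) (h.cchar r) = h.cchar⁻¹ r := by
  by_cases hr : r = 0
  · subst hr
    rw [h.cchar_zero, MulChar.map_zero, map_zero]
  · have h1 := h.conj_chi_mul (natCast_mem O4 _) (h.val_ne_zero hr)
    rw [MulChar.inv_apply_eq_inv', h.cchar_apply]
    exact eq_inv_of_mul_eq_one_left h1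

lemma gcong_cchar (h : QDatum p π χ) [Fact p.Prime] (r : ZMod p) :
    GCong (h.cchar r) (((r.val ^ ((p - 1) / 4) : ℕ) : ℤ) : ℂ) π := by
  by_cases hr : r = 0
  · subst hr
    have : (p - 1) / 4 ≠ 0 := by
      have := h.five_le
      omega
    simpa [this, h.cchar_zero] using GCong.refl 0 π
  · rw [h.cchar_apply]
    have hd : ¬ (p : ℤ) ∣ (r.val : ℤ) := by
      rw [← ZMod.intCast_zmod_eq_zero_iff_dvd]
      simpa using hr
    have he := h.euler_int hd
    push_cast at he ⊢
    exact he

lemma cchar_mem (h : QDatum p π χ) [Fact p.Prime] (r : ZMod p) : h.cchar r ∈ O4 := by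
  by_cases hr : r = 0
  · subst hr
    simp [h.cchar_zero]
  · rw [h.cchar_apply]
    exact mem_O4_of_pow_four (h.chi_pow_four (natCast_mem O4 _) (h.val_ne_zero hr))

lemma sum_pow_mul_pow [Fact p.Prime] {k n : ℕ} (hk : k + n < p - 1) :
    ∑ x : ZMod p, x ^ k * (1 - x) ^ n = 0 := by
  have e (x : ZMod p) : x ^ k * (1 - x) ^ n =
      ∑ m ∈ Finset.range (n + 1), (-1) ^ m * (n.choose m : ZMod p) * x ^ (k + m) := by
    rw [sub_eq_neg_add, add_pow, Finset.mul_sum]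
    refine Finset.sum_congr rfl fun m _ => ?_
    rw [neg_pow, one_pow, pow_add]
    ring
  simp only [e]
  rw [Finset.sum_comm]
  refine Finset.sum_eq_zero fun m hm => ?_
  rw [← Finset.mul_sum, FiniteField.sum_pow_lt_card_sub_one, mul_zero]
  rw [ZMod.card]
  have := Finset.mem_range.1 hm
  omega

lemma jacobiSum_gcong_zero (h : QDatum p π χ) [Fact p.Prime] :
    GCong (jacobiSum h.cchar (h.cchar ^ 2)) 0 π := by
  set k := (p - 1) / 4 with hk
  have h1 : GCong (jacobiSum h.cchar (h.cchar ^ 2))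
      (∑ x : ZMod p, (((x.val ^ k : ℕ) : ℤ) : ℂ) *
        ((((1 - x).val ^ k : ℕ) : ℤ) * (((1 - x).val ^ k : ℕ) : ℤ) : ℂ)) π := by
    refine GCong.sum fun x _ => ?_
    rw [MulChar.pow_apply' _ two_ne_zero, sq]
    exact (h.gcong_cchar x).mul ((h.gcong_cchar _).mul (h.gcong_cchar _) (h.cchar_mem _)
      (intCast_mem O4 _)) (O4.mul_mem (h.cchar_mem _) (h.cchar_mem _)) (intCast_mem O4 _)
  refine h1.trans ?_
  have h2 : GCong ((∑ x : ZMod p, ((x.val ^ k : ℕ) : ℤ) *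
        ((((1 - x).val ^ k : ℕ) : ℤ) * (((1 - x).val ^ k : ℕ) : ℤ)) : ℤ) : ℂ) ((0 : ℤ) : ℂ) π := by
    rw [h.gcong_int, ← ZMod.intCast_zmod_eq_zero_iff_dvd]
    push_cast [ZMod.natCast_zmod_val]
    rw [sub_zero, ← sum_pow_mul_pow (p := p) (k := k) (n := k + k)]
    · simp only [pow_add]
    · have := h.five_le
      omega
  push_cast at h2 ⊢
  exact h2

lemma jacobiSum_gcong_neg_one (h : QDatum p π χ) [Fact p.Prime] :
    GCong (jacobiSum h.cchar (h.cchar ^ 2)) (-1) ((1 + I) ^ 3) := by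
  have h2 : h.cchar ^ 2 ≠ 1 := by
    intro h1
    apply h.char_sq_ne_one
    refine MulChar.ext fun r => GaussianInt.toComplex_injective ?_
    have := congrArg (fun f : MulChar (ZMod p) ℂ => f r) h1
    simp only [MulChar.pow_apply' _ two_ne_zero] at this ⊢
    rw [map_pow]
    rw [MulChar.one_apply_coe] at this ⊢
    rw [map_one]
    exact this
  have e : jacobiSum h.cchar (h.cchar ^ 2) = -p +
      ∑ x ∈ (Finset.univ \ {0, 1} : Finset (ZMod p)), (h.cchar x - 1) * ((h.cchar ^ 2) (1 - x) - 1) := by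
    have hs : ∑ x ∈ (Finset.univ \ {0, 1} : Finset (ZMod p)), (h.cchar x - 1) * ((h.cchar ^ 2) (1 - x) - 1) =
        ∑ x ∈ (Finset.univ \ {0, 1} : Finset (ZMod p)), h.cchar x * (h.cchar ^ 2) (1 - x) -
        ∑ x ∈ (Finset.univ \ {0, 1} : Finset (ZMod p)), h.cchar x - ∑ x ∈ (Finset.univ \ {0, 1} : Finset (ZMod p)), (h.cchar ^ 2) (1 - x) +
          ∑ x ∈ (Finset.univ \ {0, 1} : Finset (ZMod p)), 1 := by
      rw [← Finset.sum_sub_distrib, ← Finset.sum_sub_distrib, ← Finset.sum_add_distrib]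
      exact Finset.sum_congr rfl fun x _ => by ring
    rw [hs, ← jacobiSum_eq_sum_sdiff]
    have n01 : (0 : ZMod p) ≠ 1 := zero_ne_one
    have a1 : ∑ x ∈ (Finset.univ \ {0, 1} : Finset (ZMod p)), h.cchar x = -1 := by
      have := Finset.sum_sdiff (f := h.cchar) (Finset.subset_univ ({0, 1} : Finset (ZMod p)))
      rw [MulChar.sum_eq_zero_of_ne_one h.cchar_ne_one, Finset.sum_pair n01] at this
      simp only [map_one, MulChar.map_zero, zero_add] at this
      linear_combination this
    have a2 : ∑ x ∈ (Finset.univ \ {0, 1} : Finset (ZMod p)), (h.cchar ^ 2) (1 - x) = -1 := by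
      have := Finset.sum_sdiff (f := fun x => (h.cchar ^ 2) (Equiv.subLeft (1 : ZMod p) x))
        (Finset.subset_univ ({0, 1} : Finset (ZMod p)))
      rw [(Equiv.subLeft (1 : ZMod p)).sum_comp (fun x => (h.cchar ^ 2) x),
        MulChar.sum_eq_zero_of_ne_one h2, Finset.sum_pair n01] at this
      simp only [Equiv.subLeft_apply, sub_zero, sub_self, map_one, MulChar.map_zero, add_zero] at this
      linear_combination this
    have a3 : ∑ x ∈ (Finset.univ \ {0, 1} : Finset (ZMod p)), (1 : ℂ) = p - 2 := by
      have := Finset.sum_sdiff (f := fun _ => (1 : ℂ))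
        (Finset.subset_univ ({0, 1} : Finset (ZMod p)))
      rw [Finset.sum_pair n01] at this
      simp only [Finset.sum_const, Finset.card_univ, ZMod.card, nsmul_eq_mul, mul_one] at this ⊢
      linear_combination this
    rw [a1, a2, a3]
    ring
  rw [e]
  have hs : GCong (∑ x ∈ (Finset.univ \ {0, 1} : Finset (ZMod p)), (h.cchar x - 1) * ((h.cchar ^ 2) (1 - x) - 1))
      (∑ x ∈ (Finset.univ \ {0, 1} : Finset (ZMod p)), 0) ((1 + I) ^ 3) := by
    refine GCong.sum fun x hx => ?_
    simp only [Finset.mem_sdiff, Finset.mem_univ, Finset.mem_insert, Finset.mem_singleton,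
      true_and, not_or] at hx
    have hx1 : 1 - x ≠ 0 := sub_ne_zero.2 (Ne.symm hx.2)
    have h4 := h.chi_pow_four (natCast_mem O4 _) (h.val_ne_zero hx.1)
    rw [← h.cchar_apply] at h4
    rw [MulChar.pow_apply' _ two_ne_zero, h.cchar_sq, lam_eq]
    have m1 := O4.one_mem
    have mI := I_mem_O4
    have key : ∃ d ∈ O4, h.cchar x - 1 = (1 - I) * d := by
      rcases eq_of_pow_four h4 with h1 | h1 | h1 | h1 <;> rw [h1]
      · exact ⟨0, O4.zero_mem, by ring⟩
      · exact ⟨-(1 + I), O4.neg_mem (O4.add_mem m1 mI), by linear_combination -I_sq⟩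
      · exact ⟨-1, O4.neg_mem m1, by ring⟩
      · exact ⟨-I, O4.neg_mem mI, by linear_combination -I_sq⟩
    obtain ⟨d, hd, hde⟩ := key
    rcases quadraticChar_dichotomy hx1 with hq | hq <;> rw [hq, hde]
    · exact ⟨0, O4.zero_mem, by push_cast; ring⟩
    · exact ⟨d, hd, by push_cast; ring⟩
  simp only [Finset.sum_const_zero] at hs
  have hp1 : GCong (-(p : ℂ)) (-1) ((1 + I) ^ 3) := by
    obtain ⟨j, hj⟩ : ∃ j : ℕ, p = 4 * j + 1 := ⟨p / 4, by have := h.mod4; omega⟩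
    refine ⟨j * (1 + I), O4.mul_mem (natCast_mem O4 _) (O4.add_mem O4.one_mem I_mem_O4), ?_⟩
    rw [lam_eq, hj]
    push_cast
    linear_combination (-2 * (j : ℂ)) * I_sq
  simpa using hp1.add hs

end QDatum

namespace QDatum

variable {p : ℕ} {π : ℂ} {χ : ℂ → ℂ}

lemma cchar_pow_three (h : QDatum p π χ) [Fact p.Prime] : h.cchar * h.cchar ^ 2 = h.cchar⁻¹ := by
  refine eq_inv_of_mul_eq_one_left (MulChar.ext fun r => ?_)
  have h4 := h.chi_pow_four (natCast_mem O4 _) (h.val_ne_zero r.ne_zero)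
  rw [← h.cchar_apply] at h4
  simp only [MulChar.mul_apply, MulChar.pow_apply' _ two_ne_zero, MulChar.one_apply_coe]
  linear_combination h4

lemma cchar_sq_ne_one (h : QDatum p π χ) [Fact p.Prime] : h.cchar ^ 2 ≠ 1 := by
  intro h1
  apply h.char_sq_ne_one
  refine MulChar.ext fun r => GaussianInt.toComplex_injective ?_
  have := congrArg (fun f : MulChar (ZMod p) ℂ => f r) h1
  simp only [MulChar.pow_apply' _ two_ne_zero] at this ⊢
  rw [map_pow]
  rw [MulChar.one_apply_coe] at this ⊢
  rw [map_one]
  exact this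

lemma jacobiSum_eq (h : QDatum p π χ) [Fact p.Prime] :
    jacobiSum h.cchar (h.cchar ^ 2) = -π := by
  set J := jacobiSum h.cchar (h.cchar ^ 2) with hJ
  obtain ⟨d, hd, hJd⟩ := h.jacobiSum_gcong_zero
  rw [← hJ, sub_zero] at hJd
  have hconj : (starRingEnd ℂ) J = jacobiSum h.cchar⁻¹ (h.cchar ^ 2)⁻¹ := by
    simp only [hJ, jacobiSum, map_sum, map_mul, h.conj_cchar]
    refine Finset.sum_congr rfl fun x _ => ?_
    rw [MulChar.pow_apply' _ two_ne_zero, map_pow, h.conj_cchar, ← inv_pow,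
      MulChar.pow_apply' _ two_ne_zero]
  have hn : J * (starRingEnd ℂ) J = p := by
    have hch : h.cchar * h.cchar ^ 2 ≠ 1 := by
      rw [h.cchar_pow_three]
      exact fun h1 => h.cchar_ne_one (inv_eq_one.1 h1)
    rw [hconj, hJ, jacobiSum_mul_jacobiSum_inv ?_ h.cchar_ne_one h.cchar_sq_ne_one hch, ZMod.card]
    rw [ZMod.ringChar_zmod_n, ringChar.eq_zero]
    exact h.prime.ne_zero.symm
  have hdn : normSq d = 1 := by
    rw [mul_conj, hJd, map_mul, h.normSq_eq] at hn
    have hp : (p : ℝ) ≠ 0 := Nat.cast_ne_zero.2 h.prime.ne_zero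
    have : (p : ℝ) * normSq d = p := by exact_mod_cast hn
    exact mul_left_cancel₀ hp (by rw [this, mul_one])
  have hc : GCong d (-1) ((1 + I) ^ 3) := by
    have h1 : GCong (d * π) (d * 1) ((1 + I) ^ 3) := by
      obtain ⟨x, hx, hx'⟩ := h.primary
      exact ⟨d * x, O4.mul_mem hd hx, by linear_combination d * hx'⟩
    have h2 := h.jacobiSum_gcong_neg_one
    rw [← hJ, hJd, mul_comm] at h2
    rw [mul_one] at h1
    exact h1.symm.trans h2
  obtain ⟨m, rfl⟩ := exists_gi hd
  have e1 : (-1 : ℂ) = gi (-1, 0) := by simp [gi]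
  rw [e1, gcong_lam] at hc
  simp only [normSq_apply, gi_re, gi_im] at hdn
  have hdn' : m.1 * m.1 + m.2 * m.2 = 1 := by exact_mod_cast hdn
  obtain ⟨m1, m2⟩ := m
  simp only at hc hdn'
  have b1 : -1 ≤ m1 := by nlinarith [mul_self_nonneg m2]
  have b2 : m1 ≤ 1 := by nlinarith [mul_self_nonneg m2]
  have b3 : m2 ^ 2 = 1 - m1 ^ 2 := by linarith
  have : m1 = -1 ∧ m2 = 0 := by
    interval_cases m1
    · simpa using b3
    · omega
    · have : m2 = 0 := by simpa using b3
      omega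
  rw [hJd, this.1, this.2]
  simp [gi]

lemma chi_neg_one (h : QDatum p π χ) : χ (-1) = (-1) ^ ((p - 1) / 4) := by
  have hd : ¬ (p : ℤ) ∣ -1 := by
    rw [dvd_neg]
    exact (Nat.prime_iff_prime_int.1 h.prime).not_dvd_one
  have h1 := h.euler_int hd
  push_cast at h1
  have h0 : ¬ GCong (-1) 0 π := by
    intro h0
    have : GCong ((-1 : ℤ) : ℂ) ((0 : ℤ) : ℂ) π := by simpa using h0
    rw [h.gcong_int, sub_zero] at this
    exact hd this
  refine h.eq_of_gcong (h.chi_pow_four (O4.neg_mem O4.one_mem) h0) ?_ h1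
  rw [← pow_mul, mul_comm, pow_mul]
  norm_num

lemma G4sum_mul_conj (h : QDatum p π χ) [Fact p.Prime] :
    G4sum p χ * gaussSum h.cchar⁻¹ ZMod.stdAddChar = χ (-1) * p := by
  have h1 := gaussSum_mul_gaussSum_eq_card h.cchar_ne_one (ZMod.isPrimitive_stdAddChar p)
  have h2 := mul_gaussSum_inv_eq_gaussSum h.cchar⁻¹ (ZMod.stdAddChar (N := p))
  have h3 : (h.cchar⁻¹) (-1) = χ (-1) := by
    rw [MulChar.inv_apply', inv_neg_one]
    simpa using h.cchar_intCast (-1)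
  rw [h3] at h2
  rw [h.G4sum_eq, ← h2]
  rw [ZMod.card] at h1
  linear_combination χ (-1) * h1

/-- The square of the quartic Gauss sum. -/
lemma G4sum_sq (h : QDatum p π χ) [Fact p.Prime] :
    G4sum p χ ^ 2 = -(χ (-1) * π * (Real.sqrt p : ℝ)) := by
  have hch : h.cchar * h.cchar ^ 2 ≠ 1 := by
    rw [h.cchar_pow_three]
    exact fun h1 => h.cchar_ne_one (inv_eq_one.1 h1)
  have h1 := jacobiSum_mul_nontrivial hch (ZMod.stdAddChar (N := p))
  rw [h.jacobiSum_eq, h.cchar_pow_three, h.gaussSum_sq, ← h.G4sum_eq] at h1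
  have h2 := h.G4sum_mul_conj
  have hp : (0 : ℝ) < p := Nat.cast_pos.2 h.prime.pos
  have hs : ((Real.sqrt p : ℝ) : ℂ) ^ 2 = p := by
    rw [← ofReal_pow, Real.sq_sqrt hp.le, ofReal_natCast]
  have hs0 : ((Real.sqrt p : ℝ) : ℂ) ≠ 0 := ofReal_ne_zero.2 (Real.sqrt_pos.2 hp).ne'
  refine mul_right_cancel₀ hs0 ?_
  linear_combination (-G4sum p χ) * h1 - π * h2 + π * χ (-1) * hs

lemma G4sum_ne_zero (h : QDatum p π χ) [Fact p.Prime] : G4sum p χ ≠ 0 := by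
  intro h0
  have h1 := h.G4sum_mul_conj
  rw [h0, zero_mul, h.chi_neg_one] at h1
  exact mul_ne_zero (pow_ne_zero _ (by norm_num)) (Nat.cast_ne_zero.2 h.prime.ne_zero) h1.symm

end QDatum

/-- Congruence modulo `q` in the ring of algebraic integers. -/
def ICong (q : ℕ) (x y : ℂ) : Prop := ∃ r : ℂ, IsIntegral ℤ r ∧ x = y + q * r

lemma ICong.mul {q : ℕ} {x y x' y' : ℂ} (h : ICong q x y) (h' : ICong q x' y')
    (hx' : IsIntegral ℤ x') (hy : IsIntegral ℤ y) : ICong q (x * x') (y * y') := by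
  obtain ⟨r, hr, e⟩ := h
  obtain ⟨r', hr', e'⟩ := h'
  exact ⟨r * x' + y * r', (hr.mul hx').add (hy.mul hr'), by linear_combination x' * e + y * e'⟩

lemma ICong.refl (q : ℕ) (x : ℂ) : ICong q x x := ⟨0, isIntegral_zero, by simp⟩

lemma ICong.symm {q : ℕ} {x y : ℂ} (h : ICong q x y) : ICong q y x := by
  obtain ⟨r, hr, e⟩ := h
  exact ⟨-r, hr.neg, by linear_combination -e⟩

lemma ICong.trans {q : ℕ} {x y z : ℂ} (h : ICong q x y) (h' : ICong q y z) : ICong q x z := by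
  obtain ⟨r, hr, e⟩ := h
  obtain ⟨r', hr', e'⟩ := h'
  exact ⟨r + r', hr.add hr', by linear_combination e + e'⟩

lemma ICong.pow {q : ℕ} {x y : ℂ} (h : ICong q x y) (hx : IsIntegral ℤ x) (hy : IsIntegral ℤ y)
    (n : ℕ) : ICong q (x ^ n) (y ^ n) := by
  induction n with
  | zero => simpa using ICong.refl q 1
  | succ n ih => simpa only [pow_succ] using ih.mul h hx (hy.pow n)

lemma isIntegral_int (n : ℤ) : IsIntegral ℤ (n : ℂ) := by
  simpa using isIntegral_algebraMap (R := ℤ) (A := ℂ) (x := n)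

lemma isIntegral_nat (n : ℕ) : IsIntegral ℤ (n : ℂ) := by
  simpa using isIntegral_int n

lemma ICong.of_int {q : ℕ} {m n : ℤ} (h : m ≡ n [ZMOD q]) : ICong q m n := by
  obtain ⟨k, hk⟩ := h.symm.dvd
  refine ⟨k, isIntegral_int k, ?_⟩
  have : m = n + q * k := by linarith
  exact_mod_cast this

lemma ICong.sum_pow {q : ℕ} (hq : q.Prime) {ι : Type*} (s : Finset ι) {f : ι → ℂ}
    (hf : ∀ i, IsIntegral ℤ (f i)) : ICong q ((∑ i ∈ s, f i) ^ q) (∑ i ∈ s, f i ^ q) := by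
  classical
  induction s using Finset.induction_on with
  | empty => simpa [hq.ne_zero] using ICong.refl q 0
  | insert i s hi ih =>
    rw [Finset.sum_insert hi, Finset.sum_insert hi]
    obtain ⟨r, hr, e⟩ := ih
    obtain ⟨t, ht⟩ := exists_add_pow_prime_eq hq (⟨f i, hf i⟩ : integralClosure ℤ ℂ)
      ⟨∑ i ∈ s, f i, IsIntegral.sum _ fun i _ => hf i⟩
    have ht := congrArg (Subtype.val) ht
    push_cast at ht
    refine ⟨r + f i * (∑ i ∈ s, f i) * t, hr.add (((hf i).mul (IsIntegral.sum _ fun i _ => hf i)).mul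
      t.2), ?_⟩
    linear_combination ht + e

lemma dvd_of_isIntegral {q : ℕ} (hq : q ≠ 0) {n : ℤ} (h : IsIntegral ℤ ((n : ℂ) / q)) :
    (q : ℤ) ∣ n := by
  have e : ((n : ℂ) / q) = algebraMap ℚ ℂ (n / q) := by simp
  rw [e, isIntegral_algebraMap_iff (algebraMap ℚ ℂ).injective,
    IsIntegrallyClosed.isIntegral_iff] at h
  obtain ⟨y, hy⟩ := h
  have hq0 : (q : ℚ) ≠ 0 := Nat.cast_ne_zero.2 hq
  rw [eq_div_iff hq0] at hy
  simp only [algebraMap_int_eq, eq_intCast] at hy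
  exact ⟨y, by rw [mul_comm]; exact_mod_cast hy.symm⟩

lemma isIntegral_of_pow_four {c : ℂ} (hc : c ^ 4 = 1) : IsIntegral ℤ c :=
  IsIntegral.of_pow (n := 4) (by norm_num) (by rw [hc]; exact isIntegral_one)

/-- Two units of `ℤ[i]`, one of them rational, which are congruent modulo an odd prime agree. -/
lemma eq_of_icong {q : ℕ} (hq : q.Prime) (hq2 : q ≠ 2) {m : ℤ} (hm : ¬ (q : ℤ) ∣ m) {c c' : ℂ}
    (hc : c ^ 4 = 1) (hc' : c' = 1 ∨ c' = -1) (h : ICong q (m * c) (m * c')) : c = c' := by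
  obtain ⟨r, hr, e⟩ := h
  have hqp : Prime (q : ℤ) := Nat.prime_iff_prime_int.1 hq
  have hq0 : (q : ℂ) ≠ 0 := Nat.cast_ne_zero.2 hq.ne_zero
  have hd2 : ¬ (q : ℤ) ∣ 2 := by
    intro h
    have h : q ∣ 2 := by exact_mod_cast h
    exact hq2 ((Nat.prime_dvd_prime_iff_eq hq Nat.prime_two).1 h)
  have key (d : ℂ) (hd : IsIntegral ℤ d) {N : ℤ} (hN : (c - c') * d = N) (hNd : (N = 2 ∨ N = 4)) :
      c = c' := by
    exfalso
    have h1 : IsIntegral ℤ (((m * N : ℤ) : ℂ) / q) := by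
      have : ((m * N : ℤ) : ℂ) / q = r * d := by
        rw [div_eq_iff hq0]
        push_cast
        rw [← hN]
        linear_combination d * e
      rw [this]
      exact hr.mul hd
    have h2 := (hqp.dvd_mul.1 (dvd_of_isIntegral hq.ne_zero h1)).resolve_left hm
    rcases hNd with rfl | rfl
    · exact hd2 h2
    · exact hd2 ((hqp.dvd_mul.1 (show (q : ℤ) ∣ 2 * 2 from h2)).elim id id)
  have i1 : IsIntegral ℤ (1 : ℂ) := isIntegral_one
  have iI : IsIntegral ℤ I := isIntegral_of_pow_four (by simp)
  rcases eq_of_pow_four hc with h1 | h1 | h1 | h1 <;> rcases hc' with h2 | h2 <;>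
    rw [h1, h2] at key ⊢
  · exact key 1 i1 (N := 2) (by norm_num) (Or.inl rfl)
  · exact key (-1) i1.neg (N := 2) (by norm_num) (Or.inl rfl)
  · exact key (-I - 1) (iI.neg.sub i1) (N := 2) (by push_cast; linear_combination -I_sq) (Or.inl rfl)
  · exact key (-I + 1) (iI.neg.add i1) (N := 2) (by push_cast; linear_combination -I_sq) (Or.inl rfl)
  · exact key (I - 1) (iI.sub i1) (N := 2) (by push_cast; linear_combination -I_sq) (Or.inl rfl)
  · exact key (I + 1) (iI.add i1) (N := 2) (by push_cast; linear_combination -I_sq) (Or.inl rfl)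

namespace QDatum

variable {p : ℕ} {π : ℂ} {χ : ℂ → ℂ}

lemma isIntegral_cchar (h : QDatum p π χ) [Fact p.Prime] (r : ZMod p) :
    IsIntegral ℤ (h.cchar r) := by
  by_cases hr : r = 0
  · rw [hr, h.cchar_zero]
    exact isIntegral_zero
  · rw [h.cchar_apply]
    exact isIntegral_of_pow_four (h.chi_pow_four (natCast_mem O4 _) (h.val_ne_zero hr))

lemma isIntegral_stdAddChar [Fact p.Prime] (r : ZMod p) :
    IsIntegral ℤ (ZMod.stdAddChar r : ℂ) := by
  refine IsIntegral.of_pow (n := p) (Fact.out : p.Prime).pos ?_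
  rw [← AddChar.map_nsmul_eq_pow]
  simpa using isIntegral_one

lemma isIntegral_gaussSum (h : QDatum p π χ) [Fact p.Prime] :
    IsIntegral ℤ (gaussSum h.cchar ZMod.stdAddChar) :=
  IsIntegral.sum _ fun r _ => (h.isIntegral_cchar r).mul (isIntegral_stdAddChar r)

lemma isIntegral_gaussSum_inv (h : QDatum p π χ) [Fact p.Prime] :
    IsIntegral ℤ (gaussSum h.cchar⁻¹ ZMod.stdAddChar) :=
  IsIntegral.sum _ fun r _ => by
    refine IsIntegral.mul ?_ (isIntegral_stdAddChar r)
    rw [MulChar.inv_apply']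
    exact h.isIntegral_cchar _

lemma cchar_pow_four (h : QDatum p π χ) [Fact p.Prime] : h.cchar ^ 4 = 1 := by
  refine MulChar.ext fun r => ?_
  rw [MulChar.pow_apply_coe, h.cchar_apply, MulChar.one_apply_coe]
  exact h.chi_pow_four (natCast_mem O4 _) (h.val_ne_zero r.ne_zero)

lemma gaussSum_frob_cong (h : QDatum p π χ) [Fact p.Prime] {q : ℕ} (hq : q.Prime)
    (hqp : (q : ZMod p) ≠ 0) :
    ICong q ((h.cchar ^ q) q * gaussSum h.cchar ZMod.stdAddChar ^ q)
      (gaussSum (h.cchar ^ q) ZMod.stdAddChar) := by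
  obtain ⟨u, hu⟩ := hqp.isUnit
  have h1 := gaussSum_mulShift (h.cchar ^ q) ZMod.stdAddChar u
  rw [hu] at h1
  rw [← h1]
  have h2 := ICong.sum_pow hq Finset.univ (f := fun r : ZMod p => h.cchar r * ZMod.stdAddChar r)
    fun r => (h.isIntegral_cchar r).mul (isIntegral_stdAddChar r)
  have h3 : ∑ r : ZMod p, (h.cchar r * ZMod.stdAddChar r) ^ q =
      gaussSum (h.cchar ^ q) (ZMod.stdAddChar.mulShift (q : ZMod p)) := by
    refine Finset.sum_congr rfl fun r _ => ?_
    rw [MulChar.pow_apply' _ hq.ne_zero, AddChar.mulShift_spec', mul_pow]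
  rw [h3] at h2
  obtain ⟨t, ht, e⟩ := h2
  refine ⟨(h.cchar ^ q) q * t, IsIntegral.mul ?_ ht, ?_⟩
  · rw [MulChar.pow_apply' _ hq.ne_zero]
    exact (h.isIntegral_cchar _).pow q
  · rw [show gaussSum h.cchar ZMod.stdAddChar ^ q = _ from e]
    ring

lemma G4sum_pow_four (h : QDatum p π χ) [Fact p.Prime] : G4sum p χ ^ 4 = π ^ 2 * p := by
  have hp : (0 : ℝ) < p := Nat.cast_pos.2 h.prime.pos
  have hs : ((Real.sqrt p : ℝ) : ℂ) ^ 2 = p := by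
    rw [← ofReal_pow, Real.sq_sqrt hp.le, ofReal_natCast]
  have h1 := h.G4sum_sq
  have h2 : χ (-1) ^ 2 = 1 := by
    rw [h.chi_neg_one, ← pow_mul, mul_comm, pow_mul]
    norm_num
  rw [show G4sum p χ ^ 4 = (G4sum p χ ^ 2) ^ 2 by ring, h1]
  linear_combination (π ^ 2 * (Real.sqrt p : ℝ) ^ 2) * h2 + π ^ 2 * hs

/-- The value of the quartic character at a rational prime dividing the real part of `π`. -/
lemma chi_prime (h : QDatum p π χ) [Fact p.Prime] {a b : ℤ} (hab : π = a + b * I)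
    (hn : a ^ 2 + b ^ 2 = p) (hao : 2 ∣ a - 1) {q : ℕ} (hq : q.Prime) (hqa : (q : ℤ) ∣ a) :
    χ q * χ (ZMod.χ₄ q : ℤ) = (ZMod.χ₈ q : ℤ) := by
  have hpp : Prime (p : ℤ) := Nat.prime_iff_prime_int.1 h.prime
  have hqq : Prime (q : ℤ) := Nat.prime_iff_prime_int.1 hq
  have hq2 : q ≠ 2 := by
    rintro rfl
    push_cast at hqa
    omega
  have hqb : ¬ (q : ℤ) ∣ b := by
    intro hb
    have h1 : (q : ℤ) ^ 2 ∣ p := by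
      rw [← hn]
      exact dvd_add (pow_dvd_pow_of_dvd hqa 2) (pow_dvd_pow_of_dvd hb 2)
    have h1 : q ^ 2 ∣ p := by exact_mod_cast h1
    rcases (Nat.dvd_prime h.prime).1 h1 with h2 | h2
    · exact hq.one_lt.ne' (by simpa using h2)
    · have := h.prime
      rw [← h2] at this
      exact Nat.Prime.not_prime_pow le_rfl this
  have hqp : ¬ (q : ℤ) ∣ p := by
    intro h1
    have : (q : ℤ) ∣ b ^ 2 := by
      rw [show b ^ 2 = p - a * a by linarith]
      exact dvd_sub h1 (hqa.mul_right a)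
    exact hqb (hqq.dvd_of_dvd_pow this)
  have hqz : (q : ZMod p) ≠ 0 := by
    intro h0
    rw [ZMod.natCast_eq_zero_iff] at h0
    rcases (Nat.dvd_prime hq).1 h0 with h2 | h2
    · exact h.prime.one_lt.ne' h2
    · exact hqp (by rw [h2])
  obtain ⟨a', ha'⟩ := hqa
  have iI : IsIntegral ℤ I := isIntegral_of_pow_four (by simp)
  have hpc : (p : ℂ) = a ^ 2 + b ^ 2 := by exact_mod_cast hn.symm
  have hac : (a : ℂ) = q * a' := by exact_mod_cast ha'
  have hG4 : ICong q (G4sum p χ ^ 4) ((-b ^ 4 : ℤ) : ℂ) := by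
    refine ⟨a' * (a ^ 3 + 2 * b * I * p), (isIntegral_int _).mul (((isIntegral_int _).pow 3).add
      ((((isIntegral_int 2).mul (isIntegral_int b)).mul iI).mul (isIntegral_nat p))), ?_⟩
    rw [h.G4sum_pow_four, hab]
    push_cast
    rw [← mul_assoc, ← hac, hpc]
    linear_combination (b : ℂ) ^ 2 * (a ^ 2 + b ^ 2) * I_sq
  have hGi : IsIntegral ℤ (G4sum p χ) := by
    rw [h.G4sum_eq]
    exact h.isIntegral_gaussSum
  have hGk (k : ℕ) : ICong q (G4sum p χ ^ (4 * k)) (((-1) ^ k * (b ^ (4 * k)) : ℤ) : ℂ) := by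
    have := hG4.pow (hGi.pow 4) (isIntegral_int _) k
    rw [pow_mul, pow_mul, ← mul_pow, neg_one_mul]
    push_cast at this ⊢
    exact this
  have hferm : b ^ (q - 1) ≡ 1 [ZMOD q] := by
    refine Int.ModEq.pow_card_sub_one_eq_one hq ?_
    exact (isCoprime_comm.1 ((Prime.coprime_iff_not_dvd hqq).2 hqb))
  have hfrob := h.gaussSum_frob_cong hq hqz
  have hcq : h.cchar (q : ZMod p) = χ q := by simpa using h.cchar_intCast q
  have hcq4 : χ q ^ 4 = 1 := by
    have := congrArg (fun f : MulChar (ZMod p) ℂ => f q) h.cchar_pow_four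
    simp only [MulChar.pow_apply' _ four_ne_zero, hcq] at this
    rw [this, MulChar.one_apply hqz.isUnit]
  have hGG := h.G4sum_mul_conj
  have hχ1 : χ (-1) ^ 2 = 1 := by
    rw [h.chi_neg_one, ← pow_mul, mul_comm, pow_mul]
    norm_num
  have hχ1' : χ (-1) = 1 ∨ χ (-1) = -1 := by
    rcases mul_eq_zero.1 (show (χ (-1) - 1) * (χ (-1) + 1) = 0 by linear_combination hχ1) with hx | hx
    · exact Or.inl (sub_eq_zero.1 hx)
    · exact Or.inr (eq_neg_of_add_eq_zero_left hx)
  have hqodd : q % 2 = 1 := (hq.eq_two_or_odd).resolve_left hq2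
  have hcase : q % 4 = 1 ∨ q % 4 = 3 := by omega
  rw [MulChar.pow_apply' _ hq.ne_zero, ← h.G4sum_eq, hcq] at hfrob
  have hGbi := h.isIntegral_gaussSum_inv
  have hci : IsIntegral ℤ (χ q) := isIntegral_of_pow_four hcq4
  rcases hcase with hc | hc
  · obtain ⟨k, hk⟩ : ∃ k, q = 4 * k + 1 := ⟨q / 4, by omega⟩
    have e4 : ZMod.χ₄ (q : ZMod 4) = 1 := by
      rw [ZMod.χ₄_nat_eq_if_mod_four]; simp [hqodd, hc]
    have hcharq : h.cchar ^ q = h.cchar := by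
      rw [hk, pow_succ, pow_mul, h.cchar_pow_four, one_pow, one_mul]
    have hχq : χ q ^ q = χ q := by
      have : χ q ^ q = χ q ^ (4 * k + 1) := congrArg (χ q ^ ·) hk
      rw [this, pow_succ, pow_mul, hcq4, one_pow, one_mul]
    rw [hcharq, hχq, ← h.G4sum_eq] at hfrob
    have h1 := hfrob.mul (ICong.refl q (gaussSum h.cchar⁻¹ ZMod.stdAddChar)) hGbi hGi
    have e1 : χ q * G4sum p χ ^ q * gaussSum h.cchar⁻¹ ZMod.stdAddChar =
        (χ (-1) * p) * (χ q * G4sum p χ ^ (4 * k)) := by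
      rw [← hGG]
      conv_lhs => rw [show G4sum p χ ^ q = G4sum p χ ^ (4 * k) * G4sum p χ by rw [← pow_succ, ← hk]]
      ring
    rw [e1, hGG] at h1
    have h2 : ICong q (χ (-1) * p * (χ q * G4sum p χ ^ (4 * k)))
        (χ (-1) * p * (χ q * ((-1) ^ k : ℤ))) := by
      have hi1 : IsIntegral ℤ (χ (-1) * p) :=
        (isIntegral_of_pow_four (by linear_combination (χ (-1) ^ 2 + 1) * hχ1)).mul (isIntegral_nat p)
      refine (ICong.refl q _).mul ((ICong.refl q _).mul ((hGk k).trans (ICong.of_int ?_))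
        (hGi.pow _) hci) (hci.mul (hGi.pow _)) hi1
      have := hferm
      rw [hk, Nat.add_sub_cancel] at this
      rw [hk]
      simpa using this.mul_left ((-1) ^ k)
    have h3 := (h2.symm.trans h1)
    have h4 : ICong q (((p : ℤ) : ℂ) * (χ q * ((-1) ^ k : ℤ))) (((p : ℤ) : ℂ) * 1) := by
      rcases hχ1' with hx | hx
      · rw [hx] at h3
        push_cast at h3 ⊢
        simpa [mul_one] using h3
      · rw [hx] at h3
        obtain ⟨r, hr, e⟩ := h3
        exact ⟨-r, hr.neg, by push_cast at e ⊢; linear_combination -e⟩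
    have h5 := eq_of_icong hq hq2 hqp (by
      push_cast
      rw [mul_pow, hcq4, ← pow_mul, mul_comm, mul_comm k, pow_mul]
      norm_num) (Or.inl rfl) h4
    have e8 : ((ZMod.χ₈ (q : ZMod 8) : ℤ) : ℂ) = ((-1) ^ k : ℤ) := by
      rw [ZMod.χ₈_nat_eq_if_mod_eight]
      rcases Nat.even_or_odd k with ⟨j, hj⟩ | ⟨j, hj⟩
      · have : q % 8 = 1 := by omega
        rw [if_neg (by omega), if_pos (Or.inl this), hj, ← two_mul, pow_mul]
        norm_num
      · have : q % 8 = 5 := by omega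
        rw [if_neg (by omega), if_neg (by omega), hj, pow_succ, pow_mul]
        norm_num
    rw [e4, e8, Int.cast_one, h.quartic.resChar.map_one, mul_one]
    have h6 : (((-1) ^ k : ℤ) : ℂ) * ((-1) ^ k : ℤ) = 1 := by
      push_cast
      rw [← mul_pow]
      norm_num
    linear_combination (((-1) ^ k : ℤ) : ℂ) * h5 - χ q * h6
  · obtain ⟨k, hk⟩ : ∃ k, q + 1 = 4 * k := ⟨q / 4 + 1, by omega⟩
    have e4 : ZMod.χ₄ (q : ZMod 4) = -1 := by
      rw [ZMod.χ₄_nat_eq_if_mod_four]; simp [hqodd, hc]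
    have hcharq : h.cchar ^ q = h.cchar⁻¹ := by
      refine eq_inv_of_mul_eq_one_left ?_
      rw [← pow_succ, hk, pow_mul, h.cchar_pow_four, one_pow]
    have hχq : χ q ^ q * χ q = 1 := by
      rw [← pow_succ, hk, pow_mul, hcq4, one_pow]
    rw [hcharq] at hfrob
    have h1 := hfrob.mul (ICong.refl q (χ q * G4sum p χ)) (hci.mul hGi) hGbi
    have e1 : χ q ^ q * G4sum p χ ^ q * (χ q * G4sum p χ) = G4sum p χ ^ (4 * k) := by
      rw [← hk, pow_succ]
      linear_combination (G4sum p χ ^ q * G4sum p χ) * hχq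
    have e2 : gaussSum h.cchar⁻¹ ZMod.stdAddChar * (χ q * G4sum p χ) = p * (χ q * χ (-1)) := by
      linear_combination χ q * hGG
    rw [e1, e2] at h1
    have h2 : ICong q (G4sum p χ ^ (4 * k)) ((b ^ 2 : ℤ) * ((-1) ^ k : ℤ)) := by
      refine (hGk k).trans ?_
      have h3 : b ^ (4 * k) ≡ b ^ 2 [ZMOD q] := by
        have := hferm.mul_right (b ^ 2)
        rw [← pow_add, one_mul] at this
        rw [← hk]
        convert this using 2
        have := hq.two_le
        omega
      have := ICong.of_int (h3.mul_left ((-1) ^ k))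
      push_cast at this ⊢
      rw [mul_comm ((b : ℂ) ^ 2)]
      exact this
    have h3 : ICong q (p * (χ q * χ (-1))) ((b ^ 2 : ℤ) * (χ q * χ (-1))) := by
      refine ⟨a' * a * (χ q * χ (-1)), ((isIntegral_int _).mul (isIntegral_int _)).mul (hci.mul
        (isIntegral_of_pow_four (by linear_combination (χ (-1) ^ 2 + 1) * hχ1))), ?_⟩
      push_cast
      rw [hpc]
      linear_combination (a * (χ q * χ (-1))) * hac
    have h4 := (h3.symm.trans h1.symm).trans h2
    have hqb2 : ¬ (q : ℤ) ∣ b ^ 2 := fun hd => hqb (hqq.dvd_of_dvd_pow hd)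
    have h5 := eq_of_icong hq hq2 hqb2 (by
      rw [mul_pow, hcq4]
      linear_combination (χ (-1) ^ 2 + 1) * hχ1) (by
      rcases neg_one_pow_eq_or ℤ k with hx | hx <;> rw [hx] <;> simp) h4
    have e8 : ((ZMod.χ₈ (q : ZMod 8) : ℤ) : ℂ) = ((-1) ^ k : ℤ) := by
      rw [ZMod.χ₈_nat_eq_if_mod_eight]
      rcases Nat.even_or_odd k with ⟨j, hj⟩ | ⟨j, hj⟩
      · have : q % 8 = 7 := by omega
        rw [if_neg (by omega), if_pos (Or.inr this), hj, ← two_mul, pow_mul]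
        norm_num
      · have : q % 8 = 3 := by omega
        rw [if_neg (by omega), if_neg (by omega), hj, pow_succ, pow_mul]
        norm_num
    rw [e4, e8, ← h5]
    norm_num

/-- The value of the quartic character at a divisor of the real part of `π`. -/
lemma chi_dvd (h : QDatum p π χ) [Fact p.Prime] {a b : ℤ} (hab : π = a + b * I)
    (hn : a ^ 2 + b ^ 2 = p) (hao : 2 ∣ a - 1) (n : ℕ) (hna : (n : ℤ) ∣ a) :
    χ n * χ (ZMod.χ₄ n : ℤ) = (ZMod.χ₈ n : ℤ) := by
  have hm := h.quartic.resChar.map_mul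
  have h1 := h.quartic.resChar.map_one
  induction n using induction_on_primes with
  | zero =>
    push_cast at hna
    rw [zero_dvd_iff] at hna
    omega
  | one => simp [h1]
  | prime_mul q n hq ih =>
    push_cast at hna
    have h2 := h.chi_prime hab hn hao hq ((dvd_mul_right _ _).trans hna)
    have h3 := ih ((dvd_mul_left _ _).trans hna)
    push_cast
    rw [map_mul, map_mul]
    push_cast
    rw [hm _ (natCast_mem O4 _) _ (natCast_mem O4 _), hm _ (intCast_mem O4 _) _ (intCast_mem O4 _),
      ← h2, ← h3]
    ring

/-- The value of the quartic character at the real part of `π`. -/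
lemma chi_re (h : QDatum p π χ) [Fact p.Prime] {a b : ℤ} (hab : π = a + b * I)
    (hn : a ^ 2 + b ^ 2 = p) (hao : 2 ∣ a - 1) :
    χ a * χ (ZMod.χ₄ a : ℤ) = (ZMod.χ₈ a : ℤ) := by
  rcases Int.natAbs_eq a with h1 | h1
  · have := h.chi_dvd hab hn hao a.natAbs (Int.natAbs_dvd.2 dvd_rfl)
    rw [h1]
    push_cast
    simpa using this
  · have := h.chi_dvd hab hn hao a.natAbs (Int.natAbs_dvd.2 dvd_rfl)
    have hm := h.quartic.resChar.map_mul
    have hχ1 : χ (-1) * χ (-1) = 1 := by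
      rw [← hm _ (O4.neg_mem O4.one_mem) _ (O4.neg_mem O4.one_mem)]
      simpa using h.quartic.resChar.map_one
    generalize a.natAbs = n at h1 this
    subst h1
    have e4 : ZMod.χ₄ ((-(n : ℤ) : ℤ) : ZMod 4) = -1 * ZMod.χ₄ (n : ZMod 4) := by
      rw [Int.cast_neg, Int.cast_natCast, neg_eq_neg_one_mul, map_mul]
      rfl
    have e8 : ZMod.χ₈ ((-(n : ℤ) : ℤ) : ZMod 8) = ZMod.χ₈ (n : ZMod 8) := by
      rw [Int.cast_neg, Int.cast_natCast, neg_eq_neg_one_mul, map_mul,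
        show ZMod.χ₈ (-1) = 1 from rfl, one_mul]
    rw [e4, e8, ← this, Int.cast_neg, Int.cast_natCast, Int.cast_mul, Int.cast_neg, Int.cast_one,
      neg_eq_neg_one_mul (n : ℂ), hm _ (O4.neg_mem O4.one_mem) _ (natCast_mem O4 _),
      hm _ (O4.neg_mem O4.one_mem) _ (intCast_mem O4 _)]
    linear_combination (χ n * χ (ZMod.χ₄ (n : ZMod 4) : ℤ)) * hχ1

lemma exists_re (h : QDatum p π χ) [Fact p.Prime] : ∃ a : ℤ, π.re = a ∧
    (p % 16 = 13 → χ a = 1) ∧ (p % 16 = 5 → χ a = -1) ∧ (p % 16 = 1 → χ a = 1) ∧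
    (p % 16 = 9 → χ a = -1) := by
  obtain ⟨a, b, hab, hn, h2, h4⟩ := h.exists_re_im
  have h1 := h.chi_re hab hn h2
  have hneg := h.chi_neg_one
  refine ⟨a, by simp [hab], ?_⟩
  have ha2 : a % 2 = 1 := by omega
  have key5 (hp : p % 8 = 5) : χ a = -(ZMod.χ₈ a : ℤ) ∧ (a ^ 2) % 16 = (p - 4) % 16 := by
    obtain ⟨c, rfl⟩ : ∃ c, b = 2 * c := ⟨b / 2, by omega⟩
    have hc : c % 2 = 1 := by
      by_contra hc
      obtain ⟨d, rfl⟩ : ∃ d, c = 2 * d := ⟨c / 2, by omega⟩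
      obtain ⟨e, rfl⟩ : ∃ e, a = 4 * e + 1 := ⟨a / 4, by omega⟩
      have : (p : ℤ) = 8 * (2 * e ^ 2 + e + 2 * d ^ 2) + 1 := by rw [← hn]; ring
      omega
    obtain ⟨e, rfl⟩ : ∃ e, c = 2 * e + 1 := ⟨c / 2, by omega⟩
    have h3 : a % 4 = 3 := by omega
    have he : e * (e + 1) % 2 = 0 := Int.even_iff.1 (Int.even_mul_succ_self e)
    have hap : a ^ 2 = p - 4 - 16 * (e * (e + 1)) := by rw [← hn]; ring
    refine ⟨?_, by omega⟩
    have e4 : ZMod.χ₄ (a : ZMod 4) = -1 := by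
      rw [ZMod.χ₄_int_eq_if_mod_four]; simp [ha2, h3]
    rw [e4] at h1
    push_cast at h1
    have hodd : Odd ((p - 1) / 4) := Nat.odd_iff.2 (by omega)
    rw [hneg, hodd.neg_one_pow] at h1
    linear_combination -h1
  have key1 (hp : p % 8 = 1) : χ a = (ZMod.χ₈ a : ℤ) ∧ (a ^ 2) % 16 = p % 16 := by
    obtain ⟨c, rfl⟩ : ∃ c, b = 2 * c := ⟨b / 2, by omega⟩
    have hc : c % 2 = 0 := by
      by_contra hc
      obtain ⟨d, rfl⟩ : ∃ d, c = 2 * d + 1 := ⟨c / 2, by omega⟩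
      obtain ⟨e, rfl⟩ : ∃ e, a = 4 * e + 3 := ⟨a / 4, by omega⟩
      have : (p : ℤ) = 8 * (2 * e ^ 2 + 3 * e + 1 + 2 * d ^ 2 + 2 * d) + 5 := by rw [← hn]; ring
      omega
    obtain ⟨e, rfl⟩ : ∃ e, c = 2 * e := ⟨c / 2, by omega⟩
    have h3 : a % 4 = 1 := by omega
    have hap : a ^ 2 = p - 16 * e ^ 2 := by rw [← hn]; ring
    refine ⟨?_, by omega⟩
    have e4 : ZMod.χ₄ (a : ZMod 4) = 1 := by
      rw [ZMod.χ₄_int_eq_if_mod_four]; simp [ha2, h3]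
    rw [e4, Int.cast_one, h.quartic.resChar.map_one, mul_one] at h1
    exact h1
  have hsq (hr : a % 8 = 1 ∨ a % 8 = 7 ∨ a % 8 = 3 ∨ a % 8 = 5) :
      ((a ^ 2) % 16 = 1 → ZMod.χ₈ (a : ZMod 8) = 1) ∧
      ((a ^ 2) % 16 = 9 → ZMod.χ₈ (a : ZMod 8) = -1) := by
    rw [ZMod.χ₈_int_eq_if_mod_eight]
    obtain ⟨j, hj⟩ : ∃ j, a = 8 * j + a % 8 := ⟨a / 8, by omega⟩
    rcases hr with hr | hr | hr | hr <;> rw [hr] at hj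
    · have : a ^ 2 = 16 * (4 * j ^ 2 + j) + 1 := by rw [hj]; ring
      simp only [hr]; norm_num; omega
    · have : a ^ 2 = 16 * (4 * j ^ 2 + 7 * j + 3) + 1 := by rw [hj]; ring
      simp only [hr]; norm_num; omega
    · have : a ^ 2 = 16 * (4 * j ^ 2 + 3 * j) + 9 := by rw [hj]; ring
      simp only [hr]; norm_num; omega
    · have : a ^ 2 = 16 * (4 * j ^ 2 + 5 * j + 1) + 9 := by rw [hj]; ring
      simp only [hr]; norm_num; omega
  have hsq := hsq (by omega)
  refine ⟨fun hp => ?_, fun hp => ?_, fun hp => ?_, fun hp => ?_⟩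
  · obtain ⟨k1, k2⟩ := key5 (by omega)
    rw [k1, hsq.2 (by omega)]; norm_num
  · obtain ⟨k1, k2⟩ := key5 (by omega)
    rw [k1, hsq.1 (by omega)]; norm_num
  · obtain ⟨k1, k2⟩ := key1 (by omega)
    rw [k1, hsq.1 (by omega)]; norm_num
  · obtain ⟨k1, k2⟩ := key1 (by omega)
    rw [k1, hsq.2 (by omega)]; norm_num

end QDatum

lemma tendsto_norm_gi : Tendsto (fun m => ‖gi m‖) cofinite atTop := by
  refine tendsto_atTop.2 fun R => ?_
  refine (((finite_Icc (-⌈R⌉) ⌈R⌉).prod (finite_Icc (-⌈R⌉) ⌈R⌉))).subset fun m hm => ?_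
  have hm : ‖gi m‖ < R := by simpa using hm
  have h1 : (|m.1| : ℤ) ≤ ⌈R⌉ := by
    have := (abs_re_le_norm (gi m)).trans (hm.le.trans (Int.le_ceil R))
    rw [gi_re] at this
    exact_mod_cast this
  have h2 : (|m.2| : ℤ) ≤ ⌈R⌉ := by
    have := (abs_im_le_norm (gi m)).trans (hm.le.trans (Int.le_ceil R))
    rw [gi_im] at this
    exact_mod_cast this
  exact ⟨abs_le.1 h1, abs_le.1 h2⟩

lemma tendsto_norm_add_gi (u : ℂ) : Tendsto (fun m => ‖u + gi m‖) cofinite atTop := by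
  refine tendsto_atTop_mono (fun m => ?_) (tendsto_atTop_add_const_right _ (-‖u‖) tendsto_norm_gi)
  have := norm_sub_le (u + gi m) u
  simp only [add_sub_cancel_left] at this
  linarith

lemma exists_inv_norm_add_gi_le (u : ℂ) : ∃ B, 0 < B ∧ ∀ m, ‖u + gi m‖⁻¹ ≤ B := by
  obtain ⟨B, hB⟩ := (tendsto_norm_add_gi u).inv_tendsto_atTop.bddAbove_range_of_cofinite
  exact ⟨max B 1, by positivity, fun m => (hB ⟨m, rfl⟩).trans (le_max_left _ _)⟩

lemma one_le_norm_gi {m : ℤ × ℤ} (hm : m ≠ 0) : 1 ≤ ‖gi m‖ := by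
  have h1 : (1 : ℤ) ≤ m.1 ^ 2 + m.2 ^ 2 := by
    have : ¬ (m.1 = 0 ∧ m.2 = 0) := fun h => hm (Prod.ext h.1 h.2)
    by_contra hc
    have h1 : m.1 ^ 2 = 0 := le_antisymm (by nlinarith [sq_nonneg m.2]) (sq_nonneg _)
    have h2 : m.2 ^ 2 = 0 := le_antisymm (by nlinarith [sq_nonneg m.1]) (sq_nonneg _)
    exact this ⟨by simpa using h1, by simpa using h2⟩
  have h2 : (1 : ℝ) ≤ ‖gi m‖ ^ 2 := by
    rw [← normSq_eq_norm_sq, normSq_apply, gi_re, gi_im]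
    have : (1 : ℝ) ≤ (m.1 : ℝ) ^ 2 + (m.2 : ℝ) ^ 2 := by exact_mod_cast h1
    nlinarith
  nlinarith [norm_nonneg (gi m)]

lemma summable_norm_gi_inv_cube : Summable fun m => (‖gi m‖ ^ 3)⁻¹ := by
  refine (summable_norm_gi_rpow (k := 3) (by norm_num)).congr fun m => ?_
  rw [Real.rpow_neg (norm_nonneg _)]
  norm_cast

lemma summable_zeta_term (u : ℂ) : Summable fun m => u ^ 2 / (gi m ^ 2 * (u + gi m)) := by
  refine summable_of_isBigO (summable_norm_gi_inv_cube) (IsBigO.of_bound (2 * ‖u‖ ^ 2) ?_)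
  filter_upwards [tendsto_norm_gi.eventually_ge_atTop (2 * ‖u‖ + 1)] with m hm
  have h0 : 0 < ‖gi m‖ := by linarith [norm_nonneg u]
  have h2 := norm_sub_le (u + gi m) u
  simp only [add_sub_cancel_left] at h2
  have h1 : 0 < ‖u + gi m‖ := by linarith [norm_nonneg u]
  rw [norm_div, norm_mul, norm_pow, norm_pow, norm_inv, norm_pow, norm_norm, ← div_eq_mul_inv,
    div_le_div_iff₀ (by positivity) (by positivity)]
  have := mul_le_mul_of_nonneg_left (by linarith : ‖gi m‖ ≤ 2 * ‖u + gi m‖)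
    (by positivity : 0 ≤ ‖u‖ ^ 2 * ‖gi m‖ ^ 2)
  linarith

/-- The truncated Eisenstein–Kronecker sum as an integral of the theta function. -/
lemma hasSum_truncated {u : ℂ} (hu : ∀ m, u + gi m ≠ 0) {ε : ℝ} (hε : 0 < ε) :
    HasSum (fun m => (Real.exp (-Real.pi * normSq (u + gi m) * ε) : ℂ) / (u + gi m))
      (Real.pi * ∫ t in Ioi ε, cTheta u t) := by
  have hpi := Real.pi_pos
  have hw (m) : 0 < normSq (u + gi m) := normSq_pos.2 (hu m)
  have hlt (m) : -Real.pi * normSq (u + gi m) < 0 := by nlinarith [hw m]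
  have h_int (m) : MeasureTheory.IntegrableOn
      (fun t : ℝ => Real.exp (-Real.pi * normSq (u + gi m) * t)) (Ioi ε) :=
    integrableOn_exp_mul_Ioi (hlt m) ε
  have hval (m) : ∫ t in Ioi ε, Real.exp (-Real.pi * normSq (u + gi m) * t) =
      Real.exp (-Real.pi * normSq (u + gi m) * ε) / (Real.pi * normSq (u + gi m)) := by
    rw [integral_exp_mul_Ioi (hlt m) ε]
    rw [neg_mul, div_neg, neg_div, neg_neg]
  have hs := (hasSum_cTheta u hε).summable.norm
  have key := MeasureTheory.hasSum_integral_of_summable_integral_norm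
    (μ := MeasureTheory.volume.restrict (Ioi ε))
    (F := fun m (t : ℝ) => (starRingEnd ℂ) (u + gi m) *
      (Real.exp (-Real.pi * normSq (u + gi m) * t) : ℂ))
    (fun m => ((h_int m).ofReal).const_mul _) (by
      obtain ⟨B, hB, hb⟩ := exists_inv_norm_add_gi_le u
      refine (hs.mul_left (B ^ 2 / Real.pi)).of_nonneg_of_le (fun m => by positivity) fun m => ?_
      simp only [norm_mul, norm_real, Real.norm_eq_abs, Real.abs_exp]
      rw [MeasureTheory.integral_const_mul, hval m, normSq_eq_norm_sq]
      have h0 : 0 < ‖u + gi m‖ := norm_pos_iff.2 (hu m)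
      have h2 : (‖u + gi m‖ ^ 2)⁻¹ ≤ B ^ 2 := by
        rw [← inv_pow]; exact pow_le_pow_left₀ (by positivity) (hb m) 2
      have h3 : (0 : ℝ) ≤ ‖(starRingEnd ℂ) (u + gi m)‖ *
        Real.exp (-Real.pi * ‖u + gi m‖ ^ 2 * ε) / Real.pi := by positivity
      calc _ = (‖(starRingEnd ℂ) (u + gi m)‖ *
        Real.exp (-Real.pi * ‖u + gi m‖ ^ 2 * ε) / Real.pi) * (‖u + gi m‖ ^ 2)⁻¹ := by
            field_simp
        _ ≤ (‖(starRingEnd ℂ) (u + gi m)‖ *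
        Real.exp (-Real.pi * ‖u + gi m‖ ^ 2 * ε) / Real.pi) * B ^ 2 :=
            mul_le_mul_of_nonneg_left h2 h3
        _ = _ := by ring)
  have h1 : ∫ t in Ioi ε, cTheta u t = ∫ t in Ioi ε, ∑' m, (starRingEnd ℂ) (u + gi m) *
      (Real.exp (-Real.pi * normSq (u + gi m) * t) : ℂ) := by
    refine MeasureTheory.setIntegral_congr_fun measurableSet_Ioi fun t ht => ?_
    exact (hasSum_cTheta u (hε.trans ht)).tsum_eq.symm
  rw [h1]
  refine (key.mul_left (Real.pi : ℂ)).congr_fun_eq fun m => ?_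
  rw [MeasureTheory.integral_const_mul, integral_complex_ofReal, hval m]
  have hc : (starRingEnd ℂ) (u + gi m) ≠ 0 := (map_ne_zero _).2 (hu m)
  have h2 : (normSq (u + gi m) : ℂ) = (u + gi m) * (starRingEnd ℂ) (u + gi m) :=
    (mul_conj _).symm
  push_cast
  rw [h2]
  have := hu m
  have hpi' : (Real.pi : ℂ) ≠ 0 := by exact_mod_cast hpi.ne'
  field_simp

lemma tendsto_integral_cTheta (u : ℂ) :
    Tendsto (fun ε : ℝ => (Real.pi : ℂ) * ∫ t in Ioi ε, cTheta u t) (nhdsWithin 0 (Ioi 0))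
      (nhds (EK u)) := by
  have hm := mellinConvergent_cTheta u 1
  have hi : MeasureTheory.IntegrableOn (cTheta u) (Ioi 0) := by
    simpa [MellinConvergent] using hm
  have he : EK u = Real.pi * ∫ t in Ioi 0, cTheta u t := by
    simp [EK, mellin]
  rw [he]
  refine Tendsto.const_mul _ ?_
  have h1 : ∀ ε : ℝ, ∫ t in Ioi ε, cTheta u t = ∫ t, (Ioi ε).indicator (cTheta u) t := fun ε =>
    (MeasureTheory.integral_indicator measurableSet_Ioi).symm
  simp only [h1]
  refine MeasureTheory.tendsto_integral_filter_of_dominated_convergence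
    (fun t => ‖(Ioi 0).indicator (cTheta u) t‖) ?_ ?_ ?_ ?_
  · filter_upwards [self_mem_nhdsWithin] with ε hε
    exact (hi.mono_set (Ioi_subset_Ioi (le_of_lt hε))).integrable_indicator measurableSet_Ioi
      |>.aestronglyMeasurable
  · filter_upwards [self_mem_nhdsWithin] with ε hε
    refine Eventually.of_forall fun t => ?_
    exact norm_indicator_le_of_subset (Ioi_subset_Ioi (le_of_lt hε)) _ _
  · exact (hi.integrable_indicator measurableSet_Ioi).norm
  · refine Eventually.of_forall fun t => ?_
    refine tendsto_const_nhds.congr' ?_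
    by_cases ht : 0 < t
    · filter_upwards [mem_nhdsWithin_of_mem_nhds (Iio_mem_nhds ht)] with ε hε
      rw [indicator_of_mem (mem_Ioi.2 ht), indicator_of_mem (mem_Ioi.2 hε)]
    · filter_upwards [self_mem_nhdsWithin] with ε hε
      rw [indicator_of_notMem (by simpa using ht), indicator_of_notMem]
      have : (0 : ℝ) < ε := hε
      simp only [mem_Ioi, not_lt] at ht ⊢
      linarith

/-- The Gaussian weight `exp (-x |m|²)`. -/
def gaussW (x : ℝ) (m : ℤ × ℤ) : ℝ := Real.exp (-x * normSq (gi m))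

lemma gaussW_nonneg (x : ℝ) (m : ℤ × ℤ) : 0 ≤ gaussW x m := (Real.exp_pos _).le

lemma hasSum_gaussW {x : ℝ} (hx : 0 < x) :
    HasSum (gaussW x) (evenKernel (0 : ℝ) (x / Real.pi) ^ 2) := by
  have hpi := Real.pi_pos
  have h1 := hasSum_int_evenKernel 0 (div_pos hx hpi)
  have h2 := h1.mul h1 (summable_mul_of_summable_norm h1.summable.norm h1.summable.norm)
  rw [sq]
  convert! h2 using 1
  funext m
  rw [gaussW, ← Real.exp_add]
  congr 1
  rw [normSq_apply, gi_re, gi_im]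
  field_simp
  ring

lemma tendsto_mul_tsum_gaussW :
    Tendsto (fun x : ℝ => x * ∑' m, gaussW x m) (nhdsWithin 0 (Ioi 0)) (nhds Real.pi) := by
  have hpi := Real.pi_pos
  have h1 : Tendsto (cosKernel 0) atTop (nhds 1) := by
    obtain ⟨r, hr, h⟩ := isBigO_atTop_cosKernel_sub 0
    have h2 : Tendsto (fun x : ℝ => Real.exp (-r * x)) atTop (nhds 0) := by
      refine Real.tendsto_exp_atBot.comp ?_
      exact tendsto_id.const_mul_atTop_of_neg (by linarith)
    simpa using (h.trans_tendsto h2).add_const 1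
  have h2 : Tendsto (fun x : ℝ => Real.pi * cosKernel 0 (Real.pi * x⁻¹) ^ 2)
      (nhdsWithin 0 (Ioi 0)) (nhds (Real.pi * 1 ^ 2)) :=
    ((h1.comp (tendsto_inv_nhdsGT_zero.const_mul_atTop hpi)).pow 2).const_mul _
  rw [one_pow, mul_one] at h2
  refine h2.congr' ?_
  filter_upwards [self_mem_nhdsWithin] with x hx
  have hx : 0 < x := hx
  rw [(hasSum_gaussW hx).tsum_eq]
  have h3 := evenKernel_functional_equation (0 : ℝ) (x / Real.pi)
  rw [QuotientAddGroup.mk_zero] at h3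
  rw [QuotientAddGroup.mk_zero, h3, mul_pow, div_pow, ← Real.rpow_natCast (_ ^ _), ← Real.rpow_mul (by positivity)]
  norm_num
  rw [div_eq_mul_inv Real.pi x]
  field_simp

/-- Multiplication by `i` on the index set of the Gaussian integers. -/
def rotI : ℤ × ℤ ≃ ℤ × ℤ where
  toFun m := (-m.2, m.1)
  invFun m := (m.2, -m.1)
  left_inv m := by simp
  right_inv m := by simp

lemma gi_rotI (m : ℤ × ℤ) : gi (rotI m) = I * gi m := by
  apply Complex.ext <;> simp [rotI]

lemma gaussW_rotI (x : ℝ) (m : ℤ × ℤ) : gaussW x (rotI m) = gaussW x m := by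
  simp [gaussW, gi_rotI]

lemma tsum_eq_zero_of_rotI {F : ℤ × ℤ → ℂ} {c : ℂ} (hc : c ≠ 1) (h : ∀ m, F (rotI m) = c * F m) :
    ∑' m, F m = 0 := by
  have h1 : ∑' m, F m = c * ∑' m, F m := by
    rw [← tsum_mul_left, ← rotI.tsum_eq F]
    exact tsum_congr h
  have h2 : (1 - c) * ∑' m, F m = 0 := by linear_combination h1
  exact (mul_eq_zero.1 h2).resolve_left (sub_ne_zero.2 hc.symm)

lemma summable_gaussW_mul {x : ℝ} (hx : 0 < x) {F : ℤ × ℤ → ℂ} (hF : ∀ m, ‖F m‖ ≤ 1) :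
    Summable fun m => (gaussW x m : ℂ) * F m := by
  refine Summable.of_norm_bounded (hasSum_gaussW hx).summable fun m => ?_
  rw [norm_mul, norm_real, Real.norm_of_nonneg (gaussW_nonneg x m)]
  exact mul_le_of_le_one_right (gaussW_nonneg x m) (hF m)

lemma norm_gi_inv_le (m : ℤ × ℤ) : ‖(gi m)⁻¹‖ ≤ 1 := by
  by_cases hm : m = 0
  · simp [gi_eq_zero.2 hm]
  · rw [norm_inv]; exact inv_le_one_of_one_le₀ (one_le_norm_gi hm)

lemma hasSum_gaussW_inv {x : ℝ} (hx : 0 < x) :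
    HasSum (fun m => (gaussW x m : ℂ) * (gi m)⁻¹) 0 := by
  have := (summable_gaussW_mul hx norm_gi_inv_le).hasSum
  rwa [tsum_eq_zero_of_rotI (c := -I)] at this
  · intro h; simpa using congrArg re h
  · intro m
    rw [gaussW_rotI, gi_rotI, mul_inv, inv_I]; ring

lemma hasSum_gaussW_inv_sq {x : ℝ} (hx : 0 < x) :
    HasSum (fun m => (gaussW x m : ℂ) * ((gi m)⁻¹ ^ 2)) 0 := by
  have := (summable_gaussW_mul hx (F := fun m => (gi m)⁻¹ ^ 2) fun m => by
    rw [norm_pow]; exact pow_le_one₀ (norm_nonneg _) (norm_gi_inv_le m)).hasSum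
  rwa [tsum_eq_zero_of_rotI (c := -1)] at this
  · norm_num
  · intro m
    rw [gaussW_rotI, gi_rotI, mul_inv, mul_pow, inv_pow, I_sq]; ring

lemma hasSum_gaussW_conj_mul_inv {x : ℝ} (hx : 0 < x) :
    HasSum (fun m => (gaussW x m : ℂ) * ((starRingEnd ℂ) (gi m) * (gi m)⁻¹)) 0 := by
  have := (summable_gaussW_mul hx (F := fun m => (starRingEnd ℂ) (gi m) * (gi m)⁻¹) fun m => by
    rw [norm_mul, norm_conj, norm_inv]; exact mul_inv_le_one).hasSum
  rwa [tsum_eq_zero_of_rotI (c := -1)] at this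
  · norm_num
  · intro m
    rw [gaussW_rotI, gi_rotI, mul_inv, inv_I, map_mul, conj_I]
    linear_combination (gaussW x m : ℂ) * (starRingEnd ℂ) (gi m) * (gi m)⁻¹ * I_sq

lemma abs_exp_sub_one_sub_le (z : ℝ) : |Real.exp z - 1 - z| ≤ z ^ 2 * Real.exp |z| := by
  have h := Complex.norm_exp_sub_sum_le_norm_mul_exp (z : ℂ) 2
  simp only [Finset.sum_range_succ, Finset.sum_range_zero] at h
  norm_num at h
  rw [← Complex.ofReal_exp, sub_add_eq_sub_sub] at h
  norm_cast at h

lemma abs_exp_sub_one_le (z : ℝ) : |Real.exp z - 1| ≤ |z| * Real.exp |z| := by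
  have h := Complex.norm_exp_sub_sum_le_norm_mul_exp (z : ℂ) 1
  simp only [Finset.sum_range_succ, Finset.sum_range_zero] at h
  norm_num at h
  rw [← Complex.ofReal_exp] at h
  norm_cast at h

/-- The exponent difference `|u + m|² - |m|²`. -/
def normDiff (u : ℂ) (m : ℤ × ℤ) : ℝ := normSq (u + gi m) - normSq (gi m)

lemma ofReal_normDiff (u : ℂ) (m : ℤ × ℤ) : (normDiff u m : ℂ) =
    u * (starRingEnd ℂ) u + u * (starRingEnd ℂ) (gi m) + (starRingEnd ℂ) u * gi m := by
  rw [normDiff, ofReal_sub, ← mul_conj, ← mul_conj, map_add]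
  ring

lemma abs_normDiff_le (u : ℂ) (m : ℤ × ℤ) : |normDiff u m| ≤ ‖u‖ ^ 2 + 2 * ‖u‖ * ‖gi m‖ := by
  rw [← Real.norm_eq_abs, ← norm_real, ofReal_normDiff]
  refine (norm_add₃_le).trans (le_of_eq ?_)
  simp only [norm_mul, norm_conj]
  ring

lemma gaussW_mul_exp_le {x : ℝ} (hx : 0 < x) (hx1 : x ≤ 1) (u : ℂ) (m : ℤ × ℤ) :
    gaussW x m * Real.exp |-x * normDiff u m| ≤
      Real.exp (3 * ‖u‖ ^ 2) * Real.exp (-(x * ‖gi m‖ ^ 2) / 2) := by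
  rw [gaussW, ← Real.exp_add, ← Real.exp_add, Real.exp_le_exp, normSq_eq_norm_sq, abs_mul, abs_neg,
    abs_of_pos hx]
  have h1 := mul_le_mul_of_nonneg_left (abs_normDiff_le u m) hx.le
  have h2 : 2 * ‖u‖ * ‖gi m‖ ≤ ‖gi m‖ ^ 2 / 2 + 2 * ‖u‖ ^ 2 := by
    nlinarith [sq_nonneg (‖gi m‖ - 2 * ‖u‖)]
  have h3 := mul_le_mul_of_nonneg_left h2 hx.le
  have h4 := mul_le_mul_of_nonneg_right hx1 (sq_nonneg ‖u‖)
  linarith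

lemma mul_exp_neg_half_le (q : ℝ) : q * Real.exp (-q / 2) ≤ 2 := by
  have h1 := Real.add_one_le_exp (q / 2)
  have h2 : Real.exp (-q / 2) * Real.exp (q / 2) = 1 := by
    rw [← Real.exp_add]; simp; ring
  have h3 := Real.exp_pos (-q / 2)
  nlinarith

lemma sq_mul_exp_neg_half_le (q : ℝ) (hq : 0 ≤ q) : q ^ 2 * Real.exp (-q / 2) ≤ 8 := by
  have h1 := Real.quadratic_le_exp_of_nonneg (by positivity : 0 ≤ q / 2)
  have h2 : Real.exp (-q / 2) * Real.exp (q / 2) = 1 := by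
    rw [← Real.exp_add]; simp; ring
  have h3 := Real.exp_pos (-q / 2)
  nlinarith

lemma abs_mul_normDiff_le {x : ℝ} (hx : 0 < x) (u : ℂ) {m : ℤ × ℤ} (hm : m ≠ 0) :
    |-x * normDiff u m| ≤ x * ((‖u‖ ^ 2 + 2 * ‖u‖) * ‖gi m‖) := by
  rw [abs_mul, abs_neg, abs_of_pos hx]
  refine mul_le_mul_of_nonneg_left ((abs_normDiff_le u m).trans ?_) hx.le
  nlinarith [one_le_norm_gi hm, sq_nonneg ‖u‖]

lemma norm_second_order_le {x : ℝ} (hx : 0 < x) (hx1 : x ≤ 1) (u : ℂ) (m : ℤ × ℤ) :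
    ‖(gaussW x m : ℂ) * ((Real.exp (-x * normDiff u m) - 1 - (-x * normDiff u m) : ℝ) : ℂ) *
      (gi m)⁻¹‖ ≤
    (8 * Real.exp (3 * ‖u‖ ^ 2) * (‖u‖ ^ 2 + 2 * ‖u‖) ^ 2) * (‖gi m‖ ^ 3)⁻¹ := by
  by_cases hm : m = 0
  · simp [gi_eq_zero.2 hm]
  have h0 : 0 < ‖gi m‖ := by linarith [one_le_norm_gi hm]
  rw [norm_mul, norm_mul, norm_real, norm_real, Real.norm_of_nonneg (gaussW_nonneg x m), norm_inv,
    Real.norm_eq_abs]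
  set A := ‖u‖ ^ 2 + 2 * ‖u‖
  set K := Real.exp (3 * ‖u‖ ^ 2)
  have h1 := abs_exp_sub_one_sub_le (-x * normDiff u m)
  have h2 := abs_mul_normDiff_le hx u hm
  have h3 : (-x * normDiff u m) ^ 2 ≤ (x * (A * ‖gi m‖)) ^ 2 := by
    rw [← sq_abs]; exact pow_le_pow_left₀ (abs_nonneg _) h2 2
  calc _ ≤ gaussW x m * ((x * (A * ‖gi m‖)) ^ 2 * Real.exp |-x * normDiff u m|) * ‖gi m‖⁻¹ := by
        have := gaussW_nonneg x m
        gcongr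
        exact h1.trans (by gcongr)
    _ = (x * (A * ‖gi m‖)) ^ 2 * (gaussW x m * Real.exp |-x * normDiff u m|) * ‖gi m‖⁻¹ := by ring
    _ ≤ (x * (A * ‖gi m‖)) ^ 2 * (K * Real.exp (-(x * ‖gi m‖ ^ 2) / 2)) * ‖gi m‖⁻¹ := by
        have := gaussW_mul_exp_le hx hx1 u m
        gcongr
    _ = A ^ 2 * K * ((x * ‖gi m‖ ^ 2) ^ 2 * Real.exp (-(x * ‖gi m‖ ^ 2) / 2)) *
        (‖gi m‖ ^ 3)⁻¹ := by field_simp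
    _ ≤ A ^ 2 * K * 8 * (‖gi m‖ ^ 3)⁻¹ := by
        have := sq_mul_exp_neg_half_le (x * ‖gi m‖ ^ 2) (by positivity)
        gcongr
    _ = _ := by ring

lemma norm_first_order_le {x : ℝ} (hx : 0 < x) (hx1 : x ≤ 1) (u : ℂ) (m : ℤ × ℤ) :
    ‖(gaussW x m : ℂ) * ((Real.exp (-x * normDiff u m) - 1 : ℝ) : ℂ) * ((gi m)⁻¹ ^ 2)‖ ≤
    (2 * Real.exp (3 * ‖u‖ ^ 2) * (‖u‖ ^ 2 + 2 * ‖u‖)) * (‖gi m‖ ^ 3)⁻¹ := by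
  by_cases hm : m = 0
  · simp [gi_eq_zero.2 hm]
  have h0 : 0 < ‖gi m‖ := by linarith [one_le_norm_gi hm]
  rw [norm_mul, norm_mul, norm_real, norm_real, Real.norm_of_nonneg (gaussW_nonneg x m), norm_pow,
    norm_inv, Real.norm_eq_abs]
  set A := ‖u‖ ^ 2 + 2 * ‖u‖
  set K := Real.exp (3 * ‖u‖ ^ 2)
  have h1 := abs_exp_sub_one_le (-x * normDiff u m)
  have h2 := abs_mul_normDiff_le hx u hm
  calc _ ≤ gaussW x m * (x * (A * ‖gi m‖) * Real.exp |-x * normDiff u m|) * ‖gi m‖⁻¹ ^ 2 := by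
        have := gaussW_nonneg x m
        gcongr
        exact h1.trans (by gcongr)
    _ = x * (A * ‖gi m‖) * (gaussW x m * Real.exp |-x * normDiff u m|) * ‖gi m‖⁻¹ ^ 2 := by ring
    _ ≤ x * (A * ‖gi m‖) * (K * Real.exp (-(x * ‖gi m‖ ^ 2) / 2)) * ‖gi m‖⁻¹ ^ 2 := by
        have := gaussW_mul_exp_le hx hx1 u m
        gcongr
    _ = A * K * (x * ‖gi m‖ ^ 2 * Real.exp (-(x * ‖gi m‖ ^ 2) / 2)) *
        (‖gi m‖ ^ 3)⁻¹ := by field_simp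
    _ ≤ A * K * 2 * (‖gi m‖ ^ 3)⁻¹ := by
        have := mul_exp_neg_half_le (x * ‖gi m‖ ^ 2)
        gcongr
    _ = _ := by ring

lemma truncated_term {u : ℂ} (hu : ∀ m, u + gi m ≠ 0) (x : ℝ) (m : ℤ × ℤ) :
    (Real.exp (-x * normSq (u + gi m)) : ℂ) / (u + gi m) =
      (if m = 0 then (Real.exp (-x * normSq u) : ℂ) / u + x * (starRingEnd ℂ) u else 0) +
      (Real.exp (-x * normSq (u + gi m)) : ℂ) * (u ^ 2 / (gi m ^ 2 * (u + gi m))) +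
      (gaussW x m : ℂ) * ((Real.exp (-x * normDiff u m) - 1 - (-x * normDiff u m) : ℝ) : ℂ) *
        (gi m)⁻¹ -
      u * ((gaussW x m : ℂ) * ((Real.exp (-x * normDiff u m) - 1 : ℝ) : ℂ) * ((gi m)⁻¹ ^ 2)) +
      (1 - x * (u * (starRingEnd ℂ) u)) * ((gaussW x m : ℂ) * (gi m)⁻¹) -
      u * ((gaussW x m : ℂ) * ((gi m)⁻¹ ^ 2)) -
      x * u * ((gaussW x m : ℂ) * ((starRingEnd ℂ) (gi m) * (gi m)⁻¹)) -
      x * (starRingEnd ℂ) u * gaussW x m := by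
  by_cases hm : m = 0
  · subst hm
    have h0 : gi 0 = 0 := gi_eq_zero.2 rfl
    simp [h0, gaussW]
  have hg : gi m ≠ 0 := fun h => hm (gi_eq_zero.1 h)
  have h1 : Real.exp (-x * normSq (u + gi m)) = gaussW x m * Real.exp (-x * normDiff u m) := by
    rw [gaussW, ← Real.exp_add, normDiff]; ring_nf
  have h2 := hu m
  rw [if_neg hm, h1]
  push_cast
  rw [ofReal_normDiff]
  field_simp
  ring

lemma EK_eq {u : ℂ} (hu : ∀ m, u + gi m ≠ 0) :
    EK u = u⁻¹ + ∑' m, u ^ 2 / (gi m ^ 2 * (u + gi m)) - Real.pi * (starRingEnd ℂ) u := by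
  have hpi := Real.pi_pos
  have hx1 : ∀ᶠ x : ℝ in nhdsWithin 0 (Ioi 0), 0 < x ∧ x ≤ 1 := by
    filter_upwards [Ioc_mem_nhdsGT (zero_lt_one' ℝ)] with x hx using hx
  have hlim : Tendsto (fun x : ℝ => x / Real.pi) (nhdsWithin 0 (Ioi 0)) (nhdsWithin 0 (Ioi 0)) := by
    refine tendsto_nhdsWithin_iff.2 ⟨?_, ?_⟩
    · refine Tendsto.mono_left ?_ nhdsWithin_le_nhds
      have : Continuous fun x : ℝ => x / Real.pi := by fun_prop
      simpa using this.tendsto 0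
    · filter_upwards [self_mem_nhdsWithin] with x hx
      exact div_pos hx hpi
  have hL := (tendsto_integral_cTheta u).comp hlim
  have id0 : Tendsto (fun x : ℝ => x) (nhdsWithin 0 (Ioi 0)) (nhds 0) :=
    tendsto_id.mono_left nhdsWithin_le_nhds
  have id0' : Tendsto (fun x : ℝ => (x : ℂ)) (nhdsWithin 0 (Ioi 0)) (nhds 0) := by
    have := (continuous_ofReal.tendsto 0).comp id0
    rw [ofReal_zero] at this
    exact this
  have hcont {f : ℝ → ℝ} (hf : Continuous f) :
      Tendsto (fun x : ℝ => (f x : ℂ)) (nhdsWithin 0 (Ioi 0)) (nhds (f 0)) :=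
    ((continuous_ofReal.comp hf).tendsto 0).mono_left nhdsWithin_le_nhds
  -- the three dominated sums
  have hb1 : ∀ᶠ x : ℝ in nhdsWithin 0 (Ioi 0), ∀ m, ‖(Real.exp (-x * normSq (u + gi m)) : ℂ) *
      (u ^ 2 / (gi m ^ 2 * (u + gi m)))‖ ≤ ‖u ^ 2 / (gi m ^ 2 * (u + gi m))‖ := by
    filter_upwards [hx1] with x hx m
    rw [norm_mul, norm_real, Real.norm_of_nonneg (Real.exp_pos _).le]
    refine mul_le_of_le_one_left (norm_nonneg _) (Real.exp_le_one_iff.2 ?_)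
    nlinarith [normSq_nonneg (u + gi m)]
  have hb2 := hx1.mono fun x hx m => norm_second_order_le hx.1 hx.2 u m
  have hb3 := hx1.mono fun x hx m => norm_first_order_le hx.1 hx.2 u m
  have s1 := (summable_zeta_term u).norm
  have s2 := summable_norm_gi_inv_cube.mul_left
    (8 * Real.exp (3 * ‖u‖ ^ 2) * (‖u‖ ^ 2 + 2 * ‖u‖) ^ 2)
  have s3 := summable_norm_gi_inv_cube.mul_left
    (2 * Real.exp (3 * ‖u‖ ^ 2) * (‖u‖ ^ 2 + 2 * ‖u‖))
  have t1 := tendsto_tsum_of_dominated_convergence s1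
    (g := fun m => u ^ 2 / (gi m ^ 2 * (u + gi m))) (fun m => by
      have := (hcont (f := fun x => Real.exp (-x * normSq (u + gi m))) (by fun_prop)).mul_const
        (u ^ 2 / (gi m ^ 2 * (u + gi m)))
      simpa using this) hb1
  have hgc (m) : Continuous fun x => gaussW x m := by unfold gaussW; fun_prop
  have t2 := tendsto_tsum_of_dominated_convergence s2
    (g := fun m => 0) (fun m => by
      have := ((hcont (hgc m)).mul (hcont (f := fun x => Real.exp (-x * normDiff u m) - 1 -
        (-x * normDiff u m)) (by fun_prop))).mul_const ((gi m)⁻¹)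
      simpa using this) hb2
  have t3 := tendsto_tsum_of_dominated_convergence s3
    (g := fun m => 0) (fun m => by
      have := ((hcont (hgc m)).mul (hcont (f := fun x => Real.exp (-x * normDiff u m) - 1)
        (by fun_prop))).mul_const ((gi m)⁻¹ ^ 2)
      simpa using this) hb3
  have t0 := ((hcont (f := fun x => Real.exp (-x * normSq u)) (by fun_prop)).div_const u).add
    (id0'.mul_const ((starRingEnd ℂ) u))
  have t4 : Tendsto (fun x : ℝ => ((x * ∑' m, gaussW x m : ℝ) : ℂ)) (nhdsWithin 0 (Ioi 0))
      (nhds Real.pi) := (continuous_ofReal.tendsto _).comp tendsto_mul_tsum_gaussW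
  have htot := ((((t0.add t1).add t2).sub (t3.const_mul u))).sub (t4.const_mul ((starRingEnd ℂ) u))
  refine (tendsto_nhds_unique hL (htot.congr' ?_)).trans ?_
  · filter_upwards [hx1, hb1, hb2, hb3] with x hx b1 b2 b3
    have h1 := hasSum_truncated hu (div_pos hx.1 hpi)
    have h2 := (((((((hasSum_ite_eq (0 : ℤ × ℤ)
      ((Real.exp (-x * normSq u) : ℂ) / u + x * (starRingEnd ℂ) u)).add
      (Summable.of_norm_bounded s1 b1).hasSum).add (Summable.of_norm_bounded s2 b2).hasSum).sub
      ((Summable.of_norm_bounded s3 b3).hasSum.mul_left u)).add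
      ((hasSum_gaussW_inv hx.1).mul_left (1 - x * (u * (starRingEnd ℂ) u)))).sub
      ((hasSum_gaussW_inv_sq hx.1).mul_left u)).sub
      ((hasSum_gaussW_conj_mul_inv hx.1).mul_left (x * u))).sub
      ((Complex.hasSum_ofReal.2 (hasSum_gaussW hx.1).summable.hasSum).mul_left
        (x * (starRingEnd ℂ) u))
    have h3 := h2.congr_fun_eq (g := fun m => (Real.exp (-Real.pi * normSq (u + gi m) *
      (x / Real.pi)) : ℂ) / (u + gi m)) fun m => by
        rw [show -Real.pi * normSq (u + gi m) * (x / Real.pi) = -x * normSq (u + gi m) by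
          field_simp]
        exact truncated_term hu x m
    have h4 := h3.unique h1
    rw [Function.comp_apply, ← h4]
    push_cast
    ring
  · simp
    ring

/-- `f` agrees near `z`, away from `z`, with `(u - z) ^ n` times an analytic function. -/
def OrdGE (f : ℂ → ℂ) (z : ℂ) (n : ℤ) : Prop :=
  ∃ g : ℂ → ℂ, AnalyticAt ℂ g z ∧ ∀ᶠ u in nhdsWithin z {z}ᶜ, f u = (u - z) ^ n * g u

namespace OrdGE

variable {f f₁ f₂ : ℂ → ℂ} {z : ℂ} {m n : ℤ}

lemma of_analyticAt (hf : AnalyticAt ℂ f z) : OrdGE f z 0 :=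
  ⟨f, hf, by simp⟩

lemma const (c z : ℂ) : OrdGE (fun _ => c) z 0 := of_analyticAt analyticAt_const

lemma congr (h : OrdGE f₁ z n) (he : ∀ᶠ u in nhdsWithin z {z}ᶜ, f₂ u = f₁ u) : OrdGE f₂ z n := by
  obtain ⟨g, hg, h⟩ := h
  exact ⟨g, hg, by filter_upwards [h, he] with u h1 h2 using h2.trans h1⟩

lemma mul (h₁ : OrdGE f₁ z m) (h₂ : OrdGE f₂ z n) : OrdGE (fun u => f₁ u * f₂ u) z (m + n) := by
  obtain ⟨g₁, hg₁, h₁⟩ := h₁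
  obtain ⟨g₂, hg₂, h₂⟩ := h₂
  refine ⟨fun u => g₁ u * g₂ u, hg₁.mul hg₂, ?_⟩
  filter_upwards [h₁, h₂, self_mem_nhdsWithin] with u e₁ e₂ hu
  rw [e₁, e₂, zpow_add₀ (sub_ne_zero.2 hu)]
  ring

lemma mono (h : OrdGE f z n) (hmn : m ≤ n) : OrdGE f z m := by
  obtain ⟨g, hg, h⟩ := h
  obtain ⟨k, hk⟩ := Int.eq_ofNat_of_zero_le (sub_nonneg.2 hmn)
  refine ⟨fun u => (u - z) ^ k * g u, ((analyticAt_id.sub analyticAt_const).pow k).mul hg, ?_⟩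
  filter_upwards [h, self_mem_nhdsWithin] with u e hu
  rw [e, ← mul_assoc, ← zpow_natCast, ← zpow_add₀ (sub_ne_zero.2 hu)]
  congr 2
  omega

lemma add (h₁ : OrdGE f₁ z n) (h₂ : OrdGE f₂ z n) : OrdGE (fun u => f₁ u + f₂ u) z n := by
  obtain ⟨g₁, hg₁, h₁⟩ := h₁
  obtain ⟨g₂, hg₂, h₂⟩ := h₂
  refine ⟨fun u => g₁ u + g₂ u, hg₁.add hg₂, ?_⟩
  filter_upwards [h₁, h₂] with u e₁ e₂
  rw [e₁, e₂]
  ring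

lemma const_mul (h : OrdGE f z n) (c : ℂ) : OrdGE (fun u => c * f u) z n := by
  simpa using (const c z).mul h

lemma sub (h₁ : OrdGE f₁ z n) (h₂ : OrdGE f₂ z n) : OrdGE (fun u => f₁ u - f₂ u) z n := by
  refine (h₁.add (h₂.const_mul (-1))).congr (Eventually.of_forall fun u => ?_)
  ring

lemma of_zero (hf : AnalyticAt ℂ f z) (h0 : f z = 0) : OrdGE f z 1 := by
  obtain ⟨p, hp⟩ := hf
  have := hp.has_fpower_series_dslope_fslope
  refine ⟨dslope f z, this.analyticAt, ?_⟩
  filter_upwards with u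
  have := sub_smul_dslope f z u
  rw [h0, sub_zero, smul_eq_mul] at this
  rw [zpow_one, this]

lemma of_zero_deriv (hf : AnalyticAt ℂ f z) (h0 : f z = 0) (h1 : deriv f z = 0) :
    OrdGE f z 2 := by
  obtain ⟨p, hp⟩ := hf
  have hd := hp.has_fpower_series_dslope_fslope
  have h2 := of_zero hd.analyticAt (by rw [dslope_same, h1])
  have h3 : OrdGE (fun u => u - z) z 1 := ⟨fun _ => 1, analyticAt_const, by simp⟩
  refine (h3.mul h2).congr (Eventually.of_forall fun u => ?_)
  have := sub_smul_dslope f z u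
  rw [h0, sub_zero, smul_eq_mul] at this
  exact this.symm

lemma comp_affine {a b : ℂ} (ha : a ≠ 0) (h : OrdGE f (a * z + b) n) :
    OrdGE (fun u => f (a * u + b)) z n := by
  obtain ⟨g, hg, h⟩ := h
  have hA : AnalyticAt ℂ (fun u : ℂ => a * u + b) z := by fun_prop
  refine ⟨fun u => a ^ n * g (a * u + b), analyticAt_const.mul (hg.comp_of_eq hA rfl), ?_⟩
  have ht : Tendsto (fun u => a * u + b) (nhdsWithin z {z}ᶜ)
      (nhdsWithin (a * z + b) {a * z + b}ᶜ) := by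
    refine tendsto_nhdsWithin_iff.2 ⟨hA.continuousAt.tendsto.mono_left nhdsWithin_le_nhds, ?_⟩
    filter_upwards [self_mem_nhdsWithin] with u hu
    simpa [ha] using hu
  filter_upwards [ht.eventually h] with u hu
  rw [hu, ← mul_assoc, ← mul_zpow]
  ring_nf

lemma comp_add {a : ℂ} (h : OrdGE f (z + a) n) : OrdGE (fun u => f (u + a)) z n := by
  have := comp_affine (a := 1) (b := a) (z := z) (f := f) (n := n) one_ne_zero (by simpa using h)
  simpa using this

lemma prod {ι : Type*} {s : Finset ι} {F : ι → ℂ → ℂ} {k : ι → ℤ}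
    (h : ∀ i ∈ s, OrdGE (F i) z (k i)) : OrdGE (fun u => ∏ i ∈ s, F i u) z (∑ i ∈ s, k i) := by
  classical
  induction s using Finset.induction_on with
  | empty => simpa using const 1 z
  | insert i s hi ih =>
    rw [Finset.sum_insert hi]
    refine ((h i (Finset.mem_insert_self i s)).mul
      (ih fun j hj => h j (Finset.mem_insert_of_mem hj))).congr (Eventually.of_forall fun u => ?_)
    rw [Finset.prod_insert hi]

end OrdGE

/-- Liouville's theorem for functions with period lattice `ℤ[i]` and removable singularities. -/
lemma exists_eq_const_of_periodic {f : ℂ → ℂ} (hper : ∀ u m, f (u + gi m) = f u)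
    (hord : ∀ z, OrdGE f z 0) :
    ∃ c, (∀ z, ∀ᶠ u in nhdsWithin z {z}ᶜ, f u = c) ∧ ∀ z, ContinuousAt f z → f z = c := by
  choose g hg h using hord
  simp only [zpow_zero, one_mul] at h
  have hlim (z) : Tendsto f (nhdsWithin z {z}ᶜ) (nhds (g z z)) :=
    ((hg z).continuousAt.tendsto.mono_left nhdsWithin_le_nhds).congr'
      ((h z).mono fun u hu => hu.symm)
  set F : ℂ → ℂ := fun z => g z z with hF
  have hloc (z) : F =ᶠ[nhds z] g z := by
    have h1 := eventually_eventually_nhdsWithin.2 (h z)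
    have h2 : ∀ᶠ u in nhdsWithin z {z}ᶜ, F u = g z u := by
      filter_upwards [h1, (hg z).eventually_analyticAt.filter_mono nhdsWithin_le_nhds,
        self_mem_nhdsWithin] with u hu hgu huz
      have h3 : ∀ᶠ v in nhdsWithin u {u}ᶜ, f v = g z v := by
        have h4 : ∀ᶠ v in nhds u, f v = g z v := by
          have hz : {z}ᶜ ∈ nhds u := isOpen_compl_singleton.mem_nhds huz
          rwa [nhdsWithin_eq_nhds.2 hz] at hu
        exact h4.filter_mono nhdsWithin_le_nhds
      refine tendsto_nhds_unique (hlim u) ?_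
      exact (hgu.continuousAt.tendsto.mono_left nhdsWithin_le_nhds).congr'
        (h3.mono fun v hv => hv.symm)
    rw [eventually_nhdsWithin_iff] at h2
    filter_upwards [h2] with u hu
    by_cases huz : u = z
    · rw [huz]
    · exact hu huz
  have hFd : Differentiable ℂ F := fun z =>
    ((hg z).differentiableAt).congr_of_eventuallyEq (hloc z)
  have hFper (u m) : F (u + gi m) = F u := by
    refine tendsto_nhds_unique (hlim (u + gi m)) ?_
    have h1 : Tendsto (fun v => v - gi m) (nhdsWithin (u + gi m) {u + gi m}ᶜ)
        (nhdsWithin u {u}ᶜ) := by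
      refine tendsto_nhdsWithin_iff.2 ⟨?_, ?_⟩
      · have : Continuous fun v : ℂ => v - gi m := by fun_prop
        simpa using (this.tendsto (u + gi m)).mono_left nhdsWithin_le_nhds
      · filter_upwards [self_mem_nhdsWithin] with v hv
        simp only [mem_compl_iff, mem_singleton_iff] at hv ⊢
        rwa [sub_eq_iff_eq_add]
    refine ((hlim u).comp h1).congr fun v => ?_
    rw [Function.comp_apply, ← hper (v - gi m) m, sub_add_cancel]
  have hb : Bornology.IsBounded (range F) := by
    have hK : IsCompact (Icc (0 : ℝ) 1 ×ℂ Icc (0 : ℝ) 1) := isCompact_Icc.reProdIm isCompact_Icc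
    refine (hK.image hFd.continuous).isBounded.subset ?_
    rintro _ ⟨u, rfl⟩
    refine ⟨u + gi (-⌊u.re⌋, -⌊u.im⌋), ?_, hFper _ _⟩
    rw [mem_reProdIm]
    simp only [add_re, add_im, gi_re, gi_im, Int.cast_neg]
    have := Int.floor_le u.re
    have := Int.lt_floor_add_one u.re
    have := Int.floor_le u.im
    have := Int.lt_floor_add_one u.im
    constructor <;> constructor <;> linarith
  obtain ⟨c, hc⟩ := hFd.exists_eq_const_of_bounded hb
  have hFc (z) : F z = c := congrFun hc z
  refine ⟨c, fun z => ?_, fun z hz => ?_⟩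
  · filter_upwards [h z, (hloc z).filter_mono nhdsWithin_le_nhds] with u h1 h2
    rw [h1, ← h2, hFc]
  · refine (tendsto_nhds_unique (hlim z) (hz.tendsto.mono_left nhdsWithin_le_nhds)).symm.trans ?_
    exact hFc z

lemma notMem_O4_iff {u : ℂ} : u ∉ O4 ↔ ∀ m, u + gi m ≠ 0 := by
  constructor
  · intro h m hm
    exact h (by rw [eq_neg_of_add_eq_zero_left hm]; exact neg_mem (gi_mem_O4 m))
  · intro h hu
    obtain ⟨m, hm⟩ := exists_gi (neg_mem hu)
    exact h m (by rw [hm, add_neg_cancel])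

lemma I_mul_mem_O4_iff {u : ℂ} : I * u ∈ O4 ↔ u ∈ O4 := by
  refine ⟨fun h => ?_, fun h => mul_mem I_mem_O4 h⟩
  have := neg_mem (mul_mem I_mem_O4 h)
  rwa [← mul_assoc, I_mul_I, neg_one_mul, neg_neg] at this

/-- The period pair `(1, i)`. -/
def sqPair : PeriodPair where
  ω₁ := 1
  ω₂ := I
  indep := by
    rw [LinearIndependent.pair_iff]
    intro s t h
    have h1 := congrArg re h
    have h2 := congrArg im h
    simp at h1 h2
    exact ⟨h1, h2⟩

lemma mem_sqPair_lattice {u : ℂ} : u ∈ sqPair.lattice ↔ u ∈ O4 := by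
  rw [PeriodPair.mem_lattice]
  constructor
  · rintro ⟨m, n, rfl⟩
    have := gi_mem_O4 (m, n)
    simpa [gi, sqPair] using this
  · intro h
    obtain ⟨m, rfl⟩ := exists_gi h
    exact ⟨m.1, m.2, by simp [gi, sqPair]⟩

lemma coe_sqPair_equiv (m : ℤ × ℤ) : (sqPair.latticeEquivProd.symm m : ℂ) = gi m := by
  rw [PeriodPair.latticeEquiv_symm_apply]
  simp [gi, sqPair]

/-- The Weierstrass function of the lattice `ℤ[i]`. -/
def wP (u : ℂ) : ℂ := sqPair.weierstrassP u

/-- The derivative of the Weierstrass function of the lattice `ℤ[i]`. -/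
def wP' (u : ℂ) : ℂ := sqPair.derivWeierstrassP u

lemma wP_add (u : ℂ) {l : ℂ} (hl : l ∈ O4) : wP (u + l) = wP u :=
  sqPair.weierstrassP_add_coe u ⟨l, mem_sqPair_lattice.2 hl⟩

lemma wP'_add (u : ℂ) {l : ℂ} (hl : l ∈ O4) : wP' (u + l) = wP' u :=
  sqPair.derivWeierstrassP_add_coe u ⟨l, mem_sqPair_lattice.2 hl⟩

lemma wP_neg (u : ℂ) : wP (-u) = wP u := sqPair.weierstrassP_neg u

lemma wP'_neg (u : ℂ) : wP' (-u) = -wP' u := sqPair.derivWeierstrassP_neg u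

lemma wP_eq_tsum (u : ℂ) : wP u = ∑' m, (1 / (u - gi m) ^ 2 - 1 / gi m ^ 2) := by
  rw [wP, PeriodPair.weierstrassP, ← sqPair.latticeEquivProd.symm.toEquiv.tsum_eq]
  simp only [LinearEquiv.coe_toEquiv, coe_sqPair_equiv]

lemma wP'_eq_tsum (u : ℂ) : wP' u = ∑' m, (-2) * ((u - gi m) ^ 3)⁻¹ := by
  rw [wP', PeriodPair.derivWeierstrassP, ← sqPair.latticeEquivProd.symm.toEquiv.tsum_eq, ← tsum_neg]
  simp only [LinearEquiv.coe_toEquiv, coe_sqPair_equiv, div_eq_mul_inv, neg_mul]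

lemma wP_I_mul (u : ℂ) : wP (I * u) = -wP u := by
  rw [wP_eq_tsum, wP_eq_tsum, ← rotI.tsum_eq, ← tsum_neg]
  refine tsum_congr fun m => ?_
  rw [gi_rotI, ← mul_sub, mul_pow, mul_pow, I_sq]
  simp only [one_div, mul_inv]
  norm_num
  ring

lemma wP'_I_mul (u : ℂ) : wP' (I * u) = I * wP' u := by
  rw [wP'_eq_tsum, wP'_eq_tsum, ← rotI.tsum_eq, ← tsum_mul_left]
  refine tsum_congr fun m => ?_
  rw [gi_rotI, ← mul_sub, mul_pow, mul_inv, I_pow_three, inv_neg, inv_I]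
  ring

lemma analyticAt_wP {u : ℂ} (hu : u ∉ O4) : AnalyticAt ℂ wP u :=
  sqPair.analyticOnNhd_weierstrassP u fun h => hu (mem_sqPair_lattice.1 h)

lemma deriv_wP (u : ℂ) : deriv wP u = wP' u := congrFun sqPair.deriv_weierstrassP u

lemma hasDerivAt_wP {u : ℂ} (hu : u ∉ O4) : HasDerivAt wP (wP' u) u :=
  deriv_wP u ▸ (analyticAt_wP hu).differentiableAt.hasDerivAt

lemma wP'_sq {u : ℂ} (hu : u ∉ O4) : wP' u ^ 2 = 4 * wP u ^ 3 - sqPair.g₂ * wP u := by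
  have h : sqPair.g₃ = 0 := by
    rw [PeriodPair.g₃, PeriodPair.G, ← sqPair.latticeEquivProd.symm.toEquiv.tsum_eq]
    simp only [LinearEquiv.coe_toEquiv, coe_sqPair_equiv]
    rw [tsum_eq_zero_of_rotI (c := -1) (by norm_num), mul_zero]
    intro m
    rw [gi_rotI, mul_pow, mul_inv, show (6 : ℕ) = 2 * 3 from rfl, pow_mul I, I_sq]
    norm_num
  have := sqPair.derivWeierstrassP_sq u fun h => hu (mem_sqPair_lattice.1 h)
  rw [h, sub_zero] at this
  exact this

lemma exists_wP_eq {l : ℂ} (hl : l ∈ O4) : ∃ g : ℂ → ℂ, AnalyticAt ℂ g l ∧ g l = 1 ∧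
    ∀ᶠ u in nhdsWithin l {l}ᶜ, wP u = (u - l) ^ (-2 : ℤ) * g u := by
  have hl' := mem_sqPair_lattice.2 hl
  refine ⟨fun z => (z - l) ^ 2 * sqPair.weierstrassPExcept l z + 1 - (z - l) ^ 2 / l ^ 2,
    ?_, by simp, ?_⟩
  · have := sqPair.analyticAt_weierstrassPExcept l
    fun_prop
  · filter_upwards [self_mem_nhdsWithin] with u hu
    have h1 := sqPair.ite_eq_one_sub_sq_mul_weierstrassP l hl' u
    have hu' : u ≠ l := hu
    rw [if_neg hu'] at h1
    rw [← h1, zpow_neg, zpow_ofNat, ← mul_assoc,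
      inv_mul_cancel₀ (pow_ne_zero 2 (sub_ne_zero.2 hu')), one_mul, wP]

lemma ordGE_wP {l : ℂ} (hl : l ∈ O4) : OrdGE wP l (-2) := by
  obtain ⟨g, h1, -, h2⟩ := exists_wP_eq hl
  exact ⟨g, h1, h2⟩

lemma EK_add (u : ℂ) {l : ℂ} (hl : l ∈ O4) : EK (u + l) = EK u := by
  obtain ⟨m, rfl⟩ := exists_gi hl
  exact EK_add_gi u m

lemma ω4_eq (m : ℤ × ℤ) : ω4 m = varpi * gi m := rfl

lemma wp4_mul (h : varpi ≠ 0) {u : ℂ} : wp4 (varpi * u) = (varpi ^ 2 : ℂ)⁻¹ * wP u := by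
  have hv : (varpi : ℂ) ≠ 0 := by exact_mod_cast h
  have hs := sqPair.hasSum_weierstrassP u
  rw [← sqPair.latticeEquivProd.symm.toEquiv.hasSum_iff] at hs
  have hs' : HasSum (fun m => 1 / (u - gi m) ^ 2 - 1 / gi m ^ 2) (wP u) :=
    hs.congr_fun_eq fun m => by
      rw [Function.comp_apply, LinearEquiv.coe_toEquiv, coe_sqPair_equiv]
  rw [wp4, ← hs'.tsum_eq, hs'.summable.tsum_eq_add_tsum_ite 0, mul_add, ← tsum_mul_left]
  congr 1
  · simp [gi, mul_pow]
    ring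
  · refine tsum_congr fun m => ?_
    split_ifs
    · simp
    · rw [ω4_eq, ← mul_sub, mul_pow, mul_pow, mul_inv, mul_inv, one_div, one_div, mul_sub]

lemma wp4'_mul (u : ℂ) : wp4' (varpi * u) = (varpi ^ 3 : ℂ)⁻¹ * wP' u := by
  rw [wp4', wP'_eq_tsum, ← tsum_mul_left]
  refine tsum_congr fun m => ?_
  rw [ω4_eq, ← mul_sub, mul_pow, mul_inv]
  ring

lemma Z4_eq (h : varpi ≠ 0) {u : ℂ} (hu : u ∉ O4) : Z4 u = (varpi : ℂ)⁻¹ * EK u := by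
  have hv : (varpi : ℂ) ≠ 0 := by exact_mod_cast h
  have hu' := notMem_O4_iff.1 hu
  have key : (∑' m : ℤ × ℤ, if m = 0 then 0 else
      ((varpi * u - ω4 m)⁻¹ + (ω4 m)⁻¹ + varpi * u * ((ω4 m) ^ 2)⁻¹)) =
      (varpi : ℂ)⁻¹ * ∑' m, u ^ 2 / (gi m ^ 2 * (u + gi m)) := by
    rw [← tsum_mul_left, ← (Equiv.neg (ℤ × ℤ)).tsum_eq]
    refine tsum_congr fun m => ?_
    have hn : gi (-m) = -gi m := by
      apply Complex.ext <;> simp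
    simp only [Equiv.neg_apply, neg_eq_zero]
    split_ifs with hm
    · simp [hm, gi]
    · have h1 : gi m ≠ 0 := fun h => hm (gi_eq_zero.1 h)
      have h2 := hu' m
      rw [ω4_eq, hn, mul_neg, sub_neg_eq_add, ← mul_add]
      field_simp
      ring
  rw [Z4, wzeta4, key, EK_eq hu']
  push_cast
  field_simp

/-- The regular part of `EK` at the origin. -/
def ekTail (u : ℂ) : ℂ := ∑' m, u ^ 2 / (gi m ^ 2 * (u + gi m))

lemma analyticAt_ekTail {z : ℂ} (hz : ∀ m ≠ 0, z + gi m ≠ 0) : AnalyticAt ℂ ekTail z := by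
  classical
  set R : ℝ := ‖z‖ + 1 with hR
  have hR0 : 0 < R := by positivity
  set s : Set (ℤ × ℤ) := {m | ‖gi m‖ < 2 * R} with hs
  have hsf : s.Finite := by
    have := tendsto_norm_gi.eventually_ge_atTop (2 * R)
    simpa [hs, Filter.Eventually, mem_cofinite, compl_def] using this
  set F : ℤ × ℤ → ℂ → ℂ := fun m u => u ^ 2 / (gi m ^ 2 * (u + gi m)) with hF
  have hsplit : ekTail = fun u => ∑ m ∈ hsf.toFinset, F m u +
      ∑' m, if m ∈ s then 0 else F m u := by
    ext u
    have h1 := (summable_zeta_term u).sum_add_tsum_compl (s := hsf.toFinset)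
    rw [ekTail, ← h1]
    congr 1
    refine (tsum_subtype ((hsf.toFinset : Set (ℤ × ℤ))ᶜ) (fun m => F m u)).trans ?_
    refine tsum_congr fun m => ?_
    simp only [indicator, hF, mem_compl_iff, SetLike.mem_coe, Finite.mem_toFinset, ite_not]
  rw [hsplit]
  refine AnalyticAt.add ?_ ?_
  · refine Finset.analyticAt_fun_sum _ fun m _ => ?_
    by_cases hm : m = 0
    · have : F m = fun _ => 0 := by
        ext u
        simp [hF, hm, gi]
      rw [this]
      exact analyticAt_const
    · have h1 : gi m ≠ 0 := fun h => hm (gi_eq_zero.1 h)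
      exact (analyticAt_id.pow 2).div
        (analyticAt_const.mul (analyticAt_id.add analyticAt_const))
        (mul_ne_zero (pow_ne_zero 2 h1) (hz m hm))
  · have hd : DifferentiableOn ℂ (fun u => ∑' m, if m ∈ s then 0 else F m u) (Metric.ball 0 R) := by
      refine differentiableOn_tsum_of_summable_norm
        (u := fun m => 2 * R ^ 2 * (‖gi m‖ ^ 3)⁻¹) (summable_norm_gi_inv_cube.mul_left _) ?_
        Metric.isOpen_ball ?_
      · intro m
        by_cases hm : m ∈ s
        · simp [hm]
        · simp only [hm, if_false]
          intro u hu
          have hm' : 2 * R ≤ ‖gi m‖ := not_lt.1 hm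
          have hu' : ‖u‖ < R := by simpa using hu
          have h1 : gi m ≠ 0 := by
            rw [← norm_pos_iff]
            linarith
          have h2 : u + gi m ≠ 0 := by
            intro h
            rw [eq_neg_of_add_eq_zero_left h, norm_neg] at hu'
            linarith
          exact ((analyticAt_id.pow 2).div
            (analyticAt_const.mul (analyticAt_id.add analyticAt_const))
            (mul_ne_zero (pow_ne_zero 2 h1) h2)).differentiableAt.differentiableWithinAt
      · intro m u hu
        by_cases hm : m ∈ s
        · simp only [hm, if_true, norm_zero]
          positivity
        · simp only [hm, if_false]
          have hm' : 2 * R ≤ ‖gi m‖ := not_lt.1 hm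
          have hu' : ‖u‖ < R := by simpa using hu
          have h1 : 0 < ‖gi m‖ := by linarith
          have h2 : ‖gi m‖ ≤ 2 * ‖u + gi m‖ := by
            have := norm_sub_le (u + gi m) u
            rw [add_sub_cancel_left] at this
            linarith
          have h3 : 0 < ‖u + gi m‖ := by linarith
          simp only [hF]
          rw [norm_div, norm_mul, norm_pow, norm_pow, ← div_eq_mul_inv,
            div_le_div_iff₀ (by positivity) (by positivity)]
          have h4 : ‖u‖ ^ 2 ≤ R ^ 2 := by gcongr
          calc ‖u‖ ^ 2 * ‖gi m‖ ^ 3 ≤ R ^ 2 * (‖gi m‖ ^ 2 * (2 * ‖u + gi m‖)) := by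
                rw [pow_succ ‖gi m‖ 2]
                gcongr
            _ = _ := by ring
    exact hd.analyticAt (Metric.isOpen_ball.mem_nhds (by simp [hR]))

lemma EK_eq_tail {u : ℂ} (hu : u ∉ O4) : EK u = u⁻¹ + ekTail u - Real.pi * (starRingEnd ℂ) u :=
  EK_eq (notMem_O4_iff.1 hu)

lemma eventually_notMem_O4 (z : ℂ) : ∀ᶠ u in nhdsWithin z {z}ᶜ, u ∉ O4 := by
  have h := sqPair.compl_lattice_sdiff_singleton_mem_nhds z
  filter_upwards [nhdsWithin_le_nhds h, self_mem_nhdsWithin] with u h1 h2 h3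
  exact h1 ⟨mem_sqPair_lattice.2 h3, h2⟩

/-- The analytic quasi-periodic function `EK u + π ū`. -/
def ekHol (u : ℂ) : ℂ := EK u + Real.pi * (starRingEnd ℂ) u

lemma ekHol_add (u : ℂ) {l : ℂ} (hl : l ∈ O4) :
    ekHol (u + l) = ekHol u + Real.pi * (starRingEnd ℂ) l := by
  rw [ekHol, EK_add u hl, ekHol, map_add]
  ring

lemma eventually_notMem_O4' {z : ℂ} (hz : z ∉ O4) : ∀ᶠ u in nhds z, u ∉ O4 := by
  have h := eventually_nhdsWithin_iff.1 (eventually_notMem_O4 z)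
  filter_upwards [h] with u hu
  by_cases huz : u = z
  · rwa [huz]
  · exact hu huz

lemma analyticAt_ekHol {z : ℂ} (hz : z ∉ O4) : AnalyticAt ℂ ekHol z := by
  have h0 : z ≠ 0 := fun h => hz (h ▸ zero_mem O4)
  have h1 : AnalyticAt ℂ (fun u => u⁻¹ + ekTail u) z :=
    (analyticAt_inv h0).add (analyticAt_ekTail fun m _ => notMem_O4_iff.1 hz m)
  refine h1.congr ?_
  filter_upwards [eventually_notMem_O4' hz] with u hu
  rw [ekHol, EK_eq_tail hu, sub_add_cancel]

lemma exists_ekHol_eq {l : ℂ} (hl : l ∈ O4) : ∃ g : ℂ → ℂ, AnalyticAt ℂ g l ∧ g l = 1 ∧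
    ∀ᶠ u in nhdsWithin l {l}ᶜ, ekHol u = (u - l) ^ (-1 : ℤ) * g u := by
  have ht : AnalyticAt ℂ ekTail (l - l) := by
    rw [sub_self]
    refine analyticAt_ekTail fun m hm => ?_
    rw [zero_add]
    exact fun h => hm (gi_eq_zero.1 h)
  have ht' : AnalyticAt ℂ (fun u => ekTail (u - l)) l :=
    ht.comp_of_eq (analyticAt_id.sub analyticAt_const) rfl
  refine ⟨fun u => 1 + (u - l) * (ekTail (u - l) + Real.pi * (starRingEnd ℂ) l), ?_, by simp, ?_⟩
  · fun_prop
  · filter_upwards [self_mem_nhdsWithin, eventually_notMem_O4 l] with u hu hu4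
    have hu0 : u - l ≠ 0 := sub_ne_zero.2 hu
    have h4 : u - l ∉ O4 := fun h => hu4 (by simpa using add_mem h hl)
    have : ekHol u = ekHol (u - l) + Real.pi * (starRingEnd ℂ) l := by
      rw [← ekHol_add _ hl, sub_add_cancel]
    rw [this, ekHol, EK_eq_tail h4, zpow_neg, zpow_one]
    field_simp
    ring

lemma ordGE_ekHol {l : ℂ} (hl : l ∈ O4) : OrdGE ekHol l (-1) := by
  obtain ⟨g, h1, -, h2⟩ := exists_ekHol_eq hl
  exact ⟨g, h1, h2⟩

lemma notMem_O4_of_two_mul {w : ℂ} (hw : 2 * w ∉ O4) : w ∉ O4 := fun h =>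
  hw (by rw [two_mul]; exact add_mem h h)

lemma tendsto_sub_punctured (z w : ℂ) :
    Tendsto (fun u => u - w) (nhdsWithin z {z}ᶜ) (nhdsWithin (z - w) {z - w}ᶜ) := by
  refine tendsto_nhdsWithin_iff.2 ⟨?_, ?_⟩
  · have : Continuous fun v : ℂ => v - w := by fun_prop
    exact (this.tendsto z).mono_left nhdsWithin_le_nhds
  · filter_upwards [self_mem_nhdsWithin] with v hv
    simpa [sub_left_inj] using hv

/-- The difference `EK (u + w) - EK (u - w) - 2 EK w` as a meromorphic function. -/
def ekDiff (w u : ℂ) : ℂ := ekHol (u + w) - ekHol (u - w) - 2 * ekHol w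

lemma ekDiff_eq (w u : ℂ) : ekDiff w u = EK (u + w) - EK (u - w) - 2 * EK w := by
  simp only [ekDiff, ekHol, map_add, map_sub]
  ring

lemma analyticAt_ekDiff {w u : ℂ} (h1 : u + w ∉ O4) (h2 : u - w ∉ O4) :
    AnalyticAt ℂ (ekDiff w) u := by
  have e1 : AnalyticAt ℂ (fun u => ekHol (u + w)) u :=
    (analyticAt_ekHol h1).comp_of_eq (analyticAt_id.add analyticAt_const) rfl
  have e2 : AnalyticAt ℂ (fun u => ekHol (u - w)) u :=
    (analyticAt_ekHol h2).comp_of_eq (analyticAt_id.sub analyticAt_const) rfl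
  exact (e1.sub e2).sub analyticAt_const

lemma analyticAt_wP_sub (c : ℂ) {u : ℂ} (hu : u ∉ O4) : AnalyticAt ℂ (fun u => wP u - c) u :=
  (analyticAt_wP hu).sub analyticAt_const

lemma OrdGE.wP_sub (c : ℂ) {u : ℂ} (hu : u ∈ O4) : OrdGE (fun u => wP u - c) u (-2) :=
  (ordGE_wP hu).sub ((OrdGE.const c u).mono (by norm_num))

lemma ordGE_ekDiff_two {w z : ℂ} (hz : z ∈ O4) (hw : w ∉ O4) : OrdGE (ekDiff w) z 2 := by
  have h1 : z + w ∉ O4 := fun h => hw (by simpa using sub_mem h hz)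
  have h2 : z - w ∉ O4 := fun h => hw (by simpa using sub_mem hz h)
  refine OrdGE.of_zero_deriv (analyticAt_ekDiff h1 h2) ?_ ?_
  · rw [ekDiff_eq, add_comm z, EK_add w hz, sub_eq_add_neg z, add_comm z, EK_add _ hz, EK_neg]
    ring
  · have hs (u : ℂ) : ekDiff w (2 * z - u) = ekDiff w u := by
      have hz2 : 2 * z ∈ O4 := by rw [two_mul]; exact add_mem hz hz
      rw [ekDiff_eq, ekDiff_eq, show 2 * z - u + w = -(u - w) + 2 * z by ring,
        show 2 * z - u - w = -(u + w) + 2 * z by ring, EK_add _ hz2, EK_add _ hz2, EK_neg, EK_neg]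
      ring
    have h3 := deriv_comp_const_sub (f := ekDiff w) (2 * z) z
    rw [show (fun u => ekDiff w (2 * z - u)) = ekDiff w from funext hs,
      show 2 * z - z = z by ring] at h3
    linear_combination h3 / 2

lemma exists_ekDiff_eq {w : ℂ} (hw : 2 * w ∉ O4) : ∃ k : ℂ → ℂ,
    Tendsto k (nhdsWithin w {w}ᶜ) (nhds (-1)) ∧
    ∀ᶠ u in nhdsWithin w {w}ᶜ, ekDiff w u = (u - w)⁻¹ * k u := by
  obtain ⟨g, hg, hg1, hge⟩ := exists_ekHol_eq (zero_mem O4)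
  have hww : w + w ∉ O4 := by rwa [← two_mul]
  have e1 : AnalyticAt ℂ (fun u => ekHol (u + w)) w :=
    (analyticAt_ekHol hww).comp_of_eq (analyticAt_id.add analyticAt_const) rfl
  have e2 : AnalyticAt ℂ (fun u => g (u - w)) w :=
    hg.comp_of_eq (analyticAt_id.sub analyticAt_const) (sub_self w)
  have e3 : AnalyticAt ℂ (fun u => (u - w) * (ekHol (u + w) - 2 * ekHol w) - g (u - w)) w :=
    ((analyticAt_id.sub analyticAt_const).mul (e1.sub analyticAt_const)).sub e2
  refine ⟨fun u => (u - w) * (ekHol (u + w) - 2 * ekHol w) - g (u - w), ?_, ?_⟩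
  · have h3 := e3.continuousAt.tendsto.mono_left (nhdsWithin_le_nhds (s := {w}ᶜ))
    simpa [hg1] using h3
  · have h4 := (tendsto_sub_punctured w w).eventually (by rw [sub_self]; exact hge)
    filter_upwards [h4, self_mem_nhdsWithin] with u hgu huw
    have h0 : u - w ≠ 0 := sub_ne_zero.2 huw
    rw [ekDiff, hgu, sub_zero, zpow_neg, zpow_one]
    field_simp
    ring

lemma wP_sub_mul_ekDiff_aux {w : ℂ} (hw : 2 * w ∉ O4) :
    (∀ z, ∀ᶠ u in nhdsWithin z {z}ᶜ, (wP u - wP w) * ekDiff w u = -wP' w) ∧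
    ∀ z, ContinuousAt (fun u => (wP u - wP w) * ekDiff w u) z →
      (wP z - wP w) * ekDiff w z = -wP' w := by
  have hw1 := notMem_O4_of_two_mul hw
  have hp1 {z : ℂ} (hz : z - w ∈ O4) : z + w ∉ O4 := fun h => hw (by
    convert! sub_mem h hz using 1; ring)
  obtain ⟨c, hc1, hc2⟩ := exists_eq_const_of_periodic
    (f := fun u => (wP u - wP w) * ekDiff w u) (fun u m => by
      have hm := gi_mem_O4 m
      rw [wP_add _ hm, ekDiff_eq, ekDiff_eq, show u + gi m + w = u + w + gi m by ring,
        show u + gi m - w = u - w + gi m by ring, EK_add _ hm, EK_add _ hm]) (fun z => by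
      by_cases hz : z ∈ O4
      · simpa using (OrdGE.wP_sub (wP w) hz).mul (ordGE_ekDiff_two hz hw1)
      by_cases hz1 : z - w ∈ O4
      · have hP : wP z - wP w = 0 := by
          rw [← wP_add w hz1, add_sub_cancel, sub_self]
        have h1 := OrdGE.of_zero (analyticAt_wP_sub (wP w) hz) hP
        have e1 : AnalyticAt ℂ (fun u => ekHol (u + w)) z :=
          (analyticAt_ekHol (hp1 hz1)).comp_of_eq (analyticAt_id.add analyticAt_const) rfl
        have e2 : OrdGE (fun u => ekHol (u - w)) z (-1) := by
          simpa only [← sub_eq_add_neg] using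
            OrdGE.comp_add (a := -w) (by rw [← sub_eq_add_neg]; exact ordGE_ekHol hz1)
        have h2 : OrdGE (ekDiff w) z (-1) :=
          (((OrdGE.of_analyticAt e1).mono (by norm_num)).sub e2).sub
            ((OrdGE.const _ z).mono (by norm_num))
        simpa using h1.mul h2
      by_cases hz2 : z + w ∈ O4
      · have hP : wP z - wP w = 0 := by
          rw [← wP_neg w, ← wP_add (-w) hz2, neg_add_cancel_comm_assoc, sub_self]
        have h1 := OrdGE.of_zero (analyticAt_wP_sub (wP w) hz) hP
        have e1 : AnalyticAt ℂ (fun u => ekHol (u - w)) z :=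
          (analyticAt_ekHol hz1).comp_of_eq (analyticAt_id.sub analyticAt_const) rfl
        have e2 : OrdGE (fun u => ekHol (u + w)) z (-1) := OrdGE.comp_add (ordGE_ekHol hz2)
        have h2 : OrdGE (ekDiff w) z (-1) :=
          (e2.sub ((OrdGE.of_analyticAt e1).mono (by norm_num))).sub
            ((OrdGE.const _ z).mono (by norm_num))
        simpa using h1.mul h2
      exact OrdGE.of_analyticAt ((analyticAt_wP_sub (wP w) hz).mul (analyticAt_ekDiff hz2 hz1)))
  obtain rfl : c = -wP' w := by
    obtain ⟨k, h2, h4⟩ := exists_ekDiff_eq hw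
    have h1 : Tendsto (fun u => (u - w)⁻¹ * (wP u - wP w)) (nhdsWithin w {w}ᶜ) (nhds (wP' w)) := by
      simpa only [slope_fun_def, vsub_eq_sub, smul_eq_mul] using
        hasDerivAt_iff_tendsto_slope.1 (hasDerivAt_wP hw1)
    have h3 := h1.mul h2
    rw [mul_neg_one] at h3
    refine tendsto_nhds_unique ?_ h3
    refine tendsto_const_nhds.congr' ?_
    filter_upwards [hc1 w, h4] with u hu hku
    rw [← hu, hku]
    ring
  exact ⟨hc1, hc2⟩

lemma wP_sub_mul_ekDiff {w u : ℂ} (hw : 2 * w ∉ O4) (hu : u ∉ O4) (h1 : u + w ∉ O4)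
    (h2 : u - w ∉ O4) : (wP u - wP w) * (EK (u + w) - EK (u - w) - 2 * EK w) = -wP' w := by
  rw [← ekDiff_eq]
  exact (wP_sub_mul_ekDiff_aux hw).2 u
    ((analyticAt_wP_sub _ hu).mul (analyticAt_ekDiff h1 h2)).continuousAt

lemma isPreconnected_compl_O4 : IsPreconnected {u : ℂ | u ∉ O4} := by
  have hc : ((O4 : Subring ℂ) : Set ℂ).Countable := by
    have : ((O4 : Subring ℂ) : Set ℂ) = range gi := by
      ext z
      exact ⟨fun h => exists_gi h, fun ⟨m, hm⟩ => hm ▸ gi_mem_O4 m⟩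
    rw [this]
    exact countable_range gi
  exact (hc.isConnected_compl_of_one_lt_rank (by
    rw [Complex.rank_real_complex]; norm_num)).isPreconnected

lemma wP'_ne_zero {w : ℂ} (hw : 2 * w ∉ O4) : wP' w ≠ 0 := by
  intro h0
  have hw1 := notMem_O4_of_two_mul hw
  have h := (wP_sub_mul_ekDiff_aux hw).1 w
  have hev : ∀ᶠ u in nhdsWithin w {w}ᶜ, wP u = wP w := by
    obtain ⟨k, h2, h4⟩ := exists_ekDiff_eq hw
    filter_upwards [h, h4, h2.eventually_ne (by norm_num : (-1 : ℂ) ≠ 0), self_mem_nhdsWithin]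
      with u hu hku hne huw
    have hu0 : u - w ≠ 0 := sub_ne_zero.2 huw
    rw [h0, neg_zero, mul_eq_zero, hku] at hu
    exact sub_eq_zero.1 (hu.resolve_right (mul_ne_zero (inv_ne_zero hu0) hne))
  have hA : AnalyticOnNhd ℂ wP {u : ℂ | u ∉ O4} := fun u hu => analyticAt_wP hu
  have hall := hA.eqOn_of_preconnected_of_frequently_eq (g := fun _ => wP w)
    (fun u _ => analyticAt_const) isPreconnected_compl_O4 hw1 hev.frequently
  obtain ⟨g, hg, hg1, hge⟩ := exists_wP_eq (zero_mem O4)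
  have h1 : Tendsto (fun u : ℂ => u ^ 2 * wP w) (nhdsWithin 0 {0}ᶜ) (nhds 0) := by
    have : ContinuousAt (fun u : ℂ => u ^ 2 * wP w) 0 := by fun_prop
    simpa using this.tendsto.mono_left (nhdsWithin_le_nhds (s := {0}ᶜ))
  have h2 : Tendsto g (nhdsWithin 0 {0}ᶜ) (nhds 1) := by
    simpa [hg1] using hg.continuousAt.tendsto.mono_left (nhdsWithin_le_nhds (s := {0}ᶜ))
  have h3 := tendsto_nhds_unique (h1.congr' (f₂ := g) (by
    filter_upwards [hge, eventually_notMem_O4 0, self_mem_nhdsWithin] with u hu h4 hu0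
    have h5 : wP u = wP w := hall h4
    have hu0' : u ≠ 0 := hu0
    rw [← h5, hu, sub_zero, zpow_neg, zpow_ofNat, ← mul_assoc,
      mul_inv_cancel₀ (pow_ne_zero 2 hu0'), one_mul])) h2
  exact zero_ne_one h3

lemma wP_ne {w u : ℂ} (hw : 2 * w ∉ O4) (hu : u ∉ O4) (h1 : u + w ∉ O4)
    (h2 : u - w ∉ O4) : wP u ≠ wP w := by
  intro h
  have := wP_sub_mul_ekDiff hw hu h1 h2
  rw [h, sub_self, zero_mul, eq_comm, neg_eq_zero] at this
  exact wP'_ne_zero hw this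

/-- The value of the Weierstrass function at the half period `1/2`. -/
def wE : ℂ := wP (1 / 2)

lemma wP'_half {h : ℂ} (hh : 2 * h ∈ O4) : wP' h = 0 := by
  have h1 := wP'_add (-h) hh
  rw [show -h + 2 * h = h by ring, wP'_neg] at h1
  linear_combination h1 / 2

lemma two_mul_half_mem : 2 * (1 / 2 : ℂ) ∈ O4 := by
  rw [mul_one_div_cancel two_ne_zero]; exact one_mem O4

lemma two_mul_I_half_mem : 2 * (I / 2 : ℂ) ∈ O4 := by
  rw [mul_div_cancel₀ _ two_ne_zero]; exact I_mem_O4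

lemma notMem_O4_of_re {z : ℂ} (h : 2 * z.re = 1) : z ∉ O4 := by
  intro hz
  obtain ⟨x, y, rfl⟩ := mem_O4_iff.1 hz
  simp at h
  have : 2 * x = 1 := by exact_mod_cast h
  omega

lemma notMem_O4_of_im {z : ℂ} (h : 2 * z.im = 1) : z ∉ O4 := by
  intro hz
  obtain ⟨x, y, rfl⟩ := mem_O4_iff.1 hz
  simp at h
  have : 2 * y = 1 := by exact_mod_cast h
  omega

lemma half_notMem : (1 / 2 : ℂ) ∉ O4 := notMem_O4_of_re (by simp)

lemma I_half_notMem : (I / 2 : ℂ) ∉ O4 := notMem_O4_of_im (by simp)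

lemma wP_I_half : wP (I / 2) = -wE := by
  rw [div_eq_mul_one_div, wP_I_mul, wE]

lemma wP_one_add_I_half : wP ((1 + I) / 2) = 0 := by
  have h1 := wP_I_mul ((1 + I) / 2)
  have h2 := wP_add (I * ((1 + I) / 2)) (one_mem O4)
  rw [show I * ((1 + I) / 2) + 1 = (1 + I) / 2 by linear_combination I_sq / 2, h1] at h2
  linear_combination h2 / 2

lemma wE_relation {u : ℂ} (hu : u ∉ O4) (hu1 : u + I / 2 ∉ O4) :
    (wP (u + I / 2) + wE) * (wP u + wE) = 2 * wE ^ 2 := by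
  have hI : I / 2 + I / 2 ∈ O4 := by rw [add_halves]; exact I_mem_O4
  have two {z : ℂ} (hz : z + I / 2 ∈ O4) : OrdGE (fun u => wP u + wE) z 2 := by
    have hz' : z ∉ O4 := fun h => I_half_notMem (by simpa using sub_mem hz h)
    have hzI : z - I / 2 ∈ O4 := by
      convert! sub_mem hz hI using 1; ring
    refine OrdGE.of_zero_deriv ((analyticAt_wP hz').add analyticAt_const) ?_ ?_
    · rw [← add_sub_cancel (I / 2) z, wP_add _ hzI, wP_I_half, neg_add_cancel]
    · rw [deriv_add_const, deriv_wP]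
      refine wP'_half ?_
      rw [two_mul]
      convert! add_mem hz hzI using 1; ring
  have mtwo {z : ℂ} (hz : z ∈ O4) : OrdGE (fun u => wP u + wE) z (-2) :=
    (ordGE_wP hz).add ((OrdGE.const _ z).mono (by norm_num))
  have zer {z : ℂ} (hz : z ∉ O4) : OrdGE (fun u => wP u + wE) z 0 :=
    OrdGE.of_analyticAt ((analyticAt_wP hz).add analyticAt_const)
  obtain ⟨c, -, hc⟩ := exists_eq_const_of_periodic
    (f := fun u => (wP (u + I / 2) + wE) * (wP u + wE)) (fun u m => by
      have hm := gi_mem_O4 m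
      rw [wP_add _ hm, show u + gi m + I / 2 = u + I / 2 + gi m by ring, wP_add _ hm]) (fun z => by
      by_cases hz : z ∈ O4
      · have h1 := OrdGE.comp_add (z := z) (a := I / 2) (two (by
          rw [add_assoc]; exact add_mem hz hI))
        simpa using h1.mul (mtwo hz)
      by_cases hz1 : z + I / 2 ∈ O4
      · simpa using (OrdGE.comp_add (mtwo hz1)).mul (two hz1)
      simpa using (OrdGE.comp_add (zer hz1)).mul (zer hz))
  have hcont {z : ℂ} (hz : z ∉ O4) (hz1 : z + I / 2 ∉ O4) :
      ContinuousAt (fun u => (wP (u + I / 2) + wE) * (wP u + wE)) z := by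
    have e1 : AnalyticAt ℂ (fun u => wP (u + I / 2)) z :=
      (analyticAt_wP hz1).comp_of_eq (analyticAt_id.add analyticAt_const) rfl
    exact ((e1.add analyticAt_const).mul ((analyticAt_wP hz).add analyticAt_const)).continuousAt
  have h1 := hc u (hcont hu hu1)
  have h2 := hc ((1 + I) / 2) (hcont (notMem_O4_of_re (by simp)) (notMem_O4_of_re (by simp)))
  rw [h1, ← h2, wP_one_add_I_half, show (1 + I) / 2 + I / 2 = 1 / 2 + I by ring, wP_add _ I_mem_O4,
    ← wE]
  ring

lemma wE_ne_zero : wE ≠ 0 := by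
  intro h0
  have h4 : (2 : ℂ) * (1 / 4) ∉ O4 := by
    rw [show (2 : ℂ) * (1 / 4) = 1 / 2 by norm_num]; exact half_notMem
  have h4' : (2 : ℂ) * (1 / 4 + I / 2) ∉ O4 := notMem_O4_of_re (by norm_num)
  have hz : ∀ u : ℂ, 2 * u ∉ O4 → wP u ≠ 0 := by
    intro u hu h
    have hl : 2 * ((1 + I) / 2) ∈ O4 := by
      rw [mul_div_cancel₀ _ two_ne_zero]; exact add_mem (one_mem O4) I_mem_O4
    refine wP_ne hu (u := (1 + I) / 2) (notMem_O4_of_re (by simp)) (fun h => hu ?_)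
      (fun h => hu ?_) (by rw [wP_one_add_I_half, h])
    · convert! sub_mem (add_mem h h) hl using 1; ring
    · convert! sub_mem hl (add_mem h h) using 1; ring
  have := wE_relation (notMem_O4_of_two_mul h4) (notMem_O4_of_two_mul h4')
  rw [h0, add_zero, add_zero, zero_pow two_ne_zero, mul_zero, mul_eq_zero] at this
  exact this.elim (hz _ h4') (hz _ h4)

lemma wP'_sq_eq {u : ℂ} (hu : u ∉ O4) : wP' u ^ 2 = 4 * wP u * (wP u ^ 2 - wE ^ 2) := by
  have h1 := wP'_sq half_notMem
  rw [wP'_half two_mul_half_mem, ← wE] at h1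
  have h2 : sqPair.g₂ = 4 * wE ^ 2 := by
    have : wE * (sqPair.g₂ - 4 * wE ^ 2) = 0 := by linear_combination h1
    exact sub_eq_zero.1 ((mul_eq_zero.1 this).resolve_left wE_ne_zero)
  rw [wP'_sq hu, h2]
  ring

lemma EK_add_half {u h : ℂ} (hu : 2 * u ∉ O4) (hh : 2 * h ∈ O4) (hh' : h ∉ O4) :
    wP h ≠ wP u ∧ 2 * (wP h - wP u) * (EK (u + h) - EK u) = -wP' u := by
  have e1 : h + u ∉ O4 := fun h' => hu (by
    convert! sub_mem (add_mem h' h') hh using 1; ring)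
  have e2 : h - u ∉ O4 := fun h' => hu (by
    convert! sub_mem hh (add_mem h' h') using 1; ring)
  refine ⟨wP_ne hu hh' e1 e2, ?_⟩
  have := wP_sub_mul_ekDiff hu hh' e1 e2
  rw [show h - u = -(u + h) + 2 * h by ring, EK_add _ hh, EK_neg, add_comm h u] at this
  linear_combination this

/-- The difference of the two half-period translates of `EK`. -/
def ekHalf (u : ℂ) : ℂ := EK (u + 1 / 2) - EK (u + I / 2)

lemma ekHalf_mul_wP' {u : ℂ} (hu : 2 * u ∉ O4) : ekHalf u * wP' u = 4 * wE * wP u := by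
  obtain ⟨n1, h1⟩ := EK_add_half hu two_mul_half_mem half_notMem
  obtain ⟨n2, h2⟩ := EK_add_half hu two_mul_I_half_mem I_half_notMem
  rw [wP_I_half] at n2 h2
  rw [← wE] at n1 h1
  have h3 := wP'_sq_eq (notMem_O4_of_two_mul hu)
  have n1 := sub_ne_zero.2 n1
  have n2 := sub_ne_zero.2 n2
  rw [ekHalf]
  apply mul_left_cancel₀ (mul_ne_zero n1 n2)
  linear_combination (1 / 2) * (-wE - wP u) * wP' u * h1 - (1 / 2) * (wE - wP u) * wP' u * h2
    + wE * h3

open Classical in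
/-- The order of vanishing of `ekHalf` at `z`. -/
def halfOrd (z : ℂ) : ℤ := if (1 + I) * z ∈ O4 then 1 else if 2 * z ∈ O4 then -1 else 0

lemma two_eq_mul : (2 : ℂ) = (1 - I) * (1 + I) := by linear_combination I_sq

lemma one_sub_I_mem : 1 - I ∈ O4 := sub_mem (one_mem O4) I_mem_O4

lemma two_mul_mem_of_one_add_I {z : ℂ} (h : (1 + I) * z ∈ O4) : 2 * z ∈ O4 := by
  rw [two_eq_mul, mul_assoc]
  exact mul_mem one_sub_I_mem h

lemma one_add_I_mul_add_half {z : ℂ} (hz : 2 * z ∈ O4) :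
    (1 + I) * (z + 1 / 2) ∈ O4 ↔ (1 + I) * z ∉ O4 := by
  have h0 : (1 + I) / 2 ∉ O4 := notMem_O4_of_re (by simp)
  constructor
  · intro h1 h2
    apply h0
    convert! sub_mem h1 h2 using 1; ring
  · intro h1
    obtain ⟨x, y, hxy⟩ := mem_O4_iff.1 hz
    have hz' : z = (x + y * I) / 2 := by linear_combination hxy / 2
    rcases Int.even_or_odd' (x + y) with ⟨k, hk | hk⟩
    · refine absurd (mem_O4_iff.2 ⟨x - k, k, ?_⟩) h1
      have hk' : (x : ℂ) + y = 2 * k := by exact_mod_cast hk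
      rw [hz']
      push_cast
      linear_combination (-(1 / 2) + I / 2) * hk' + y / 2 * I_sq
    · refine mem_O4_iff.2 ⟨x - k, k + 1, ?_⟩
      have hk' : (x : ℂ) + y = 2 * k + 1 := by exact_mod_cast hk
      rw [hz']
      push_cast
      linear_combination (-(1 / 2) + I / 2) * hk' + y / 2 * I_sq

lemma halfOrd_add (z : ℂ) {l : ℂ} (hl : l ∈ O4) : halfOrd (z + l) = halfOrd z := by
  have h1 : (1 + I) * l ∈ O4 := mul_mem one_add_I_mem hl
  have h2 : 2 * l ∈ O4 := by rw [two_mul]; exact add_mem hl hl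
  have e1 : (1 + I) * (z + l) ∈ O4 ↔ (1 + I) * z ∈ O4 := by
    rw [mul_add, add_mem_cancel_right h1]
  have e2 : 2 * (z + l) ∈ O4 ↔ 2 * z ∈ O4 := by rw [mul_add, add_mem_cancel_right h2]
  classical
  exact if_congr e1 rfl (if_congr e2 rfl rfl)

lemma two_mul_add_half {z : ℂ} : 2 * (z + 1 / 2) ∈ O4 ↔ 2 * z ∈ O4 := by
  rw [mul_add, add_mem_cancel_right two_mul_half_mem]

lemma halfOrd_add_half (z : ℂ) : halfOrd (z + 1 / 2) = -halfOrd z := by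
  by_cases h2 : 2 * z ∈ O4
  · have h3 := one_add_I_mul_add_half h2
    by_cases h1 : (1 + I) * z ∈ O4
    · rw [halfOrd, if_neg (by rwa [h3, not_not]), if_pos (two_mul_add_half.2 h2), halfOrd,
        if_pos h1]
    · rw [halfOrd, if_pos (h3.2 h1), halfOrd, if_neg h1, if_pos h2, neg_neg]
  · have h1 : (1 + I) * z ∉ O4 := fun h => h2 (two_mul_mem_of_one_add_I h)
    have h1' : (1 + I) * (z + 1 / 2) ∉ O4 := fun h =>
      h2 (two_mul_add_half.1 (two_mul_mem_of_one_add_I h))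
    rw [halfOrd, if_neg h1', if_neg (by rwa [two_mul_add_half]), halfOrd, if_neg h1, if_neg h2,
      neg_zero]

lemma halfOrd_ne_zero_iff {z : ℂ} : halfOrd z ≠ 0 ↔ 2 * z ∈ O4 := by
  rw [halfOrd]
  split_ifs with h1 h2
  · simpa using two_mul_mem_of_one_add_I h1
  · simpa using h2
  · simpa using h2

lemma halfOrd_mul {q z : ℂ} (hq : GCong q 1 2) (hz : 2 * z ∈ O4) : halfOrd (q * z) = halfOrd z := by
  obtain ⟨d, hd, hqd⟩ := hq
  have : q * z = z + d * (2 * z) := by linear_combination z * hqd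
  rw [this, halfOrd_add _ (mul_mem hd hz)]

lemma sum_halfOrd {ι : Type*} [Fintype ι] {q : ℂ} (hq0 : q ≠ 0) (hq : GCong q 1 2) {ρ : ι → ℂ}
    (hρ : IsRes q ρ) (z : ℂ) : ∑ i, halfOrd (z + ρ i / q) = halfOrd (q * z) := by
  obtain ⟨d, hd, hqd⟩ := id hq
  have hmul (i : ι) (hi : 2 * (z + ρ i / q) ∈ O4) : halfOrd (z + ρ i / q) = halfOrd (q * z) := by
    rw [← halfOrd_mul hq hi, mul_add, mul_div_cancel₀ _ hq0, halfOrd_add _ (hρ.mem i)]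
  by_cases hex : ∃ i, 2 * (z + ρ i / q) ∈ O4
  · obtain ⟨i, hi⟩ := hex
    rw [← hmul i hi]
    refine Finset.sum_eq_single i (fun j _ hji => ?_) (by simp)
    by_contra hj
    refine hji ?_
    have he := sub_mem (halfOrd_ne_zero_iff.1 hj) hi
    obtain ⟨e, hedef⟩ : ∃ e, e = 2 * (z + ρ j / q) - 2 * (z + ρ i / q) := ⟨_, rfl⟩
    rw [← hedef] at he
    have he1 : 2 * (ρ j - ρ i) = q * e := by
      rw [hedef]
      field_simp
      ring
    have hg : GCong (ρ j) (ρ i) q := ⟨ρ j - ρ i - d * e,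
      sub_mem (sub_mem (hρ.mem j) (hρ.mem i)) (mul_mem hd he), by
        linear_combination -d * he1 - (ρ j - ρ i) * hqd⟩
    exact (hρ.cover (ρ j) (hρ.mem j)).unique (GCong.refl _ _) hg
  · push Not at hex
    rw [Finset.sum_eq_zero fun i _ => by
      by_contra h
      exact hex i (halfOrd_ne_zero_iff.1 h)]
    by_contra h
    have he := halfOrd_ne_zero_iff.1 (Ne.symm h)
    obtain ⟨i, ⟨k, hk, hi⟩, -⟩ := hρ.cover (d * (2 * (q * z))) (mul_mem hd he)
    refine hex i ?_
    have : 2 * (z + ρ i / q) = 2 * (q * z) - 2 * k := by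
      have h1 : ρ i / q = 2 * (d * z) - k := by
        rw [div_eq_iff hq0]
        linear_combination -hi
      rw [h1]
      linear_combination -2 * z * hqd
    rw [this]
    exact sub_mem he (by rw [two_mul]; exact add_mem hk hk)

lemma EK_half {h : ℂ} (hh : 2 * h ∈ O4) : EK h = 0 := by
  have h1 := EK_add (-h) hh
  rw [show -h + 2 * h = h by ring, EK_neg] at h1
  linear_combination h1 / 2

lemma ekHalf_add (u : ℂ) {l : ℂ} (hl : l ∈ O4) : ekHalf (u + l) = ekHalf u := by
  rw [ekHalf, add_right_comm, EK_add _ hl, add_right_comm, EK_add _ hl, ekHalf]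

lemma ekHalf_eq_ekHol (u : ℂ) :
    ekHalf u = ekHol (u + 1 / 2) - ekHol (u + I / 2) - Real.pi * (1 + I) / 2 := by
  simp only [ekHalf, ekHol, map_add, map_div₀, map_one, conj_I, map_ofNat]
  ring

lemma ordGE_ekHol' (z : ℂ) : OrdGE ekHol z (-1) := by
  by_cases hz : z ∈ O4
  · exact ordGE_ekHol hz
  · exact (OrdGE.of_analyticAt (analyticAt_ekHol hz)).mono (by norm_num)

lemma analyticAt_ekHalf {z : ℂ} (h1 : z + 1 / 2 ∉ O4) (h2 : z + I / 2 ∉ O4) :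
    AnalyticAt ℂ ekHalf z := by
  rw [show ekHalf = _ from funext ekHalf_eq_ekHol]
  have e1 : AnalyticAt ℂ (fun u => ekHol (u + 1 / 2)) z :=
    (analyticAt_ekHol h1).comp_of_eq (analyticAt_id.add analyticAt_const) rfl
  have e2 : AnalyticAt ℂ (fun u => ekHol (u + I / 2)) z :=
    (analyticAt_ekHol h2).comp_of_eq (analyticAt_id.add analyticAt_const) rfl
  exact (e1.sub e2).sub analyticAt_const

lemma analyticAt_ekHalf' {z : ℂ} (hz : 2 * z ∉ O4) : AnalyticAt ℂ ekHalf z := by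
  refine analyticAt_ekHalf (fun h => hz ?_) (fun h => hz ?_)
  · convert! sub_mem (add_mem h h) (one_mem O4) using 1; ring
  · convert! sub_mem (add_mem h h) I_mem_O4 using 1; ring

lemma ordGE_ekHalf (z : ℂ) : OrdGE ekHalf z (halfOrd z) := by
  rw [halfOrd]
  split_ifs with h1 h2
  · have h3 := two_mul_mem_of_one_add_I h1
    refine OrdGE.of_zero (analyticAt_ekHalf (fun h => ?_) (fun h => ?_)) ?_
    · refine notMem_O4_of_re (z := (1 + I) / 2) (by simp) ?_
      convert! sub_mem (mul_mem one_add_I_mem h) h1 using 1; ring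
    · refine notMem_O4_of_im (z := (1 + I) * (I / 2)) (by simp) ?_
      convert! sub_mem (mul_mem one_add_I_mem h) h1 using 1; ring
    · rw [ekHalf, EK_half, EK_half, sub_zero]
      · rw [mul_add]; exact add_mem h3 two_mul_I_half_mem
      · rw [mul_add]; exact add_mem h3 two_mul_half_mem
  · refine (((OrdGE.comp_add (a := 1 / 2) (ordGE_ekHol' _)).sub
      (OrdGE.comp_add (a := I / 2) (ordGE_ekHol' _))).sub
        ((OrdGE.const (Real.pi * (1 + I) / 2) z).mono (by norm_num))).congr
          (Eventually.of_forall fun u => ekHalf_eq_ekHol u)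
  · exact OrdGE.of_analyticAt (analyticAt_ekHalf' h2)

lemma ekHalf_I_mul (u : ℂ) : ekHalf (I * u) = I * ekHalf u := by
  rw [ekHalf, show I * u + 1 / 2 = I * (u + I / 2 - I) by linear_combination I_sq / 2,
    show I * u + I / 2 = I * (u + 1 / 2) by ring, EK_I_mul, EK_I_mul, ekHalf, sub_eq_add_neg _ I,
    EK_add _ (neg_mem I_mem_O4)]
  ring

lemma eventually_affine_notMem {a : ℂ} (ha : a ≠ 0) (b z : ℂ) :
    ∀ᶠ u in nhdsWithin z {z}ᶜ, a * u + b ∉ O4 := by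
  have ht : Tendsto (fun u : ℂ => a * u + b) (nhdsWithin z {z}ᶜ)
      (nhdsWithin (a * z + b) {a * z + b}ᶜ) := by
    refine tendsto_nhdsWithin_iff.2 ⟨?_, ?_⟩
    · have : Continuous fun u : ℂ => a * u + b := by fun_prop
      exact (this.tendsto z).mono_left nhdsWithin_le_nhds
    · filter_upwards [self_mem_nhdsWithin] with u hu h
      exact hu (mul_left_cancel₀ ha (add_right_cancel h))
  exact ht.eventually (eventually_notMem_O4 _)

/-- The point `(1 + i)⁻³`. -/
def lamInv : ℂ := -(1 + I) / 4

lemma two_mul_lamInv_notMem : 2 * lamInv ∉ O4 := by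
  intro h
  refine notMem_O4_of_re (z := -(2 * lamInv)) ?_ (neg_mem h)
  simp [lamInv]
  norm_num

lemma lamInv_notMem : lamInv ∉ O4 := notMem_O4_of_two_mul two_mul_lamInv_notMem

lemma wP_lamInv_sq : wP lamInv ^ 2 = -wE ^ 2 := by
  have e : lamInv + I / 2 = -(I * lamInv) := by
    rw [lamInv]
    linear_combination -I_sq / 4
  have h2 : lamInv + I / 2 ∉ O4 := by
    rw [e, neg_mem_iff, I_mul_mem_O4_iff]
    exact lamInv_notMem
  have h := wE_relation lamInv_notMem h2
  rw [e, wP_neg, wP_I_mul] at h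
  linear_combination -h

lemma wP'_lamInv_sq : wP' lamInv ^ 2 = -8 * wP lamInv * wE ^ 2 := by
  rw [wP'_sq_eq lamInv_notMem, wP_lamInv_sq]
  ring

lemma wP_lamInv_ne_zero : wP lamInv ≠ 0 := by
  intro h
  have := wP_lamInv_sq
  rw [h] at this
  exact wE_ne_zero (by simpa using this)

lemma norm_wP_lamInv : ‖wP lamInv‖ = ‖wE‖ := by
  have := congrArg norm wP_lamInv_sq
  rw [norm_neg, norm_pow, norm_pow] at this
  exact (sq_eq_sq₀ (norm_nonneg _) (norm_nonneg _)).1 this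

lemma ekHalf_lamInv_sq : ekHalf lamInv ^ 2 = -2 * wP lamInv := by
  have h := ekHalf_mul_wP' two_mul_lamInv_notMem
  have h1 : ekHalf lamInv ^ 2 * wP' lamInv ^ 2 = 16 * wE ^ 2 * wP lamInv ^ 2 := by
    rw [← mul_pow, h]; ring
  rw [wP'_lamInv_sq] at h1
  have h2 : -8 * wP lamInv * wE ^ 2 ≠ 0 :=
    mul_ne_zero (mul_ne_zero (by norm_num) wP_lamInv_ne_zero) (pow_ne_zero _ wE_ne_zero)
  refine mul_right_cancel₀ h2 ?_
  rw [h1]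
  ring

lemma exists_ekHalf_mul_eq : ∃ c : ℂ, ‖c‖ = 2 * ‖wE‖ ∧
    ∀ u, 2 * u ∉ O4 → ekHalf u * ekHalf (u + 1 / 2) = c := by
  obtain ⟨c, -, hc⟩ := exists_eq_const_of_periodic (f := fun u => ekHalf u * ekHalf (u + 1 / 2))
    (fun u m => by
      rw [add_right_comm, ekHalf_add _ (gi_mem_O4 m), ekHalf_add _ (gi_mem_O4 m)])
    (fun z => by
      have h := (ordGE_ekHalf z).mul (OrdGE.comp_add (a := 1 / 2) (ordGE_ekHalf _))
      rwa [halfOrd_add_half, add_neg_cancel] at h)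
  have hc' (u : ℂ) (hu : 2 * u ∉ O4) : ekHalf u * ekHalf (u + 1 / 2) = c := by
    refine hc u (((analyticAt_ekHalf' hu).mul ?_).continuousAt)
    have hu' : 2 * (u + 1 / 2) ∉ O4 := by rwa [two_mul_add_half]
    exact (analyticAt_ekHalf' hu').comp_of_eq (analyticAt_id.add analyticAt_const) rfl
  refine ⟨c, ?_, hc'⟩
  have h := hc' lamInv two_mul_lamInv_notMem
  rw [show lamInv + 1 / 2 = I * lamInv by rw [lamInv]; linear_combination I_sq / 4,
    ekHalf_I_mul] at h
  rw [← h, show ekHalf lamInv * (I * ekHalf lamInv) = I * ekHalf lamInv ^ 2 by ring,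
    ekHalf_lamInv_sq]
  simp [norm_wP_lamInv]

namespace QDatum

variable {p : ℕ} {π : ℂ} {χ : ℂ → ℂ}

lemma gcong_one_two (h : QDatum p π χ) : GCong π 1 2 := by
  obtain ⟨d, hd, hp⟩ := h.primary
  refine ⟨d * (I - 1), mul_mem hd (sub_mem I_mem_O4 (one_mem _)), ?_⟩
  rw [hp, lam_eq]
  ring

lemma gcong_zero_of_two_mul (h : QDatum p π χ) {z : ℂ} (hz : z ∈ O4)
    (h2 : 2 * (z / π) ∈ O4) : GCong z 0 π := by
  obtain ⟨d, hd, hp⟩ := h.gcong_one_two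
  refine ⟨z - d * (2 * (z / π)), sub_mem hz (mul_mem hd h2), ?_⟩
  have := h.ne_zero
  have e : z / π * π = z := div_mul_cancel₀ _ this
  linear_combination 2 * d * e - z * hp

lemma norm_prod_ekHalf (h : QDatum p π χ) [Fact p.Prime] :
    ‖∏ r ∈ Finset.univ.erase (0 : ZMod p), ekHalf (((r.val : ℕ) : ℂ) / π)‖ ^ 2 =
      p * (2 * ‖wE‖) ^ (p - 1) := by
  obtain ⟨c, hcn, hc⟩ := exists_ekHalf_mul_eq
  have h0 := h.ne_zero
  obtain ⟨d, hd, hpd⟩ := h.gcong_one_two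
  have hres := h.isRes
  have hc0 : c ≠ 0 := by
    rw [← norm_ne_zero_iff, hcn]
    exact mul_ne_zero two_ne_zero (norm_ne_zero_iff.2 wE_ne_zero)
  set ρ : ZMod p → ℂ := fun r => ((r.val : ℕ) : ℂ) with hρ
  obtain ⟨K, hK, -⟩ := exists_eq_const_of_periodic
    (f := fun u => ekHalf (π * u + 0) * ∏ r, ekHalf (u + (ρ r / π + 1 / 2)))
    (fun u m => by
      have hm := gi_mem_O4 m
      rw [show π * (u + gi m) + 0 = π * u + 0 + π * gi m by ring,
        ekHalf_add _ (mul_mem h.mem hm)]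
      congr 1
      refine Finset.prod_congr rfl fun r _ => ?_
      rw [add_right_comm, ekHalf_add _ hm])
    (fun z => by
      have h1 := (OrdGE.comp_affine (b := 0) (z := z) h0 (ordGE_ekHalf _)).mul
        (OrdGE.prod (s := Finset.univ) fun r _ =>
          OrdGE.comp_add (a := ρ r / π + 1 / 2) (z := z) (ordGE_ekHalf _))
      have h2 : halfOrd (π * z + 0) + ∑ r, halfOrd (z + (ρ r / π + 1 / 2)) = 0 := by
        simp only [← add_assoc, halfOrd_add_half, Finset.sum_neg_distrib, add_zero]
        rw [sum_halfOrd h0 h.gcong_one_two hres, add_neg_cancel]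
      rwa [h2] at h1)
  simp only [add_zero] at hK
  have hval {u : ℂ} (hu : 2 * (π * u) ∉ O4) (r : ZMod p) : 2 * (u + ρ r / π) ∉ O4 := by
    intro hr
    refine hu ?_
    have e : 2 * (π * u) = π * (2 * (u + ρ r / π)) - 2 * ρ r := by
      field_simp
      ring
    rw [e]
    exact sub_mem (mul_mem h.mem hr) (by rw [two_mul]; exact add_mem (hres.mem r) (hres.mem r))
  have hK2 : K ^ 2 = c ^ (p + 1) := by
    have ht : Tendsto (fun u : ℂ => u + 1 / 2) (nhdsWithin 0 {0}ᶜ)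
        (nhdsWithin (1 / 2) {1 / 2}ᶜ) := by
      simpa using tendsto_sub_punctured 0 (-(1 / 2))
    obtain ⟨u, hu1, hu2, hu3⟩ := ((hK 0).and ((ht.eventually (hK (1 / 2))).and
      (eventually_affine_notMem (a := 2 * π) (mul_ne_zero two_ne_zero h0) 0 0))).exists
    rw [add_zero, mul_assoc] at hu3
    rw [sq]
    nth_rw 1 [← hu1]
    rw [← hu2, mul_mul_mul_comm, ← Finset.prod_mul_distrib,
      show π * (u + 1 / 2) = π * u + 1 / 2 + d by linear_combination hpd / 2,
      ekHalf_add _ hd, hc _ hu3, pow_succ', Finset.prod_congr rfl (g := fun _ => c)]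
    · simp [ZMod.card]
    · intro r _
      have hr : 2 * (u + ρ r / π + 1 / 2) ∉ O4 := by
        rw [two_mul_add_half]; exact hval hu3 r
      rw [← hc _ hr]
      congr 2 <;> ring
  have hlim : K = π * c * ∏ r ∈ Finset.univ.erase (0 : ZMod p), ekHalf (ρ r / π + 1 / 2) := by
    have o1 := ordGE_ekHalf 0
    have o2 := ordGE_ekHalf (0 + 1 / 2)
    rw [halfOrd_add_half] at o2
    have e0 : halfOrd 0 = 1 := by rw [halfOrd, if_pos (by simp)]
    rw [e0] at o1 o2
    have o3 := OrdGE.comp_add (a := 1 / 2) o2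
    obtain ⟨k, hk, hke⟩ := o1
    obtain ⟨g, hg, hge⟩ := o3
    have tk : Tendsto k (nhdsWithin 0 {0}ᶜ) (nhds (k 0)) :=
      hk.continuousAt.tendsto.mono_left nhdsWithin_le_nhds
    have tg : Tendsto g (nhdsWithin 0 {0}ᶜ) (nhds (g 0)) :=
      hg.continuousAt.tendsto.mono_left nhdsWithin_le_nhds
    have tm : Tendsto (fun u : ℂ => π * u) (nhdsWithin 0 {0}ᶜ) (nhdsWithin 0 {0}ᶜ) := by
      refine tendsto_nhdsWithin_iff.2 ⟨?_, ?_⟩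
      · have : Continuous fun u : ℂ => π * u := by fun_prop
        have := (this.tendsto 0).mono_left (nhdsWithin_le_nhds (s := {0}ᶜ))
        rwa [mul_zero] at this
      · filter_upwards [self_mem_nhdsWithin] with u hu
        exact mul_ne_zero h0 hu
    have hkg : k 0 * g 0 = c := by
      refine tendsto_nhds_unique_of_eventuallyEq (tk.mul tg) tendsto_const_nhds ?_
      filter_upwards [hke, hge, eventually_affine_notMem two_ne_zero 0 0, self_mem_nhdsWithin]
        with u h1 h2 h3 h4
      have h4 : u ≠ 0 := h4
      rw [add_zero] at h3
      rw [← hc u h3, h1, h2]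
      simp only [sub_zero, zpow_one, zpow_neg]
      field_simp
    have tprod : Tendsto (fun u => ∏ r ∈ Finset.univ.erase (0 : ZMod p),
        ekHalf (u + (ρ r / π + 1 / 2))) (nhdsWithin 0 {0}ᶜ)
        (nhds (∏ r ∈ Finset.univ.erase (0 : ZMod p), ekHalf (0 + (ρ r / π + 1 / 2)))) := by
      refine tendsto_finsetProd _ fun r hr => ?_
      have hr0 : 2 * (0 + (ρ r / π + 1 / 2)) ∉ O4 := by
        rw [zero_add, two_mul_add_half]
        exact fun hm => h.val_ne_zero (Finset.ne_of_mem_erase hr)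
          (h.gcong_zero_of_two_mul (hres.mem r) hm)
      have ha : AnalyticAt ℂ (fun u => ekHalf (u + (ρ r / π + 1 / 2))) 0 :=
        (analyticAt_ekHalf' hr0).comp_of_eq (analyticAt_id.add analyticAt_const) rfl
      exact ha.continuousAt.tendsto.mono_left nhdsWithin_le_nhds
    simp only [zero_add] at tprod
    have hlim := (((tk.comp tm).const_mul π).mul tg).mul tprod
    rw [mul_assoc π, hkg] at hlim
    refine tendsto_nhds_unique_of_eventuallyEq tendsto_const_nhds hlim ?_
    filter_upwards [hK 0, tm.eventually hke, hge, self_mem_nhdsWithin] with u h1 h2 h3 h4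
    have h4 : u ≠ 0 := h4
    rw [← h1, ← Finset.mul_prod_erase _ _ (Finset.mem_univ (0 : ZMod p)), h2]
    have : ρ 0 / π = 0 := by simp [hρ]
    rw [this, zero_add, h3]
    simp only [sub_zero, zpow_one, zpow_neg, Function.comp]
    generalize ∏ r ∈ Finset.univ.erase (0 : ZMod p), ekHalf (u + (ρ r / π + 1 / 2)) = R
    field_simp
  have hprod : (∏ r ∈ Finset.univ.erase (0 : ZMod p), ekHalf (ρ r / π)) *
      ∏ r ∈ Finset.univ.erase (0 : ZMod p), ekHalf (ρ r / π + 1 / 2) = c ^ (p - 1) := by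
    rw [← Finset.prod_mul_distrib, Finset.prod_congr rfl (g := fun _ => c)]
    · simp [ZMod.card]
    · intro r hr
      exact hc _ fun hm => h.val_ne_zero (Finset.ne_of_mem_erase hr)
        (h.gcong_zero_of_two_mul (hres.mem r) hm)
  set P := ∏ r ∈ Finset.univ.erase (0 : ZMod p), ekHalf (ρ r / π)
  set Q := ∏ r ∈ Finset.univ.erase (0 : ZMod p), ekHalf (ρ r / π + 1 / 2)
  obtain ⟨n, rfl⟩ : ∃ n, p = n + 1 := ⟨p - 1, by have := h.five_le; omega⟩
  rw [Nat.add_sub_cancel] at hprod ⊢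
  have key : c ^ (n + 2) * P ^ 2 = c ^ (n + 2) * (π ^ 2 * c ^ n) := by
    rw [← hK2, hlim]
    have : (π * c * Q) ^ 2 * P ^ 2 = (π * c) ^ 2 * (P * Q) ^ 2 := by ring
    rw [this, hprod, ← hlim, hK2]
    ring
  have key1 : P ^ 2 = π ^ 2 * c ^ n := mul_left_cancel₀ (pow_ne_zero _ hc0) key
  have key2 := congrArg (fun z : ℂ => ‖z‖) key1
  rw [norm_pow, norm_mul, norm_pow, norm_pow, hcn] at key2
  rw [key2, ← h.normSq_eq, normSq_eq_norm_sq]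

end QDatum

lemma I_pow_mem (k : ℕ) : I ^ k ∈ ({1, -1, I, -I} : Set ℂ) := by
  have h : (I ^ k) ^ 4 = 1 := by rw [← pow_mul, mul_comm, pow_mul, I_pow_four, one_pow]
  simpa using eq_of_pow_four h

lemma exists_I_pow {ε : ℂ} (h : ε ∈ ({1, -1, I, -I} : Set ℂ)) : ∃ k : Fin 4, I ^ (k : ℕ) = ε := by
  rcases h with rfl | rfl | rfl | rfl
  · exact ⟨0, by simp⟩
  · exact ⟨2, by simp⟩
  · exact ⟨1, by simp⟩
  · exact ⟨3, by simp [pow_succ]⟩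

lemma I_pow_fin_injective : Function.Injective fun k : Fin 4 => I ^ (k : ℕ) := by
  have h1 : I ≠ 1 := fun h => by simpa using congrArg im h
  have h2 : I ≠ -1 := fun h => by simpa using congrArg im h
  have h3 : I ≠ -I := fun h => by simpa [eq_neg_iff_add_eq_zero] using congrArg im h
  have h4 : (1 : ℂ) ≠ -1 := by norm_num
  have h5 : (1 : ℂ) ≠ -I := fun h => by simpa using congrArg im h
  have h6 : (-1 : ℂ) ≠ -I := fun h => by simpa using congrArg im h
  intro i j hij
  fin_cases i <;> fin_cases j <;> simp_all [pow_succ, eq_comm]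

namespace QDatum

variable {p : ℕ} {π : ℂ} {χ : ℂ → ℂ}

lemma prod_quarterSet (h : QDatum p π χ) [Fact p.Prime] {S : Finset ℂ} (hS : IsQuarterSet π S)
    {F : ℂ → ℝ} (hF : ∀ a ∈ O4, ∀ b ∈ O4, GCong a b π → F a = F b) (hI : ∀ z, F (I * z) = F z) :
    ∏ r ∈ Finset.univ.erase (0 : ZMod p), F ((r.val : ℕ) : ℂ) = (∏ ν ∈ S, F ν) ^ 4 := by
  obtain ⟨hS1, hS2, hS3⟩ := hS
  have hres := h.isRes
  have hpow (k : ℕ) (z : ℂ) : F (I ^ k * z) = F z := by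
    induction k with
    | zero => simp
    | succ k ih => rw [pow_succ', mul_assoc, hI, ih]
  have hmem (x : ℂ × Fin 4) (hx : x ∈ S ×ˢ (Finset.univ : Finset (Fin 4))) :
      I ^ (x.2 : ℕ) * x.1 ∈ O4 :=
    mul_mem (pow_mem I_mem_O4 _) (hS1 _ (Finset.mem_product.1 hx).1).1
  have hprod : (∏ ν ∈ S, F ν) ^ 4 =
      ∏ x ∈ S ×ˢ (Finset.univ : Finset (Fin 4)), F (I ^ (x.2 : ℕ) * x.1) := by
    rw [Finset.prod_product, ← Finset.prod_pow]
    refine Finset.prod_congr rfl fun ν _ => ?_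
    simp [hpow]
  rw [hprod]
  symm
  refine Finset.prod_bij (fun x hx => (hres.cover _ (hmem x hx)).choose) (fun x hx => ?_)
    (fun x hx y hy hxy => ?_) (fun r hr => ?_) (fun x hx => ?_)
  · refine Finset.mem_erase.2 ⟨fun h0 => ?_, Finset.mem_univ _⟩
    have h1 := (hres.cover _ (hmem x hx)).choose_spec.1
    simp only at h1
    rw [h0] at h1
    have hx1 := hS1 _ (Finset.mem_product.1 hx).1
    refine (h.not_gcong_zero_iff hx1.1).1 hx1.2 ?_
    obtain ⟨d, hd, h1⟩ := h1
    have e4 : (I ^ (x.2 : ℕ)) ^ 4 = 1 := by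
      rw [← pow_mul, mul_comm, pow_mul, I_pow_four, one_pow]
    refine ⟨(I ^ (x.2 : ℕ)) ^ 3 * d, mul_mem (pow_mem (pow_mem I_mem_O4 _) _) hd, ?_⟩
    rw [ZMod.val_zero, Nat.cast_zero] at h1
    linear_combination (I ^ (x.2 : ℕ)) ^ 3 * h1 - x.1 * e4
  · have h1 := (hres.cover _ (hmem x hx)).choose_spec.1
    have h2 := (hres.cover _ (hmem y hy)).choose_spec.1
    simp only at h1 h2 hxy
    rw [← hxy] at h2
    obtain ⟨e1, e2⟩ := hS3 _ (Finset.mem_product.1 hx).1 _ (Finset.mem_product.1 hy).1 _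
      (I_pow_mem x.2) _ (I_pow_mem y.2) (h1.trans h2.symm)
    exact Prod.ext e1 (I_pow_fin_injective e2)
  · have hr0 := h.val_ne_zero (Finset.ne_of_mem_erase hr)
    obtain ⟨ν, hν, ε, hε, hg⟩ := hS2 _ (hres.mem r) ((h.not_gcong_zero_iff (hres.mem r)).2 hr0)
    obtain ⟨k, rfl⟩ := exists_I_pow hε
    refine ⟨(ν, k), by simpa using hν, ?_⟩
    have hx : (ν, k) ∈ S ×ˢ (Finset.univ : Finset (Fin 4)) := by simpa using hν
    exact ((hres.cover _ (hmem _ hx)).choose_spec.2 r hg.symm).symm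
  · exact hF _ (hmem x hx) _ (hres.mem _) (hres.cover _ (hmem x hx)).choose_spec.1

lemma norm_prod_quarterSet (h : QDatum p π χ) [Fact p.Prime] {S : Finset ℂ}
    (hS : IsQuarterSet π S) :
    (∏ ν ∈ S, ‖ekHalf (ν / π)‖) ^ 8 = p * (2 * ‖wE‖) ^ (p - 1) := by
  rw [← h.norm_prod_ekHalf, norm_prod, h.prod_quarterSet hS (F := fun z => ‖ekHalf (z / π)‖),
    ← pow_mul]
  · rintro a - b - ⟨d, hd, hab⟩
    have : a / π = b / π + d := by
      have := h.ne_zero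
      field_simp
      linear_combination hab
    rw [this, ekHalf_add _ hd]
  · intro z
    rw [mul_div_assoc, ekHalf_I_mul, norm_mul, norm_I, one_mul]

lemma card_quarterSet (h : QDatum p π χ) [Fact p.Prime] {S : Finset ℂ}
    (hS : IsQuarterSet π S) : p - 1 = 4 * S.card := by
  have := h.prod_quarterSet hS (F := fun _ => 2) (fun _ _ _ _ _ => rfl) fun _ => rfl
  simp only [Finset.prod_const, Finset.card_erase_of_mem (Finset.mem_univ _), Finset.card_univ,
    ZMod.card, ← pow_mul] at this
  have := pow_right_injective₀ (by norm_num : (0 : ℝ) < 2) (by norm_num) this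
  omega

end QDatum

/-- Complex conjugation on the index set of the Gaussian integers. -/
def conjZ : ℤ × ℤ ≃ ℤ × ℤ := Equiv.prodCongr (Equiv.refl ℤ) (Equiv.neg ℤ)

lemma gi_conjZ (m : ℤ × ℤ) : gi (conjZ m) = (starRingEnd ℂ) (gi m) := by
  apply Complex.ext <;> simp [conjZ]

lemma wP_conj (u : ℂ) : wP ((starRingEnd ℂ) u) = (starRingEnd ℂ) (wP u) := by
  rw [wP_eq_tsum, wP_eq_tsum, conj_tsum, ← conjZ.tsum_eq]
  refine tsum_congr fun m => ?_
  rw [gi_conjZ]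
  simp

lemma wP'_conj (u : ℂ) : wP' ((starRingEnd ℂ) u) = (starRingEnd ℂ) (wP' u) := by
  rw [wP'_eq_tsum, wP'_eq_tsum, conj_tsum, ← conjZ.tsum_eq]
  refine tsum_congr fun m => ?_
  rw [gi_conjZ]
  simp only [map_mul, map_neg, map_inv₀, map_pow, map_sub, map_ofNat]

lemma wP_ofReal (x : ℝ) : ((wP x).re : ℂ) = wP x := by
  rw [← conj_eq_iff_re, ← wP_conj, conj_ofReal]

lemma wP'_ofReal (x : ℝ) : ((wP' x).re : ℂ) = wP' x := by
  rw [← conj_eq_iff_re, ← wP'_conj, conj_ofReal]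

lemma wE_ofReal : (wE.re : ℂ) = wE := by
  have := wP_ofReal (1 / 2)
  rw [wE]
  push_cast at this
  exact this

lemma ofReal_notMem {x : ℝ} (h0 : 0 < x) (h1 : x < 1) : (x : ℂ) ∉ O4 := by
  intro h
  obtain ⟨m, n, hmn⟩ := mem_O4_iff.1 h
  have : x = m := by simpa using congrArg re hmn
  rw [this] at h0 h1
  have h0' : 0 < m := by exact_mod_cast h0
  have h1' : m < 1 := by exact_mod_cast h1
  omega

lemma hasDerivAt_wP_re {x : ℝ} (h0 : 0 < x) (h1 : x < 1) :
    HasDerivAt (fun x : ℝ => (wP x).re) (wP' x).re x :=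
  (hasDerivAt_wP (ofReal_notMem h0 h1)).real_of_complex

lemma wP'_re_sq {x : ℝ} (h0 : 0 < x) (h1 : x < 1) :
    (wP' x).re ^ 2 = 4 * (wP x).re * ((wP x).re ^ 2 - wE.re ^ 2) := by
  have h := wP'_sq_eq (ofReal_notMem h0 h1)
  rw [← wP_ofReal, ← wP'_ofReal, ← wE_ofReal] at h
  exact_mod_cast h

lemma wP'_re_ne_zero {x : ℝ} (h0 : 0 < x) (h1 : x < 1 / 2) : (wP' x).re ≠ 0 := by
  have h : 2 * (x : ℂ) ∉ O4 := by
    have := ofReal_notMem (x := 2 * x) (by linarith) (by linarith)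
    push_cast at this
    exact this
  intro h2
  apply wP'_ne_zero h
  rw [← wP'_ofReal, h2, ofReal_zero]

lemma tendsto_wP_re : Tendsto (fun x : ℝ => (wP x).re) (nhdsWithin 0 (Ioi 0)) atTop := by
  obtain ⟨g, hg, hg0, he⟩ := exists_wP_eq (zero_mem O4)
  have hc : Tendsto (fun x : ℝ => (x : ℂ)) (nhdsWithin 0 (Ioi 0)) (nhdsWithin 0 {0}ᶜ) := by
    refine tendsto_nhdsWithin_iff.2 ⟨?_, ?_⟩
    · simpa using (continuous_ofReal.tendsto 0).mono_left nhdsWithin_le_nhds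
    · filter_upwards [self_mem_nhdsWithin] with x hx
      simpa using (show (0 : ℝ) < x from hx).ne'
  have h1 : Tendsto (fun x : ℝ => (g x).re) (nhdsWithin 0 (Ioi 0)) (nhds 1) := by
    have h := (hg.continuousAt.tendsto.mono_left (nhdsWithin_le_nhds (s := {0}ᶜ))).comp hc
    rw [hg0] at h
    have h' := (continuous_re.tendsto 1).comp h
    rw [one_re] at h'
    exact h'
  have h2 : Tendsto (fun x : ℝ => (x ^ 2)⁻¹) (nhdsWithin 0 (Ioi 0)) atTop := by
    refine tendsto_inv_nhdsGT_zero.comp (tendsto_nhdsWithin_iff.2 ⟨?_, ?_⟩)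
    · have : Continuous fun x : ℝ => x ^ 2 := by fun_prop
      simpa using (this.tendsto 0).mono_left nhdsWithin_le_nhds
    · filter_upwards [self_mem_nhdsWithin] with x hx
      exact pow_pos (show (0 : ℝ) < x from hx) 2
  refine (h2.atTop_mul_pos one_pos h1).congr' ?_
  filter_upwards [hc.eventually he] with x hx
  rw [hx, sub_zero, show ((x : ℂ) ^ (-2 : ℤ)) = (((x ^ 2)⁻¹ : ℝ) : ℂ) by
    push_cast; rw [zpow_neg]; norm_cast, re_ofReal_mul]

lemma exists_wP_re_gt (y : ℝ) {d : ℝ} (hd : 0 < d) : ∃ x : ℝ, 0 < x ∧ x < d ∧ y < (wP x).re := by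
  have h : ∀ᶠ x in nhdsWithin (0 : ℝ) (Ioi 0), x ∈ Ioo 0 d := Ioo_mem_nhdsGT hd
  obtain ⟨x, ⟨h1, h2⟩, h3⟩ :=
    (h.and (tendsto_wP_re.eventually (eventually_gt_atTop y))).exists
  exact ⟨x, h1, h2, h3⟩

lemma continuousOn_wP_re : ContinuousOn (fun x : ℝ => (wP x).re) (Ioc 0 (1 / 2)) := fun x hx =>
  (hasDerivAt_wP_re hx.1 (by linarith [hx.2])).continuousAt.continuousWithinAt

lemma wP_half_re : (wP ((1 / 2 : ℝ) : ℂ)).re = wE.re := by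
  rw [wE]
  push_cast
  rfl

lemma strictAntiOn_wP_re : StrictAntiOn (fun x : ℝ => (wP x).re) (Ioc 0 (1 / 2)) := by
  have hd := hasDerivWithinAt_forall_lt_or_forall_gt_of_forall_ne (convex_Ioo (0 : ℝ) (1 / 2))
    (m := 0) (fun x hx => (hasDerivAt_wP_re hx.1 (by linarith [hx.2])).hasDerivWithinAt)
    (fun x hx => wP'_re_ne_zero hx.1 hx.2)
  rcases hd with hd | hd
  · refine strictAntiOn_of_deriv_neg (convex_Ioc _ _) continuousOn_wP_re fun x hx => ?_
    rw [interior_Ioc] at hx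
    rw [(hasDerivAt_wP_re hx.1 (by linarith [hx.2])).deriv]
    exact hd x hx
  · exfalso
    have hm : StrictMonoOn (fun x : ℝ => (wP x).re) (Ioc 0 (1 / 2)) := by
      refine strictMonoOn_of_deriv_pos (convex_Ioc _ _) continuousOn_wP_re fun x hx => ?_
      rw [interior_Ioc] at hx
      rw [(hasDerivAt_wP_re hx.1 (by linarith [hx.2])).deriv]
      exact hd x hx
    obtain ⟨x, h1, h2, h3⟩ := exists_wP_re_gt wE.re (d := 1 / 2) (by norm_num)
    have := hm ⟨h1, h2.le⟩ ⟨by norm_num, le_refl _⟩ h2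
    simp only [wP_half_re] at this
    linarith

lemma exists_wP_re_eq {y : ℝ} (hy : wE.re < y) : ∃ x : ℝ, 0 < x ∧ x < 1 / 2 ∧ (wP x).re = y := by
  obtain ⟨d, h1, h2, h3⟩ := exists_wP_re_gt y (d := 1 / 2) (by norm_num)
  have h := intermediate_value_Ioo' h2.le
    (continuousOn_wP_re.mono fun x hx => ⟨h1.trans_le hx.1, hx.2⟩)
  rw [wP_half_re] at h
  obtain ⟨x, hx, hxy⟩ := h ⟨hy, h3⟩
  exact ⟨x, h1.trans hx.1, hx.2, hxy⟩

lemma wE_re_pos : 0 < wE.re := by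
  by_contra h
  have h0 : wE.re ≠ 0 := fun h => wE_ne_zero (by rw [← wE_ofReal, h, ofReal_zero])
  obtain ⟨x, h1, h2, h3⟩ := exists_wP_re_eq (y := 0) (lt_of_le_of_ne (not_lt.1 h) h0)
  have h4 := wP'_re_sq h1 (by linarith)
  rw [h3, mul_zero, zero_mul] at h4
  exact wP'_re_ne_zero h1 h2 (by simpa using h4)

lemma wE_lt_wP_re {x : ℝ} (h0 : 0 < x) (h1 : x < 1 / 2) : wE.re < (wP x).re := by
  have := strictAntiOn_wP_re ⟨h0, h1.le⟩ ⟨by norm_num, le_refl _⟩ h1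
  simp only [wP_half_re] at this
  exact this

lemma varpi_eq_sqrt : varpi = Real.sqrt wE.re := by
  set e := wE.re with he
  have he0 : 0 < e := wE_re_pos
  set q : ℝ → ℝ := fun x => Real.sqrt (e / (wP x).re) with hq
  have hpos (x : ℝ) (hx : x ∈ Ioo (0 : ℝ) (1 / 2)) : e < (wP x).re := wE_lt_wP_re hx.1 hx.2
  have hderiv (x : ℝ) (hx : x ∈ Ioo (0 : ℝ) (1 / 2)) : HasDerivAt q
      ((-(e * (wP' x).re) / (wP x).re ^ 2) / (2 * Real.sqrt (e / (wP x).re))) x := by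
    have h1 := hpos x hx
    have h2 := (hasDerivAt_wP_re hx.1 (by linarith [hx.2]))
    have h3 : HasDerivAt (fun x : ℝ => e / (wP x).re) (-(e * (wP' x).re) / (wP x).re ^ 2) x := by
      convert! (hasDerivAt_const x e).div h2 (he0.trans h1).ne' using 1
      rw [zero_mul, zero_sub]
    exact h3.sqrt (div_pos he0 (he0.trans h1)).ne'
  have hinj : InjOn q (Ioo 0 (1 / 2)) := by
    intro x hx y hy hxy
    have h1 := hpos x hx
    have h2 := hpos y hy
    rw [hq] at hxy
    simp only at hxy
    rw [Real.sqrt_inj (div_pos he0 (he0.trans h1)).le (div_pos he0 (he0.trans h2)).le,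
      div_eq_div_iff (he0.trans h1).ne' (he0.trans h2).ne'] at hxy
    exact strictAntiOn_wP_re.injOn ⟨hx.1, hx.2.le⟩ ⟨hy.1, hy.2.le⟩
      (mul_left_cancel₀ he0.ne' hxy).symm
  have himg : q '' Ioo 0 (1 / 2) = Ioo 0 1 := by
    ext t
    constructor
    · rintro ⟨x, hx, rfl⟩
      have h1 := hpos x hx
      refine ⟨Real.sqrt_pos.2 (div_pos he0 (he0.trans h1)), ?_⟩
      rw [Real.sqrt_lt' one_pos, one_pow, div_lt_one (he0.trans h1)]
      exact h1
    · rintro ⟨h0, h1⟩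
      have ht : e < e / t ^ 2 := by
        rw [lt_div_iff₀ (by positivity)]
        have : t ^ 2 < 1 := by nlinarith
        nlinarith
      obtain ⟨x, hx0, hx1, hx⟩ := exists_wP_re_eq ht
      refine ⟨x, ⟨hx0, hx1⟩, ?_⟩
      rw [hq]
      simp only
      rw [hx, div_div_cancel₀ he0.ne', Real.sqrt_sq h0.le]
  have hconst : EqOn (fun x : ℝ => |(-(e * (wP' x).re) / (wP x).re ^ 2) /
      (2 * Real.sqrt (e / (wP x).re))| • (1 - q x ^ 4) ^ (-(1 : ℝ) / 2))
      (fun _ => Real.sqrt e) (Ioo 0 (1 / 2)) := by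
    intro x hx
    have h1 := hpos x hx
    have hP : 0 < (wP x).re := he0.trans h1
    have h3 := wP'_re_sq hx.1 (by linarith [hx.2])
    rw [← he] at h3
    simp only [smul_eq_mul]
    set P := (wP x).re
    set P' := (wP' x).re
    have hq2 : q x ^ 2 = e / P := Real.sq_sqrt (div_pos he0 hP).le
    have hq4 : q x ^ 4 = e ^ 2 / P ^ 2 := by
      rw [show q x ^ 4 = (q x ^ 2) ^ 2 by ring, hq2, div_pow]
    have hq1 : 0 < 1 - q x ^ 4 := by
      rw [hq4, sub_pos, div_lt_one (by positivity)]
      nlinarith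
    have hsq : (-(e * P') / P ^ 2 / (2 * Real.sqrt (e / P))) ^ 2 = e * (1 - q x ^ 4) := by
      rw [div_pow, mul_pow, Real.sq_sqrt (div_pos he0 hP).le, hq4, div_pow, neg_sq, mul_pow, h3]
      field_simp
      ring
    rw [← Real.sqrt_sq_eq_abs, hsq, Real.sqrt_mul he0.le, mul_assoc, neg_div,
      Real.rpow_neg hq1.le, ← Real.sqrt_eq_rpow, mul_inv_cancel₀ (Real.sqrt_ne_zero'.2 hq1), mul_one]
  have h_int := MeasureTheory.integral_image_eq_integral_abs_deriv_smul measurableSet_Ioo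
    (fun x hx => (hderiv x hx).hasDerivWithinAt) hinj (fun x : ℝ => (1 - x ^ 4) ^ (-(1 : ℝ) / 2))
  rw [himg, MeasureTheory.setIntegral_congr_fun measurableSet_Ioo hconst] at h_int
  rw [varpi, intervalIntegral.integral_of_le zero_le_one,
    MeasureTheory.integral_Ioc_eq_integral_Ioo, h_int]
  simp

lemma varpi_pos : 0 < varpi := by
  rw [varpi_eq_sqrt]
  exact Real.sqrt_pos.2 wE_re_pos

lemma varpi_ne_zero : varpi ≠ 0 := varpi_pos.ne'

lemma wE_eq : wE = (varpi : ℂ) ^ 2 := by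
  rw [← wE_ofReal, varpi_eq_sqrt, ← ofReal_pow, Real.sq_sqrt wE_re_pos.le]

lemma norm_wE : ‖wE‖ = varpi ^ 2 := by
  rw [wE_eq, norm_pow, norm_real, Real.norm_of_nonneg varpi_pos.le]

lemma varpi_coe_ne_zero : (varpi : ℂ) ≠ 0 := ofReal_ne_zero.2 varpi_ne_zero

lemma one_add_I_ne_zero : (1 + I : ℂ) ≠ 0 := fun h => by simpa using congrArg re h

lemma norm_one_add_I_sq : ‖(1 + I : ℂ)‖ ^ 2 = 2 := by
  rw [← normSq_eq_norm_sq, normSq_apply]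
  norm_num

lemma ekHalf_eq_phi4 {u : ℂ} (hu : 2 * u ∉ O4) :
    ekHalf u = -((varpi : ℂ) * (1 + I)) * phi4 u := by
  have hP' := wP'_ne_zero hu
  have hv := varpi_coe_ne_zero
  have hI : (1 + I) * (1 - I) = 2 := by linear_combination -I_sq
  rw [phi4, wp4_mul varpi_ne_zero, wp4'_mul, ← mul_right_inj' hP', mul_comm (wP' u) (ekHalf u),
    ekHalf_mul_wP' hu, wE_eq]
  field_simp
  linear_combination (-2 * wP u) * hI

lemma norm_ekHalf_eq {u : ℂ} (hu : 2 * u ∉ O4) :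
    ‖ekHalf u‖ ^ 8 = (2 * varpi ^ 2) ^ 4 * ‖phi4 u‖ ^ 8 := by
  rw [ekHalf_eq_phi4 hu, norm_mul, norm_neg, norm_mul, norm_real,
    Real.norm_of_nonneg varpi_pos.le, ← norm_one_add_I_sq]
  ring

lemma norm_gamma {π : ℂ} {p : ℕ} {S : Finset ℂ} {γ : ℂ} (h4 : p % 4 = 1)
    (h : IsGamma4 π p S γ) : ‖γ‖ = 1 := by
  have h8 : γ ^ 4 = 1 ∨ γ ^ 4 = -1 := by
    have : p % 8 = 5 ∨ p % 8 = 1 := by omega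
    rcases this with h5 | h1
    · exact Or.inl (h.1 h5).1
    · exact Or.inr (h.2 h1).1
  have : ‖γ‖ ^ 4 = 1 := by
    rw [← norm_pow]
    rcases h8 with h8 | h8 <;> simp [h8]
  exact (pow_eq_one_iff_of_nonneg (norm_nonneg _) (by norm_num)).1 this

lemma QDatum.norm_quarticRoot {p : ℕ} {π : ℂ} {χ : ℂ → ℂ} (D : QDatum p π χ)
    [Fact p.Prime] {S : Finset ℂ} (hS : IsQuarterSet π S) {γ : ℂ} (hγ : IsGamma4 π p S γ) :
    ‖γ⁻¹ * ∏ ν ∈ S, phi4 (ν / π)‖ ^ 8 = p := by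
  have h := D.norm_prod_quarterSet hS
  have hc := D.card_quarterSet hS
  have hmem : ∀ ν ∈ S, 2 * (ν / π) ∉ O4 := fun ν hν hn =>
    (D.not_gcong_zero_iff (hS.1 ν hν).1).1 (hS.1 ν hν).2 (D.gcong_zero_of_two_mul (hS.1 ν hν).1 hn)
  rw [← Finset.prod_pow, Finset.prod_congr rfl fun ν hν => norm_ekHalf_eq (hmem ν hν),
    Finset.prod_mul_distrib, Finset.prod_const, ← pow_mul, ← hc, norm_wE, Finset.prod_pow] at h
  have h2 : (2 * varpi ^ 2) ^ (p - 1) ≠ 0 := pow_ne_zero _ (by have := varpi_pos; positivity)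
  rw [norm_mul, norm_inv, norm_gamma D.mod4 hγ, inv_one, one_mul, norm_prod]
  rw [mul_comm (p : ℝ)] at h
  exact mul_left_cancel₀ h2 h

lemma lamInv_eq : lamInv = ((1 + I) ^ 3)⁻¹ := by
  have h : ((1 + I) ^ 3 : ℂ) ≠ 0 := pow_ne_zero 3 one_add_I_ne_zero
  rw [← mul_left_inj' h, inv_mul_cancel₀ h, lam_eq, lamInv]
  linear_combination -I_sq / 2

lemma add_mul_lamInv_notMem {u d : ℂ} (hu : 4 * u ∉ O4) (hd : d ∈ O4) : u + d * lamInv ∉ O4 := by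
  intro h
  apply hu
  have h4 : (4 : ℂ) ∈ O4 := by exact_mod_cast natCast_mem O4 4
  have := O4.add_mem (O4.mul_mem h4 h) (O4.mul_mem hd one_add_I_mem)
  convert! this using 1
  rw [lamInv]
  ring

lemma notMem_of_four_mul {u : ℂ} (hu : 4 * u ∉ O4) : u ∉ O4 := by
  have := add_mul_lamInv_notMem hu O4.zero_mem
  rwa [zero_mul, add_zero] at this

lemma two_mul_I_lamInv_notMem : 2 * (I * lamInv) ∉ O4 := by
  rw [show 2 * (I * lamInv) = I * (2 * lamInv) by ring, I_mul_mem_O4_iff]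
  exact two_mul_lamInv_notMem

lemma wP_sq_add_ne_zero {u : ℂ} (hu : 4 * u ∉ O4) : wP u ^ 2 + (varpi : ℂ) ^ 4 ≠ 0 := by
  have h1 : wP u - wP lamInv ≠ 0 := sub_ne_zero.2 (wP_ne two_mul_lamInv_notMem
    (notMem_of_four_mul hu) (by simpa using add_mul_lamInv_notMem hu O4.one_mem)
    (by simpa [sub_eq_add_neg] using add_mul_lamInv_notMem hu (O4.neg_mem O4.one_mem)))
  have h2 : wP u + wP lamInv ≠ 0 := by
    have := wP_ne two_mul_I_lamInv_notMem
      (notMem_of_four_mul hu) (add_mul_lamInv_notMem hu I_mem_O4)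
      (by simpa [sub_eq_add_neg] using add_mul_lamInv_notMem hu (O4.neg_mem I_mem_O4))
    rw [wP_I_mul] at this
    intro h
    exact this (eq_neg_of_add_eq_zero_left h)
  have h3 := mul_ne_zero h1 h2
  intro h
  apply h3
  have h4 := wP_lamInv_sq
  rw [wE_eq] at h4
  linear_combination h - h4

lemma ekDiff_lamInv {u : ℂ} (hu : 4 * u ∉ O4) :
    EK (u + lamInv) - EK (u - lamInv) =
      2 * EK lamInv - wP' lamInv * (wP u + wP lamInv) / (wP u ^ 2 + (varpi : ℂ) ^ 4) := by
  have h := wP_sub_mul_ekDiff two_mul_lamInv_notMem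
    (notMem_of_four_mul hu) (by simpa using add_mul_lamInv_notMem hu O4.one_mem)
    (by simpa [sub_eq_add_neg] using add_mul_lamInv_notMem hu (O4.neg_mem O4.one_mem))
  have h4 := wP_lamInv_sq
  rw [wE_eq] at h4
  have h0 := wP_sq_add_ne_zero hu
  rw [eq_sub_iff_add_eq, ← eq_sub_iff_add_eq', div_eq_iff h0]
  linear_combination (wP u + wP lamInv) * h +
    (EK (u + lamInv) - EK (u - lamInv) - 2 * EK lamInv) * h4

lemma ekDiff_I_lamInv {u : ℂ} (hu : 4 * u ∉ O4) :
    EK (u + I * lamInv) - EK (u - I * lamInv) =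
      -2 * I * EK lamInv - I * wP' lamInv * (wP u - wP lamInv) / (wP u ^ 2 + (varpi : ℂ) ^ 4) := by
  have h := wP_sub_mul_ekDiff two_mul_I_lamInv_notMem
    (notMem_of_four_mul hu) (add_mul_lamInv_notMem hu I_mem_O4)
    (by simpa [sub_eq_add_neg] using add_mul_lamInv_notMem hu (O4.neg_mem I_mem_O4))
  have h4 := wP_lamInv_sq
  rw [wE_eq] at h4
  rw [wP_I_mul, wP'_I_mul, EK_I_mul] at h
  have h0 := wP_sq_add_ne_zero hu
  rw [eq_sub_iff_add_eq, ← eq_sub_iff_add_eq', div_eq_iff h0]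
  linear_combination (wP u - wP lamInv) * h +
    (EK (u + I * lamInv) - EK (u - I * lamInv) + 2 * I * EK lamInv) * h4

lemma psi4_eq (u : ℂ) :
    psi4 u = (wP u + I * (varpi : ℂ) ^ 2) / (wP u - I * (varpi : ℂ) ^ 2) := by
  have hv := varpi_coe_ne_zero
  rw [psi4, wp4_mul varpi_ne_zero]
  rw [← mul_div_mul_left _ _ (pow_ne_zero 2 hv)]
  congr 1 <;> field_simp

lemma psi4_add (u : ℂ) {l : ℂ} (hl : l ∈ O4) : psi4 (u + l) = psi4 u := by
  rw [psi4_eq, psi4_eq, wP_add u hl]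

lemma wP_add_mul_sub_ne_zero {u : ℂ} (hu : 4 * u ∉ O4) :
    wP u + I * (varpi : ℂ) ^ 2 ≠ 0 ∧ wP u - I * (varpi : ℂ) ^ 2 ≠ 0 := by
  rw [← mul_ne_zero_iff]
  convert! wP_sq_add_ne_zero hu using 1
  linear_combination (-(varpi : ℂ) ^ 4) * I_sq

lemma psi4_add_psi4_I_mul {u : ℂ} (hu : 4 * u ∉ O4) :
    psi4 u + psi4 (I * u) = 2 - 4 * (varpi : ℂ) ^ 4 / (wP u ^ 2 + (varpi : ℂ) ^ 4) := by
  obtain ⟨h1, h2⟩ := wP_add_mul_sub_ne_zero hu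
  have h3 : -wP u - I * (varpi : ℂ) ^ 2 ≠ 0 := fun h => h1 (by linear_combination -h)
  have h0 := wP_sq_add_ne_zero hu
  rw [psi4_eq, psi4_eq, wP_I_mul]
  field_simp
  ring_nf
  simp only [I_sq]
  ring

lemma psi4_sub_psi4_I_mul {u : ℂ} (hu : 4 * u ∉ O4) :
    psi4 u - psi4 (I * u) = 4 * I * (varpi : ℂ) ^ 2 * wP u / (wP u ^ 2 + (varpi : ℂ) ^ 4) := by
  obtain ⟨h1, h2⟩ := wP_add_mul_sub_ne_zero hu
  have h3 : -wP u - I * (varpi : ℂ) ^ 2 ≠ 0 := fun h => h1 (by linear_combination -h)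
  have h0 := wP_sq_add_ne_zero hu
  rw [psi4_eq, psi4_eq, wP_I_mul]
  field_simp
  ring_nf
  simp only [I_pow_three]
  ring

/-- The average of `EK` over the translates by `W / (1 + i)³`, weighted by `χ₀`. -/
lemma ek_lam_sum {u : ℂ} (hu : 4 * u ∉ O4) :
    (EK (u + lamInv) - EK (u - lamInv)) + I * (EK (u + I * lamInv) - EK (u - I * lamInv)) =
      (4 * EK lamInv - wP' lamInv * wP lamInv / (varpi : ℂ) ^ 4) +
      wP' lamInv * wP lamInv / (2 * (varpi : ℂ) ^ 4) * (psi4 u + psi4 (I * u)) := by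
  have hv := varpi_coe_ne_zero
  have h0 := wP_sq_add_ne_zero hu
  rw [psi4_add_psi4_I_mul hu, ekDiff_lamInv hu, ekDiff_I_lamInv hu]
  field_simp
  ring_nf
  simp only [I_sq]
  ring

/-- The average of `EK` over the translates by `W / (1 + i)³`, weighted by `χ̄₀`. -/
lemma ek_lam_sum_conj {u : ℂ} (hu : 4 * u ∉ O4) :
    (EK (u + lamInv) - EK (u - lamInv)) - I * (EK (u + I * lamInv) - EK (u - I * lamInv)) =
      I * wP' lamInv / (2 * (varpi : ℂ) ^ 2) * (psi4 u - psi4 (I * u)) := by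
  have hv := varpi_coe_ne_zero
  have h0 := wP_sq_add_ne_zero hu
  rw [psi4_sub_psi4_I_mul hu, ekDiff_lamInv hu, ekDiff_I_lamInv hu]
  field_simp
  ring_nf
  simp only [I_sq]
  ring

lemma norm_wP'_lamInv_sq : ‖wP' lamInv‖ ^ 2 = 8 * varpi ^ 6 := by
  have h := congrArg (fun z : ℂ => ‖z‖) wP'_lamInv_sq
  simp only [norm_pow, norm_mul, norm_neg, norm_wP_lamInv, norm_wE, norm_ofNat] at h
  rw [h]
  ring

lemma GCong.unit_mul_cancel {a b c ε δ : ℂ} (hδ : δ ∈ O4) (hε : δ * ε = 1)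
    (h : GCong (ε * a) (ε * b) c) : GCong a b c := by
  obtain ⟨d, hd, h⟩ := h
  exact ⟨δ * d, O4.mul_mem hδ hd, by linear_combination δ * h - (a - b) * hε⟩

/-- Summation of a periodic function over a residue system is invariant under units. -/
lemma IsRes.sum_I_mul {ι : Type*} [Fintype ι] {β : ℂ} {ρ : ι → ℂ} (h : IsRes β ρ) {F : ℂ → ℂ}
    (hper : ∀ a ∈ O4, ∀ b ∈ O4, GCong a b β → F a = F b) :
    ∑ i, F (I * ρ i) = ∑ i, F (ρ i) := by
  choose τ hτ hu using fun i => h.cover (I * ρ i) (O4.mul_mem I_mem_O4 (h.mem i))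
  have hinj : Function.Injective τ := by
    intro i j hij
    refine h.eq_of_gcong (GCong.unit_mul_cancel (O4.neg_mem I_mem_O4) (ε := I) ?_ ?_)
    · linear_combination -I_sq
    · have h1 := hτ i
      have h2 := hτ j
      simp only at h1 h2
      rw [hij] at h1
      exact h1.trans h2.symm
  have hb := Finite.injective_iff_bijective.1 hinj
  rw [← (Equiv.ofBijective τ hb).sum_comp fun i => F (ρ i)]
  exact Finset.sum_congr rfl fun i _ =>
    hper _ (O4.mul_mem I_mem_O4 (h.mem i)) _ (h.mem _) (hτ i)

lemma EGS4_add (p : ℕ) (χ f g : ℂ → ℂ) (π : ℂ) :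
    EGS4 p χ (fun u => f u + g u) π = EGS4 p χ f π + EGS4 p χ g π := by
  simp only [EGS4, mul_add, Finset.sum_add_distrib]

lemma EGS4_const_mul (p : ℕ) (χ f : ℂ → ℂ) (c π : ℂ) :
    EGS4 p χ (fun u => c * f u) π = c * EGS4 p χ f π := by
  simp only [EGS4, Finset.mul_sum]
  exact Finset.sum_congr rfl fun _ _ => by ring

namespace QDatum

variable {p : ℕ} {π : ℂ} {χ : ℂ → ℂ}

lemma EGS4_const (h : QDatum p π χ) [Fact p.Prime] (c : ℂ) : EGS4 p χ (fun _ => c) π = 0 := by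
  rw [h.EGS4_eq, ← Finset.sum_mul]
  simp_rw [← h.cchar_apply]
  rw [MulChar.sum_eq_zero_of_ne_one h.cchar_ne_one, zero_mul, mul_zero]

lemma four_mul_notMem (h : QDatum p π χ) [NeZero p] {r : ZMod p} (hr : r ≠ 0) :
    4 * (((r.val : ℕ) : ℂ) / π) ∉ O4 := by
  intro h4
  apply h.val_ne_zero hr
  have hm : ((r.val : ℕ) : ℂ) ∈ O4 := natCast_mem O4 _
  have h2 : (2 : ℂ) ∈ O4 := by exact_mod_cast natCast_mem O4 2
  have h1 : GCong (2 * ((r.val : ℕ) : ℂ)) 0 π :=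
    h.gcong_zero_of_two_mul (O4.mul_mem h2 hm) (by convert! h4 using 1; ring)
  obtain ⟨d, hd, h1⟩ := h1
  refine h.gcong_zero_of_two_mul hm ?_
  convert! hd using 1
  rw [sub_zero] at h1
  rw [mul_div_assoc', h1, mul_div_cancel_left₀ _ h.ne_zero]

lemma EGS4_congr (h : QDatum p π χ) [Fact p.Prime] {f g : ℂ → ℂ}
    (hfg : ∀ u, 4 * u ∉ O4 → f u = g u) : EGS4 p χ f π = EGS4 p χ g π := by
  rw [h.EGS4_eq, h.EGS4_eq]
  refine congrArg _ (Finset.sum_congr rfl fun r _ => ?_)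
  by_cases hr : r = 0
  · simp [hr, h.chi_zero]
  · rw [hfg _ (h.four_mul_notMem hr)]

lemma EGS4_I_mul (h : QDatum p π χ) [Fact p.Prime] {f : ℂ → ℂ}
    (hper : ∀ u, ∀ l ∈ O4, f (u + l) = f u) :
    χ I * EGS4 p χ (fun u => f (I * u)) π = EGS4 p χ f π := by
  have hs := h.isRes.sum_I_mul (F := fun z => χ z * f (z / π)) fun a ha b hb hab => by
    rw [h.quartic.resChar.periodic a ha b hb hab]
    obtain ⟨d, hd, hab⟩ := hab
    rw [show a / π = b / π + d by field_simp [h.ne_zero]; linear_combination hab, hper _ d hd]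
  rw [h.EGS4_eq, h.EGS4_eq, ← hs, Finset.mul_sum, Finset.mul_sum, Finset.mul_sum]
  refine Finset.sum_congr rfl fun r _ => ?_
  rw [h.quartic.resChar.map_mul I I_mem_O4 _ (natCast_mem O4 _), mul_div_assoc]
  ring

lemma chi_I_eq (h : QDatum p π χ) : χ I = I ^ ((p - 1) / 4) := by
  have hc : GCoprime I π := ⟨-I, O4.neg_mem I_mem_O4, 0, O4.zero_mem, by
    linear_combination -I_sq⟩
  refine h.eq_of_gcong (h.quartic.quart I I_mem_O4 hc) ?_ (h.quartic.euler I I_mem_O4 hc)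
  rw [← pow_mul, mul_comm, pow_mul, I_pow_four, one_pow]

lemma chi_I_one (h : QDatum p π χ) (h1 : p % 16 = 1) : χ I = 1 := by
  rw [h.chi_I_eq, show (p - 1) / 4 = 4 * ((p - 1) / 16) by omega, pow_mul, I_pow_four, one_pow]

lemma chi_I_nine (h : QDatum p π χ) (h9 : p % 16 = 9) : χ I = -1 := by
  rw [h.chi_I_eq, show (p - 1) / 4 = 4 * ((p - 1) / 16) + 2 by omega, pow_add, pow_mul, I_pow_four,
    one_pow, one_mul, I_sq]

lemma norm_pi_sq (h : QDatum p π χ) : ‖π‖ ^ 2 = p := by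
  rw [← normSq_eq_norm_sq, h.normSq_eq]

lemma norm_lvalue (h : QDatum p π χ) {L : ℂ} (hL : IsLValue4 χ L) :
    ‖L‖ ^ 2 * p = varpi ^ 2 * ‖EGS4 p χ Z4 π‖ ^ 2 := by
  have : Fact p.Prime := ⟨h.prime⟩
  have e : EGS4 p χ EK π = varpi * EGS4 p χ Z4 π := by
    rw [← EGS4_const_mul]
    refine h.EGS4_congr fun u hu => ?_
    rw [Z4_eq varpi_ne_zero (notMem_of_four_mul hu), mul_inv_cancel_left₀ varpi_coe_ne_zero]
  have h0 : ‖π‖ ≠ 0 := norm_ne_zero_iff.2 h.ne_zero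
  rw [h.lvalue_eq hL, e, norm_mul, norm_mul, norm_inv, norm_real,
    Real.norm_of_nonneg varpi_pos.le, ← h.norm_pi_sq]
  field_simp

lemma norm_lvalue_of_twist (h : QDatum p π χ) {κ : Type*} [Fintype κ] {b : ℂ} {σ : κ → ℂ}
    {χb : ℂ → ℂ} {L : ℂ} (hbm : b ∈ O4) (hb0 : b ≠ 0) (hb : GCong π 1 b)
    (hσ : IsRes b σ) (cb : IsResChar4 b χb) (hL : IsLValue4 (fun z => χ z * χb z) L)
    {c : ℂ} {f : ℂ → ℂ}
    (hf : EGS4 p χ (fun u => ∑ k, χb (σ k) * EK (u + σ k / b)) π = c * EGS4 p χ f π) :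
    ‖L‖ ^ 2 * (p * ‖b‖ ^ 2) = ‖c‖ ^ 2 * ‖EGS4 p χ f π‖ ^ 2 := by
  have h0 : ‖π‖ ≠ 0 := norm_ne_zero_iff.2 h.ne_zero
  have h1 : ‖b‖ ≠ 0 := norm_ne_zero_iff.2 hb0
  have hc : ‖χ b‖ = 1 := by
    refine norm_of_pow_four (h.quartic.quart b hbm ?_)
    obtain ⟨u, hu, v, hv, huv⟩ := coprime_of_gcong hb
    exact ⟨v, hv, u, hu, by rw [← huv, add_comm]⟩
  rw [h.lvalue_twist_eq hbm hb0 hb hσ cb hL, hf, norm_mul, norm_mul, norm_mul, norm_inv, norm_mul,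
    hc, ← h.norm_pi_sq]
  field_simp

lemma norm_lvalue_two (h : QDatum p π χ) {χ₀' : ℂ → ℂ} (hχ : IsChi0'₄ χ₀') {L : ℂ}
    (hL : IsLValue4 (fun z => χ z * χ₀' z) L) :
    ‖L‖ ^ 2 * (2 * p) = varpi ^ 2 * ‖EGS4 p χ phi4 π‖ ^ 2 := by
  have : Fact p.Prime := ⟨h.prime⟩
  have h2 : (2 : ℂ) ∈ O4 := by exact_mod_cast natCast_mem O4 2
  have key := h.norm_lvalue_of_twist h2 two_ne_zero h.gcong_one_two isRes_two hχ.1 hL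
    (c := -((varpi : ℂ) * (1 + I))) (f := phi4) (by
      rw [← EGS4_const_mul]
      refine h.EGS4_congr fun u hu => ?_
      obtain ⟨v0, v1, v2, v3⟩ := hχ.values
      have hu2 : 2 * u ∉ O4 := fun hm => hu (by
        convert! O4.mul_mem h2 hm using 1
        ring)
      rw [← ekHalf_eq_phi4 hu2, Fin.sum_univ_four]
      simp only [resTwo, Matrix.cons_val_zero, Matrix.cons_val_one, Matrix.cons_val, v0, v1, v2, v3]
      simp [gi, ekHalf, sub_eq_add_neg])
  rw [norm_neg, norm_mul, mul_pow, norm_one_add_I_sq, norm_real,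
    Real.norm_of_nonneg varpi_pos.le, norm_ofNat] at key
  linarith

lemma sum_resLam {c : ℂ → ℂ} {ε : ℂ} (hv : ∀ k, c (gi (resLam k)) = ![1, ε, -1, -ε, 0, 0, 0, 0] k)
    (u : ℂ) : ∑ k, c (gi (resLam k)) * EK (u + gi (resLam k) / (1 + I) ^ 3) =
      (EK (u + lamInv) - EK (u - lamInv)) + ε * (EK (u + I * lamInv) - EK (u - I * lamInv)) := by
  simp only [hv, div_eq_mul_inv, ← lamInv_eq]
  simp only [Fin.sum_univ_eight, resLam, Matrix.cons_val_zero, Matrix.cons_val_one, Matrix.cons_val]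
  simp [gi, sub_eq_add_neg]
  ring

lemma norm_lvalue_lam (h : QDatum p π χ) (h1 : p % 16 = 1) {χ₀ : ℂ → ℂ} (hχ : IsChi0₄ χ₀) {L : ℂ}
    (hL : IsLValue4 (fun z => χ z * χ₀ z) L) :
    ‖L‖ ^ 2 * p = varpi ^ 2 * ‖EGS4 p χ psi4 π‖ ^ 2 := by
  have : Fact p.Prime := ⟨h.prime⟩
  have hl : (1 + I : ℂ) ^ 3 ≠ 0 := pow_ne_zero 3 one_add_I_ne_zero
  have key := h.norm_lvalue_of_twist (O4.pow_mem one_add_I_mem 3) hl h.primary isRes_lam hχ.1 hL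
    (c := wP' lamInv * wP lamInv / (varpi : ℂ) ^ 4) (f := psi4) (by
      rw [h.EGS4_congr fun u hu => (sum_resLam hχ.values u).trans (ek_lam_sum hu), EGS4_add,
        h.EGS4_const, zero_add, EGS4_const_mul, EGS4_add]
      have := h.EGS4_I_mul fun u l hl => psi4_add u hl
      rw [h.chi_I_one h1, one_mul] at this
      rw [this]
      field_simp [varpi_coe_ne_zero]
      ring)
  have hv := varpi_pos
  rw [norm_pow, norm_div, norm_mul, norm_wP_lamInv, norm_wE, norm_pow, norm_real,
    Real.norm_of_nonneg hv.le, div_pow, mul_pow, norm_wP'_lamInv_sq,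
    show (‖1 + I‖ ^ 3) ^ 2 = (‖1 + I‖ ^ 2) ^ 3 by ring, norm_one_add_I_sq] at key
  field_simp at key
  linarith

lemma norm_lvalue_lam_conj (h : QDatum p π χ) (h9 : p % 16 = 9) {χ₀ : ℂ → ℂ} (hχ : IsChi0₄ χ₀)
    {L : ℂ} (hL : IsLValue4 (fun z => χ z * (starRingEnd ℂ) (χ₀ z)) L) :
    ‖L‖ ^ 2 * p = varpi ^ 2 * ‖EGS4 p χ psi4 π‖ ^ 2 := by
  have : Fact p.Prime := ⟨h.prime⟩
  have hl : (1 + I : ℂ) ^ 3 ≠ 0 := pow_ne_zero 3 one_add_I_ne_zero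
  have key := h.norm_lvalue_of_twist (O4.pow_mem one_add_I_mem 3) hl h.primary isRes_lam
    hχ.1.conj hL (c := I * wP' lamInv / (varpi : ℂ) ^ 2) (f := psi4) (by
      have hv (k : Fin 8) :
          (starRingEnd ℂ) (χ₀ (gi (resLam k))) = ![1, -I, -1, - -I, 0, 0, 0, 0] k := by
        rw [hχ.values]
        fin_cases k <;> simp
      rw [h.EGS4_congr fun u hu => (sum_resLam (c := fun z => (starRingEnd ℂ) (χ₀ z)) hv u).trans
        (by rw [neg_mul, ← sub_eq_add_neg, ek_lam_sum_conj hu]), EGS4_const_mul]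
      simp_rw [sub_eq_add_neg, ← neg_one_mul (psi4 (I * _))]
      rw [EGS4_add, EGS4_const_mul]
      have := h.EGS4_I_mul fun u l hl => psi4_add u hl
      rw [h.chi_I_nine h9] at this
      rw [this]
      field_simp [varpi_coe_ne_zero]
      ring)
  have hv := varpi_pos
  rw [norm_pow, norm_div, norm_mul, norm_I, one_mul, norm_pow, norm_real,
    Real.norm_of_nonneg hv.le, div_pow, norm_wP'_lamInv_sq,
    show (‖1 + I‖ ^ 3) ^ 2 = (‖1 + I‖ ^ 2) ^ 3 by ring, norm_one_add_I_sq] at key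
  field_simp at key
  linarith

end QDatum

lemma norm_zeta8 : ‖zeta8‖ = 1 := by
  rw [zeta8, show 2 * (Real.pi : ℂ) * I / 8 = ((Real.pi / 4 : ℝ) : ℂ) * I by push_cast; ring,
    norm_exp_ofReal_mul_I]

lemma norm_sqrt_two_sq : ‖((Real.sqrt 2 : ℝ) : ℂ)‖ ^ 2 = 2 := by
  rw [norm_real, Real.norm_eq_abs, sq_abs, Real.sq_sqrt zero_le_two]

lemma norm_intCast_sq (a : ℤ) : ‖(a : ℂ)‖ ^ 2 = (a : ℝ) ^ 2 := by
  rw [norm_intCast, sq_abs]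

lemma sq_eq_of_norm_eq {p : ℕ} (hp : p ≠ 0) {L πt α E w G : ℂ} {k A : ℝ} (hk : k ≠ 0)
    (hpt : ‖πt‖ ^ 8 = p) (hα : α = (πt ^ 3)⁻¹ * E) (hA : ‖α‖ ^ 2 = A)
    (hn : ‖L‖ ^ 2 * (k * p) = varpi ^ 2 * ‖E‖ ^ 2)
    (hL : L ^ 2 = w * (Real.sqrt p : ℝ) / G * ((‖L‖ ^ 2 : ℝ) : ℂ)) :
    ((varpi : ℂ) ^ 2)⁻¹ * L ^ 2 =
      w * (((p : ℝ) ^ ((1 : ℝ) / 4) : ℝ) : ℂ) * ((A / k : ℝ) : ℂ) * G⁻¹ := by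
  have hp0 : (p : ℝ) ≠ 0 := Nat.cast_ne_zero.2 hp
  have hq : (p : ℝ) ^ ((1 : ℝ) / 4) = ‖πt‖ ^ 2 := by
    rw [← hpt, show ‖πt‖ ^ 8 = (‖πt‖ ^ 2) ^ 4 by ring, one_div]
    exact Real.pow_rpow_inv_natCast (by positivity) (by norm_num)
  have hs : Real.sqrt p = ‖πt‖ ^ 4 := by
    rw [← hpt, show ‖πt‖ ^ 8 = (‖πt‖ ^ 4) ^ 2 by ring, Real.sqrt_sq (by positivity)]
  have ht : ‖πt‖ ≠ 0 := by
    intro h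
    rw [h] at hpt
    exact hp0 (by rw [← hpt]; norm_num)
  have hv := varpi_ne_zero
  have hE : ‖E‖ ^ 2 = ‖πt‖ ^ 6 * A := by
    rw [← hA, hα, norm_mul, norm_inv, norm_pow]
    field_simp
  have hl : (varpi ^ 2)⁻¹ * (Real.sqrt p * ‖L‖ ^ 2) = ‖πt‖ ^ 2 * (A / k) := by
    rw [hE, ← hpt] at hn
    rw [hs]
    field_simp
    have h4 : ‖πt‖ ^ 4 * (‖πt‖ ^ 2 * ‖L‖ ^ 2 * k) = ‖πt‖ ^ 4 * (varpi ^ 2 * A) := by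
      have h2 : ‖πt‖ ^ 2 ≠ 0 := pow_ne_zero 2 ht
      apply mul_left_cancel₀ h2
      linear_combination hn
    have := mul_left_cancel₀ (pow_ne_zero 4 ht) h4
    linear_combination this
  have hl' := congrArg (fun x : ℝ => (x : ℂ)) hl
  rw [hL, hq]
  push_cast at hl' ⊢
  linear_combination w * G⁻¹ * hl'

namespace QDatum

variable {p : ℕ} {π : ℂ} {χ : ℂ → ℂ}

lemma G4sum_div (h : QDatum p π χ) [Fact p.Prime] :
    G4sum p χ / π = -χ (-1) * (Real.sqrt p : ℝ) / G4sum p χ := by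
  have h1 := h.G4sum_sq
  rw [div_eq_div_iff h.ne_zero h.G4sum_ne_zero]
  linear_combination h1

lemma chi_neg_one_of_five (h : QDatum p π χ) [Fact p.Prime] (h5 : p % 8 = 5) : χ (-1) = -1 := by
  rw [h.chi_neg_one, Odd.neg_one_pow (Nat.odd_iff.2 (by omega))]

lemma chi_neg_one_of_one (h : QDatum p π χ) [Fact p.Prime] (h1 : p % 8 = 1) : χ (-1) = 1 := by
  rw [h.chi_neg_one, Even.neg_one_pow (Nat.even_iff.2 (by omega))]

lemma chi_one_add_I_pow (h : QDatum p π χ) : χ (1 + I) ^ 4 = 1 := by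
  refine h.quartic.quart _ one_add_I_mem ?_
  obtain ⟨u, hu, v, hv, huv⟩ := coprime_of_gcong h.primary
  exact ⟨v * (1 + I) ^ 2, O4.mul_mem hv (O4.pow_mem one_add_I_mem 2), u, hu, by
    linear_combination huv⟩

lemma chi_lam (h : QDatum p π χ) : χ ((1 + I) ^ 3) = (starRingEnd ℂ) (χ (1 + I)) := by
  have hm := h.quartic.resChar.map_mul
  have e : χ ((1 + I) ^ 3) = χ (1 + I) ^ 3 := by
    rw [pow_succ, hm _ (O4.pow_mem one_add_I_mem 2) _ one_add_I_mem, pow_two,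
      hm _ one_add_I_mem _ one_add_I_mem]
    ring
  rw [e]
  rcases eq_of_pow_four h.chi_one_add_I_pow with h1 | h1 | h1 | h1 <;> rw [h1]
  · simp
  · norm_num
  · simp
  · rw [map_neg, conj_I]
    linear_combination (-I) * I_sq

lemma chi_I_mul_chi_two (h : QDatum p π χ) : χ I * χ 2 = χ (1 + I) ^ 2 := by
  have h2 : (2 : ℂ) ∈ O4 := by exact_mod_cast natCast_mem O4 2
  rw [pow_two, ← h.quartic.resChar.map_mul _ one_add_I_mem _ one_add_I_mem,
    ← h.quartic.resChar.map_mul _ I_mem_O4 _ h2]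
  congr 1
  linear_combination -I_sq

lemma lvalue_sq_five (h : QDatum p π χ) (h5 : p % 16 = 5) {L : ℂ} (hL : IsLValue4 χ L) :
    L ^ 2 = I * (Real.sqrt p : ℝ) / G4sum p χ * ((‖L‖ ^ 2 : ℝ) : ℂ) := by
  have : Fact p.Prime := ⟨h.prime⟩
  obtain ⟨a, ha, -, ha5, -⟩ := h.exists_re
  rw [h.lvalue_sq hL ha, mul_div_assoc, h.G4sum_div, ha5 h5, h.chi_neg_one_of_five (by omega)]
  simp only [map_neg, map_one]
  ring

lemma lvalue_sq_thirteen (h : QDatum p π χ) (h13 : p % 16 = 13) {χ₀' : ℂ → ℂ}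
    (hχ : IsChi0'₄ χ₀') {L : ℂ} (hL : IsLValue4 (fun z => χ z * χ₀' z) L) :
    L ^ 2 = I * χ 2 * (Real.sqrt p : ℝ) / G4sum p χ * ((‖L‖ ^ 2 : ℝ) : ℂ) := by
  have : Fact p.Prime := ⟨h.prime⟩
  have h2 : (2 : ℂ) ∈ O4 := by exact_mod_cast natCast_mem O4 2
  obtain ⟨a, ha, ha13, -⟩ := h.exists_re
  have hd := h.G4sum_div
  rw [h.chi_neg_one_of_five (by omega)] at hd
  rw [h.lvalue_twist_sq h2 two_ne_zero h.gcong_one_two isRes_two hχ.1 hL ha hχ.hasGauss, ha13 h13,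
    map_one]
  linear_combination (χ 2 * I * ((‖L‖ ^ 2 : ℝ) : ℂ)) * hd

lemma lvalue_sq_one (h : QDatum p π χ) (h1 : p % 16 = 1) {χ₀ : ℂ → ℂ}
    (hχ : IsChi0₄ χ₀) {L : ℂ} (hL : IsLValue4 (fun z => χ z * χ₀ z) L) :
    L ^ 2 = -(starRingEnd ℂ) (χ (1 + I)) * (Real.sqrt p : ℝ) / G4sum p χ *
      ((‖L‖ ^ 2 : ℝ) : ℂ) := by
  have : Fact p.Prime := ⟨h.prime⟩
  have hl : (1 + I : ℂ) ^ 3 ≠ 0 := pow_ne_zero 3 one_add_I_ne_zero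
  obtain ⟨a, ha, -, -, ha1, -⟩ := h.exists_re
  have hd := h.G4sum_div
  rw [h.chi_neg_one_of_one (by omega)] at hd
  have hg : -2 * (I * (1 - I)) / (1 + I) ^ 3 = I := by
    rw [div_eq_iff hl, lam_eq]
    ring
  rw [h.lvalue_twist_sq (O4.pow_mem one_add_I_mem 3) hl h.primary isRes_lam hχ.1 hL ha hχ.hasGauss,
    ha1 h1, map_one, h.chi_lam, mul_div_mul_comm, hg]
  linear_combination ((starRingEnd ℂ) (χ (1 + I)) * ((‖L‖ ^ 2 : ℝ) : ℂ)) * hd -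
    ((starRingEnd ℂ) (χ (1 + I)) * ((‖L‖ ^ 2 : ℝ) : ℂ)) * (G4sum p χ / π) * I_sq

lemma lvalue_sq_nine (h : QDatum p π χ) (h9 : p % 16 = 9) {χ₀ : ℂ → ℂ}
    (hχ : IsChi0₄ χ₀) {L : ℂ} (hL : IsLValue4 (fun z => χ z * (starRingEnd ℂ) (χ₀ z)) L) :
    L ^ 2 = I * (starRingEnd ℂ) (χ (1 + I)) * (Real.sqrt p : ℝ) / G4sum p χ *
      ((‖L‖ ^ 2 : ℝ) : ℂ) := by
  have : Fact p.Prime := ⟨h.prime⟩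
  have hl : (1 + I : ℂ) ^ 3 ≠ 0 := pow_ne_zero 3 one_add_I_ne_zero
  obtain ⟨a, ha, -, -, -, ha9⟩ := h.exists_re
  have hd := h.G4sum_div
  rw [h.chi_neg_one_of_one (by omega)] at hd
  have hg : -2 * (I * (1 - -I)) / (1 + I) ^ 3 = -1 := by
    rw [div_eq_iff hl, lam_eq]
    linear_combination -2 * I_sq
  rw [h.lvalue_twist_sq (O4.pow_mem one_add_I_mem 3) hl h.primary isRes_lam hχ.1.conj hL ha
    hχ.hasGauss_conj, ha9 h9, map_neg, map_one, h.chi_lam, mul_div_mul_comm, hg]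
  linear_combination (-I * (starRingEnd ℂ) (χ (1 + I)) * ((‖L‖ ^ 2 : ℝ) : ℂ)) * hd

end QDatum

end

/-- **Theorem II.5.** Let `π ∈ ℤ[i]` be a primary prime with `p = π·π̄`, let `χ̃_π` be
the associated Hecke character of weight one, and let `a_π` be the rational integer
attached to the elliptic Gauss sum coefficient (via Corollaries II.1 and II.2). Then
`ϖ⁻²·L(1, χ̃_π)²` equals: `2⁻¹·i·χ_π(2)·p^{1/4}·a_π²·G₄(π)⁻¹` if `p ≡ 13 (mod 16)`;
`i·p^{1/4}·a_π²·G₄(π)⁻¹` if `p ≡ 5 (mod 16)`;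
`−2·χ̄_π(1+i)·p^{1/4}·a_π²·G₄(π)⁻¹` if `p ≡ 1 (mod 16)` and `χ_π(2) = 1`;
`−χ̄_π(1+i)·p^{1/4}·a_π²·G₄(π)⁻¹` if `p ≡ 1 (mod 16)` and `χ_π(2) = −1`;
`2i·χ̄_π(1+i)·p^{1/4}·a_π²·G₄(π)⁻¹` if `p ≡ 9 (mod 16)` and `χ_π(2) = 1`; and
`i·χ̄_π(1+i)·p^{1/4}·a_π²·G₄(π)⁻¹` if `p ≡ 9 (mod 16)` and `χ_π(2) = −1`. -/
theorem stmt_19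
    (p : ℕ) (hp : p.Prime) (hp4 : p % 4 = 1)
    (π : ℂ) (hπ : π ∈ O4) (hprimary : GCong π 1 ((1 + Complex.I) ^ 3))
    (hnorm : (p : ℂ) = π * (starRingEnd ℂ) π)
    (χ : ℂ → ℂ) (hχ : IsQuarticChar π p χ)
    (χ₀ : ℂ → ℂ) (hχ₀ : IsChi0₄ χ₀)
    (χ₀' : ℂ → ℂ) (hχ₀' : IsChi0'₄ χ₀')
    (S : Finset ℂ) (hS : IsQuarterSet π S)
    (γ : ℂ) (hγ : IsGamma4 π p S γ)
    (πt : ℂ) (hπt : πt = γ⁻¹ * ∏ ν ∈ S, phi4 (ν / π))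
    (α₁₃ α₅ α₁ : ℂ)
    (hα₁₃ : α₁₃ = (πt ^ 3)⁻¹ * EGS4 p χ phi4 π)
    (hα₅ : α₅ = (πt ^ 3)⁻¹ * EGS4 p χ Z4 π)
    (hα₁ : α₁ = (πt ^ 3)⁻¹ * EGS4 p χ psi4 π)
    (a : ℤ)
    (ha₁₃ : p % 16 = 13 → α₁₃ = (a : ℂ))
    (ha₅ : p % 16 = 5 → α₅ = (a : ℂ) * χ (1 + Complex.I))
    (ha₁ : p % 16 = 1 →
      (χ (1 + Complex.I) = 1 → α₁ = (a : ℂ) * Complex.I * ((Real.sqrt 2 : ℝ) : ℂ)) ∧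
      (χ (1 + Complex.I) = -1 → α₁ = (a : ℂ) * ((Real.sqrt 2 : ℝ) : ℂ)) ∧
      (χ (1 + Complex.I) = Complex.I → α₁ = (a : ℂ) * zeta8) ∧
      (χ (1 + Complex.I) = -Complex.I → α₁ = (a : ℂ) * Complex.I * zeta8))
    (ha₉ : p % 16 = 9 →
      (χ (1 + Complex.I) = 1 → α₁ = (a : ℂ) * Complex.I * zeta8) ∧
      (χ (1 + Complex.I) = -1 → α₁ = (a : ℂ) * zeta8) ∧
      (χ (1 + Complex.I) = Complex.I →
        α₁ = (a : ℂ) * Complex.I * ((Real.sqrt 2 : ℝ) : ℂ)) ∧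
      (χ (1 + Complex.I) = -Complex.I → α₁ = (a : ℂ) * ((Real.sqrt 2 : ℝ) : ℂ))) :
    (p % 16 = 13 → ∀ L : ℂ, IsLValue4 (fun ν => χ ν * χ₀' ν) L →
      ((varpi : ℂ) ^ 2)⁻¹ * L ^ 2
        = (2 : ℂ)⁻¹ * Complex.I * χ 2 * (((p : ℝ) ^ ((1 : ℝ)/4) : ℝ) : ℂ) *
            (a : ℂ) ^ 2 * (G4sum p χ)⁻¹) ∧
    (p % 16 = 5 → ∀ L : ℂ, IsLValue4 χ L →
      ((varpi : ℂ) ^ 2)⁻¹ * L ^ 2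
        = Complex.I * (((p : ℝ) ^ ((1 : ℝ)/4) : ℝ) : ℂ) * (a : ℂ) ^ 2 *
            (G4sum p χ)⁻¹) ∧
    (p % 16 = 1 → ∀ L : ℂ, IsLValue4 (fun ν => χ ν * χ₀ ν) L →
      (χ 2 = 1 →
        ((varpi : ℂ) ^ 2)⁻¹ * L ^ 2
          = -2 * (starRingEnd ℂ) (χ (1 + Complex.I)) *
              (((p : ℝ) ^ ((1 : ℝ)/4) : ℝ) : ℂ) * (a : ℂ) ^ 2 * (G4sum p χ)⁻¹) ∧
      (χ 2 = -1 →
        ((varpi : ℂ) ^ 2)⁻¹ * L ^ 2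
          = -((starRingEnd ℂ) (χ (1 + Complex.I))) *
              (((p : ℝ) ^ ((1 : ℝ)/4) : ℝ) : ℂ) * (a : ℂ) ^ 2 * (G4sum p χ)⁻¹)) ∧
    (p % 16 = 9 → ∀ L : ℂ, IsLValue4 (fun ν => χ ν * (starRingEnd ℂ) (χ₀ ν)) L →
      (χ 2 = 1 →
        ((varpi : ℂ) ^ 2)⁻¹ * L ^ 2
          = 2 * Complex.I * (starRingEnd ℂ) (χ (1 + Complex.I)) *
              (((p : ℝ) ^ ((1 : ℝ)/4) : ℝ) : ℂ) * (a : ℂ) ^ 2 * (G4sum p χ)⁻¹) ∧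
      (χ 2 = -1 →
        ((varpi : ℂ) ^ 2)⁻¹ * L ^ 2
          = Complex.I * (starRingEnd ℂ) (χ (1 + Complex.I)) *
              (((p : ℝ) ^ ((1 : ℝ)/4) : ℝ) : ℂ) * (a : ℂ) ^ 2 * (G4sum p χ)⁻¹)) := by
  have D : QDatum p π χ := ⟨hp, hp4, hπ, hprimary, hnorm, hχ⟩
  have : Fact p.Prime := ⟨hp⟩
  have hpt : ‖πt‖ ^ 8 = p := by
    rw [hπt]
    exact D.norm_quarticRoot hS hγ
  have hχ4 := eq_of_pow_four D.chi_one_add_I_pow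
  have hχ2 := D.chi_I_mul_chi_two
  have hA2 (h : χ (1 + I) ^ 2 = 1 ∧ p % 16 = 1 ∨ χ (1 + I) ^ 2 = -1 ∧ p % 16 = 9) :
      ‖α₁‖ ^ 2 = 2 * (a : ℝ) ^ 2 := by
    rcases h with ⟨h, h1⟩ | ⟨h, h9⟩
    · rcases hχ4 with hx | hx | hx | hx
      · rw [(ha₁ h1).1 hx, norm_mul, norm_mul, mul_pow, mul_pow, norm_intCast_sq,
          norm_sqrt_two_sq, norm_I]
        ring
      · rw [(ha₁ h1).2.1 hx, norm_mul, mul_pow, norm_intCast_sq, norm_sqrt_two_sq]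
        ring
      all_goals
        rw [hx] at h
        norm_num at h
    · rcases hχ4 with hx | hx | hx | hx
      · rw [hx] at h
        norm_num at h
      · rw [hx] at h
        norm_num at h
      · rw [(ha₉ h9).2.2.1 hx, norm_mul, norm_mul, mul_pow, mul_pow, norm_intCast_sq,
          norm_sqrt_two_sq, norm_I]
        ring
      · rw [(ha₉ h9).2.2.2 hx, norm_mul, mul_pow, norm_intCast_sq, norm_sqrt_two_sq]
        ring
  have hA1 (h : χ (1 + I) ^ 2 = -1 ∧ p % 16 = 1 ∨ χ (1 + I) ^ 2 = 1 ∧ p % 16 = 9) :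
      ‖α₁‖ ^ 2 = (a : ℝ) ^ 2 := by
    rcases h with ⟨h, h1⟩ | ⟨h, h9⟩
    · rcases hχ4 with hx | hx | hx | hx
      · rw [hx] at h
        norm_num at h
      · rw [hx] at h
        norm_num at h
      · rw [(ha₁ h1).2.2.1 hx, norm_mul, mul_pow, norm_intCast_sq, norm_zeta8]
        ring
      · rw [(ha₁ h1).2.2.2 hx, norm_mul, norm_mul, mul_pow, mul_pow, norm_intCast_sq,
          norm_zeta8, norm_I]
        ring
    · rcases hχ4 with hx | hx | hx | hx
      · rw [(ha₉ h9).1 hx, norm_mul, norm_mul, mul_pow, mul_pow, norm_intCast_sq,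
          norm_zeta8, norm_I]
        ring
      · rw [(ha₉ h9).2.1 hx, norm_mul, mul_pow, norm_intCast_sq, norm_zeta8]
        ring
      all_goals
        rw [hx] at h
        norm_num at h
  refine ⟨fun h13 L hL => ?_, fun h5 L hL => ?_, fun h1 L hL => ⟨fun h2 => ?_, fun h2 => ?_⟩,
    fun h9 L hL => ⟨fun h2 => ?_, fun h2 => ?_⟩⟩
  · rw [sq_eq_of_norm_eq hp.ne_zero two_ne_zero hpt hα₁₃
      (by rw [ha₁₃ h13, norm_intCast_sq]) (D.norm_lvalue_two hχ₀' hL)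
      (D.lvalue_sq_thirteen h13 hχ₀' hL)]
    push_cast
    ring
  · have hA : ‖α₅‖ ^ 2 = (a : ℝ) ^ 2 := by
      rw [ha₅ h5, norm_mul, mul_pow, norm_intCast_sq, norm_of_pow_four D.chi_one_add_I_pow]
      ring
    rw [sq_eq_of_norm_eq hp.ne_zero one_ne_zero hpt hα₅ hA
      (by rw [one_mul]; exact D.norm_lvalue hL) (D.lvalue_sq_five h5 hL)]
    push_cast
    ring
  · rw [D.chi_I_one h1, h2] at hχ2
    rw [sq_eq_of_norm_eq hp.ne_zero one_ne_zero hpt hα₁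
      (hA2 (Or.inl ⟨by linear_combination -hχ2, h1⟩))
      (by rw [one_mul]; exact D.norm_lvalue_lam h1 hχ₀ hL) (D.lvalue_sq_one h1 hχ₀ hL)]
    push_cast
    ring
  · rw [D.chi_I_one h1, h2] at hχ2
    rw [sq_eq_of_norm_eq hp.ne_zero one_ne_zero hpt hα₁
      (hA1 (Or.inl ⟨by linear_combination -hχ2, h1⟩))
      (by rw [one_mul]; exact D.norm_lvalue_lam h1 hχ₀ hL) (D.lvalue_sq_one h1 hχ₀ hL)]
    push_cast
    ring
  · rw [D.chi_I_nine h9, h2] at hχ2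
    rw [sq_eq_of_norm_eq hp.ne_zero one_ne_zero hpt hα₁
      (hA2 (Or.inr ⟨by linear_combination -hχ2, h9⟩))
      (by rw [one_mul]; exact D.norm_lvalue_lam_conj h9 hχ₀ hL) (D.lvalue_sq_nine h9 hχ₀ hL)]
    push_cast
    ring
  · rw [D.chi_I_nine h9, h2] at hχ2
    rw [sq_eq_of_norm_eq hp.ne_zero one_ne_zero hpt hα₁
      (hA1 (Or.inr ⟨by linear_combination -hχ2, h9⟩))
      (by rw [one_mul]; exact D.norm_lvalue_lam_conj h9 hχ₀ hL) (D.lvalue_sq_nine h9 hχ₀ hL)]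
    push_cast
    ring

end
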